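/- Let f ∈ ℤ[X] be a nonconstant separable polynomial (f has no repeated roots over ℚ) all of whose irreducible factors over ℚ have degree at most 6. Then (unconditionally) there exists N₀ ∈ ℕ such that for every prime p ≥ N₀ and every integer k with p ∤ k, there are infinitely many squarefree integers d with d ≡ k (mod p) such that there exist x, y ∈ ℚ with y ≠ 0 and d·y² = f(x). -/

import Mathlib

open Polynomial

namespace TwistSieve

section Stepanov

variable {K : Type*} [Field K]

/-- The coefficient of `h ^ (N - m)` in the `m`-th derivative of `r * h ^ N`. -/
noncomputable def derivCoeff (h : K[X]) (N : ℕ) : ℕ → K[X] → K[X]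
  | 0, r => r
  | m + 1, r => derivative (derivCoeff h N m r) * h +
      C ((N - m : ℕ) : K) * derivCoeff h N m r * derivative h

lemma iterate_derivative_mul_pow {h r G : K[X]} (hG : derivative G = 0) (N m : ℕ) (hm : m ≤ N) :
    derivative^[m] (r * G * h ^ N) = derivCoeff h N m r * G * h ^ (N - m) := by
  induction m with
  | zero => simp [derivCoeff]
  | succ m ih =>
    rw [Function.iterate_succ_apply', ih (by omega)]
    obtain ⟨k, hk⟩ : ∃ k, N - m = k + 1 := ⟨N - m - 1, by omega⟩
    have hk' : N - (m + 1) = k := by omega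
    simp only [derivCoeff, derivative_mul, hG, derivative_pow, hk, hk']
    simp
    ring

lemma natDegree_derivCoeff_le {h r : K[X]} {n d : ℕ} (hn : h.natDegree ≤ n)
    (hd : r.natDegree ≤ d) (N m : ℕ) : (derivCoeff h N m r).natDegree ≤ d + m * n := by
  induction m with
  | zero => simpa [derivCoeff] using hd
  | succ m ih =>
    have e : d + (m + 1) * n = (d + m * n) + n := by ring
    rw [e]
    refine natDegree_add_le_of_degree_le ?_ ?_
    · exact natDegree_mul_le_of_le ((natDegree_derivative_le _).trans (by omega)) hn
    · exact natDegree_mul_le_of_le ((natDegree_C_mul_le _ _).trans ih)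
        ((natDegree_derivative_le _).trans (by omega))

lemma eq_zero_of_sum_valuation {ι : Type*} [Fintype ι] {α : K} {e : ι → ℕ}
    (he : Function.Injective e) {u : ι → K[X]} (hu : ∀ s, (u s).eval α ≠ 0) {v : ι → K}
    (h : ∑ s, C (v s) * ((X - C α) ^ e s * u s) = 0) : v = 0 := by
  classical
  by_contra hv
  obtain ⟨s₁, hs₁⟩ : ∃ s, v s ≠ 0 := by
    by_contra! hc
    exact hv (funext hc)
  obtain ⟨s₀, hs₀, hmin⟩ := Finset.exists_min_image (Finset.univ.filter fun s => v s ≠ 0) e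
    ⟨s₁, by simpa using hs₁⟩
  simp only [Finset.mem_filter, Finset.mem_univ, true_and] at hs₀ hmin
  have hdvd : (X - C α) ^ (e s₀ + 1) ∣
      ∑ s ∈ Finset.univ.erase s₀, C (v s) * ((X - C α) ^ e s * u s) := by
    refine Finset.dvd_sum fun s hs => ?_
    by_cases hvs : v s = 0
    · simp [hvs]
    have hne : e s ≠ e s₀ := fun h => (Finset.ne_of_mem_erase hs) (he h)
    have := hmin s hvs
    exact Dvd.dvd.mul_left (Dvd.dvd.mul_right (pow_dvd_pow _ (by omega)) _) _
  rw [← Finset.add_sum_erase _ _ (Finset.mem_univ s₀)] at h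
  have h1 : (X - C α) ^ (e s₀ + 1) ∣ C (v s₀) * ((X - C α) ^ e s₀ * u s₀) := by
    rw [eq_neg_of_add_eq_zero_left h]
    exact hdvd.neg_right
  have h2 : (X - C α) ∣ C (v s₀) * u s₀ := by
    rw [pow_succ, show C (v s₀) * ((X - C α) ^ e s₀ * u s₀) =
      (X - C α) ^ e s₀ * (C (v s₀) * u s₀) by ring] at h1
    exact (mul_dvd_mul_iff_left (pow_ne_zero _ (X_sub_C_ne_zero α))).1 h1
  rw [dvd_iff_isRoot, IsRoot, eval_mul, eval_C] at h2
  exact mul_ne_zero hs₀ (hu s₀) h2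

lemma card_mul_le_natDegree {P : K[X]} (hP : P ≠ 0) (T : Finset K) (M : ℕ)
    (h : ∀ t ∈ T, (X - C t) ^ M ∣ P) : T.card * M ≤ P.natDegree := by
  have hd : ∏ t ∈ T, (X - C t) ^ M ∣ P := by
    refine Finset.prod_dvd_of_coprime ?_ h
    intro a _ b _ hab
    exact (pairwise_coprime_X_sub_C Function.injective_id hab).pow
  have := natDegree_le_of_dvd hd hP
  rw [natDegree_prod_of_monic _ _ fun t _ => (monic_X_sub_C t).pow M] at this
  simpa [natDegree_pow] using this

lemma pow_dvd_of_iterate_derivative {p : ℕ} [CharP K p] (hp : p.Prime) {P : K[X]} (hP : P ≠ 0)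
    {M : ℕ} (hM : M ≤ p) {t : K} (h : ∀ m < M, (derivative^[m] P).eval t = 0) :
    (X - C t) ^ M ∣ P := by
  rcases M with _ | M
  · simp
  rw [← le_rootMultiplicity_iff hP]
  refine lt_rootMultiplicity_of_isRoot_iterate_derivative_of_mem_nonZeroDivisors hP
    (fun m hm => h m (by omega)) ?_
  rw [mem_nonZeroDivisors_iff_ne_zero, Ne, CharP.cast_eq_zero_iff K p, hp.dvd_factorial]
  omega

/-- Stepanov's method: the auxiliary polynomial argument. -/
lemma stepanov_aux {p : ℕ} [CharP K p] (hp : p.Prime) {n e q M J B : ℕ} (he : 0 < e)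
    (hpq : p = e * q + 1) {h : K[X]} (hn : h.natDegree ≤ n) {α : K} (hα : h.eval α = 0)
    (hα' : (derivative h).eval α ≠ 0) (c : K) (T : Finset K)
    (hT : ∀ t ∈ T, t ^ p = t ∧ ∑ i ∈ Finset.range e, (h.eval t ^ q) ^ i * c ^ (e - 1 - i) = 0)
    (hM : M ≤ p) (hB : B ≤ q) (hJ : 0 < J)
    (hdim : M * (e - 1) * (B + M * n + J) < e * (J * B)) :
    T.card * M ≤ B + p * (J - 1) + n * (q * (e - 1) + M) := by
  classical
  have : Fact p.Prime := ⟨hp⟩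
  have : ExpChar K p := ExpChar.prime hp
  -- the parametrised family of auxiliary polynomials
  let N : Fin e → ℕ := fun i => q * i + M
  let Pc : Fin e → ℕ → (Fin e × Fin J × Fin B → K) →ₗ[K] K[X] := fun i m =>
    { toFun := fun v => ∑ j : Fin J, ∑ b : Fin B, C (v (i, j, b)) *
        (derivCoeff h (N i) m ((X - C α) ^ (b : ℕ)) * (X - C (α ^ p)) ^ (j : ℕ))
      map_add' := fun v w => by simp [add_mul, Finset.sum_add_distrib]
      map_smul' := fun a v => by
        simp only [Pi.smul_apply, smul_eq_mul, C_mul, RingHom.id_apply, Finset.smul_sum,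
          smul_eq_C_mul, mul_assoc] }
  let last : Fin e := ⟨e - 1, by omega⟩
  let Φ : (Fin e × Fin J × Fin B → K) →ₗ[K] (Fin M × Fin (e - 1) × Fin (B + M * n + J) → K) :=
    LinearMap.pi fun x => (lcoeff K x.2.2) ∘ₗ
      (Pc ⟨x.2.1, by omega⟩ x.1 - c ^ (e - 1 - x.2.1 : ℕ) • Pc last x.1)
  obtain ⟨v, hvΦ, hv0⟩ : ∃ v, v ∈ LinearMap.ker Φ ∧ v ≠ 0 := by
    refine (Submodule.ne_bot_iff _).1 (LinearMap.ker_ne_bot_of_finrank_lt ?_)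
    simp only [Module.finrank_fintype_fun_eq_card, Fintype.card_prod, Fintype.card_fin]
    rw [← mul_assoc]
    exact hdim
  have hdeg : ∀ i, ∀ m ≤ M, (Pc i m v).natDegree < B + M * n + J := by
    intro i m hm
    have : (Pc i m v).natDegree ≤ B + M * n + (J - 1) := by
      simp only [Pc, LinearMap.coe_mk, AddHom.coe_mk]
      refine natDegree_sum_le_of_forall_le _ _ fun j _ =>
        natDegree_sum_le_of_forall_le _ _ fun b _ => ?_
      refine (natDegree_C_mul_le _ _).trans (natDegree_mul_le_of_le ?_ ?_)
      · refine (natDegree_derivCoeff_le hn (d := B) ?_ _ _).trans ?_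
        · rw [natDegree_pow, natDegree_X_sub_C]; omega
        · have := Nat.mul_le_mul_right n hm
          omega
      · rw [natDegree_pow, natDegree_X_sub_C]; omega
    omega
  have hrel : ∀ i : Fin e, ∀ m < M, Pc i m v = C (c ^ (e - 1 - i : ℕ)) * Pc last m v := by
    intro i m hm
    by_cases hi : (i : ℕ) < e - 1
    · ext k
      rw [← sub_eq_zero, ← coeff_sub]
      by_cases hk : k < B + M * n + J
      · have := congrFun (LinearMap.mem_ker.1 hvΦ) (⟨m, hm⟩, ⟨i, hi⟩, ⟨k, hk⟩)
        simpa [Φ, smul_eq_C_mul] using this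
      · rw [coeff_sub, coeff_C_mul,
          coeff_eq_zero_of_natDegree_lt ((hdeg _ _ hm.le).trans_le (by omega)),
          coeff_eq_zero_of_natDegree_lt ((hdeg _ _ hm.le).trans_le (by omega))]
        simp
    · have : i = last := Fin.ext (by simp [last]; omega)
      subst this
      simp [last]
  have hfrob : ∀ j : ℕ, (X - C α) ^ (p * j) = (X ^ p - C (α ^ p)) ^ j := by
    intro j
    rw [pow_mul, sub_pow_expChar, C_pow]
  let R : K[X] := ∑ i : Fin e, ∑ j : Fin J, ∑ b : Fin B, C (v (i, j, b)) *
    ((X - C α) ^ (b : ℕ) * (X - C α) ^ (p * (j : ℕ)) * h ^ N i)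
  have hRne : R ≠ 0 := by
    intro hR
    obtain ⟨g, hg⟩ : (X - C α) ∣ h := dvd_iff_isRoot.2 hα
    have hgα : g.eval α ≠ 0 := by
      rw [hg] at hα'
      simpa using hα'
    apply hv0
    refine eq_zero_of_sum_valuation (α := α) (e := fun s : Fin e × Fin J × Fin B =>
      (s.2.2 : ℕ) + p * s.2.1 + N s.1) ?_ (u := fun s => g ^ N s.1) (fun s => by simp [hgα]) ?_
    · rintro ⟨i, j, b⟩ ⟨i', j', b'⟩ hs
      simp only [N] at hs
      have hb := b.2
      have hb' := b'.2
      have hi := i.2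
      have hi' := i'.2
      have hs1 : ((b : ℕ) + q * i) + p * j = ((b' : ℕ) + q * i') + p * j' := by omega
      have hlt : ∀ (b i : ℕ), b < B → i < e → b + q * i < p := by
        intro b i hb hi
        have : q * (i + 1) ≤ q * e := Nat.mul_le_mul_left _ hi
        rw [hpq]
        nlinarith
      have hmod := congrArg (· % p) hs1
      have hdiv := congrArg (· / p) hs1
      simp only [Nat.add_mul_mod_self_left, Nat.add_mul_div_left _ _ hp.pos,
        Nat.mod_eq_of_lt (hlt _ _ hb hi), Nat.mod_eq_of_lt (hlt _ _ hb' hi'),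
        Nat.div_eq_of_lt (hlt _ _ hb hi), Nat.div_eq_of_lt (hlt _ _ hb' hi'), zero_add] at hmod hdiv
      have hq : 0 < q := by omega
      have hmod2 := congrArg (· % q) hmod
      have hdiv2 := congrArg (· / q) hmod
      simp only [Nat.add_mul_mod_self_left, Nat.add_mul_div_left _ _ hq,
        Nat.mod_eq_of_lt (hb.trans_le hB), Nat.mod_eq_of_lt (hb'.trans_le hB),
        Nat.div_eq_of_lt (hb.trans_le hB), Nat.div_eq_of_lt (hb'.trans_le hB),
        zero_add] at hmod2 hdiv2
      simp [Fin.ext_iff, hdiv, hmod2, hdiv2]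
    · rw [Fintype.sum_prod_type]
      simp only [Fintype.sum_prod_type]
      rw [← hR]
      refine Finset.sum_congr rfl fun i _ => Finset.sum_congr rfl fun j _ =>
        Finset.sum_congr rfl fun b _ => ?_
      rw [hg, mul_pow]
      ring
  have hRderiv : ∀ m ≤ M, derivative^[m] R = ∑ i : Fin e, ∑ j : Fin J, ∑ b : Fin B,
      C (v (i, j, b)) * (derivCoeff h (N i) m ((X - C α) ^ (b : ℕ)) *
        (X ^ p - C (α ^ p)) ^ (j : ℕ) * h ^ (N i - m)) := by
    intro m hm
    simp only [R, iterate_derivative_sum, iterate_derivative_C_mul]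
    refine Finset.sum_congr rfl fun i _ => Finset.sum_congr rfl fun j _ =>
        Finset.sum_congr rfl fun b _ => ?_
    rw [iterate_derivative_mul_pow _ _ _ (by simp only [N]; omega), hfrob]
    rw [derivative_pow]
    simp
  have hvanish : ∀ t ∈ T, (X - C t) ^ M ∣ R := by
    intro t ht
    obtain ⟨htp, hsum⟩ := hT t ht
    refine pow_dvd_of_iterate_derivative hp hRne hM fun m hm => ?_
    rw [hRderiv m hm.le]
    have key : ∀ i : Fin e, eval t (∑ j : Fin J, ∑ b : Fin B,
      C (v (i, j, b)) * (derivCoeff h (N i) m ((X - C α) ^ (b : ℕ)) *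
        (X ^ p - C (α ^ p)) ^ (j : ℕ) * h ^ (N i - m))) =
        eval t (Pc last m v) * h.eval t ^ (M - m) *
          ((h.eval t ^ q) ^ (i : ℕ) * c ^ (e - 1 - i : ℕ)) := by
      intro i
      have h1 : eval t (∑ j : Fin J, ∑ b : Fin B,
        C (v (i, j, b)) * (derivCoeff h (N i) m ((X - C α) ^ (b : ℕ)) *
        (X ^ p - C (α ^ p)) ^ (j : ℕ) * h ^ (N i - m))) =
          eval t (Pc i m v) * h.eval t ^ (N i - m) := by
        simp only [Pc, LinearMap.coe_mk, AddHom.coe_mk, eval_finsetSum, Finset.sum_mul, eval_mul,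
          eval_pow, eval_sub, eval_X, eval_C, htp]
        refine Finset.sum_congr rfl fun j _ => Finset.sum_congr rfl fun b _ => ?_
        ring
      rw [h1, hrel i m hm, eval_mul, eval_C,
        show N i - m = q * i + (M - m) by simp only [N]; omega, pow_add, pow_mul]
      ring
    rw [eval_finsetSum, Finset.sum_congr rfl fun i _ => key i, ← Finset.mul_sum,
      Fin.sum_univ_eq_sum_range (fun i => (h.eval t ^ q) ^ i * c ^ (e - 1 - i)) e, hsum, mul_zero]
  refine (card_mul_le_natDegree hRne T M hvanish).trans ?_
  refine natDegree_sum_le_of_forall_le _ _ fun i _ => natDegree_sum_le_of_forall_le _ _ fun j _ =>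
    natDegree_sum_le_of_forall_le _ _ fun b _ => ?_
  refine (natDegree_C_mul_le _ _).trans (natDegree_mul_le_of_le (natDegree_mul_le_of_le ?_ ?_) ?_)
  · rw [natDegree_pow, natDegree_X_sub_C]; omega
  · rw [natDegree_pow, natDegree_X_sub_C, mul_one]
    exact Nat.mul_le_mul_left _ (by omega)
  · rw [mul_comm]
    refine natDegree_pow_le_of_le _ hn |>.trans ?_
    have h1 : q * (i : ℕ) ≤ q * (e - 1) := Nat.mul_le_mul_left _ (by omega)
    have h2 : N i ≤ q * (e - 1) + M := by simp only [N]; omega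
    nlinarith

end Stepanov

/-- A positive proportion of the values of a separable polynomial modulo `p` lie in any given coset
of the subgroup of `e`-th powers. -/
lemma card_values_in_coset (n : ℕ) (hn0 : 0 < n) : ∃ P₀ D : ℕ, 0 < D ∧ ∀ (p : ℕ) [Fact p.Prime],
    P₀ ≤ p → ∀ e q : ℕ, 0 < e → e ≤ n → p = e * q + 1 → ∀ h : (ZMod p)[X], h.natDegree ≤ n →
    0 < h.natDegree → h.Separable → ∀ c : ZMod p, c ≠ 0 →
    p ≤ D * (Finset.univ.filter fun t : ZMod p => h.eval t ≠ 0 ∧ h.eval t ^ q = c ^ q).card := by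
  classical
  obtain ⟨M, hM⟩ : ∃ M, M = 2 * n ^ 2 := ⟨_, rfl⟩
  obtain ⟨B, hB⟩ : ∃ B, B = 8 * n ^ 4 + 1 := ⟨_, rfl⟩
  refine ⟨4 * n * M + 2 * B + n * B + M + 2, 2 * M, by rw [hM]; positivity, ?_⟩
  intro p hpf hp0 e q he hen hpq h hdeg hdeg0 hsep c hc
  have hp : p.Prime := hpf.out
  let K := AlgebraicClosure (ZMod p)
  have : CharP K p := charP_of_injective_algebraMap (algebraMap (ZMod p) K).injective p
  let φ : ZMod p →+* K := algebraMap (ZMod p) K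
  have hφ : Function.Injective φ := φ.injective
  obtain ⟨α, hα⟩ := IsAlgClosed.exists_root (h.map φ) (by
    rw [degree_map]; exact (natDegree_pos_iff_degree_pos.1 hdeg0).ne')
  have hα' : (derivative (h.map φ)).eval α ≠ 0 := by
    have := (hsep.map (f := φ)).eval₂_derivative_ne_zero (RingHom.id K) (x := α) (by
      simpa [eval₂_id] using hα)
    simpa [eval₂_id] using this
  have hfer : ∀ a : ZMod p, a ≠ 0 → (a ^ q) ^ e = 1 := by
    intro a ha
    rw [← pow_mul, mul_comm, show e * q = p - 1 by omega]
    exact ZMod.pow_card_sub_one_eq_one ha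
  let bad := Finset.univ.filter fun t : ZMod p => h.eval t ≠ 0 ∧ h.eval t ^ q ≠ c ^ q
  let good := Finset.univ.filter fun t : ZMod p => h.eval t ≠ 0 ∧ h.eval t ^ q = c ^ q
  let zer := Finset.univ.filter fun t : ZMod p => h.eval t = 0
  have hcard : p ≤ zer.card + (good.card + bad.card) := by
    have h1 : (Finset.univ : Finset (ZMod p)) ⊆ zer ∪ (good ∪ bad) := by
      intro t _
      simp only [zer, good, bad, Finset.mem_union, Finset.mem_filter, Finset.mem_univ, true_and]
      tauto
    calc p = (Finset.univ : Finset (ZMod p)).card := by rw [Finset.card_univ, ZMod.card]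
      _ ≤ _ := Finset.card_le_card h1
      _ ≤ _ := Finset.card_union_le _ _
      _ ≤ _ := Nat.add_le_add_left (Finset.card_union_le _ _) _
  have hzer : zer.card ≤ n := by
    refine le_trans ?_ hdeg
    refine card_le_degree_of_subset_roots (p := h) ?_
    intro t ht
    have h0 : h ≠ 0 := by rintro rfl; simp at hdeg0
    rw [Finset.mem_val, Finset.mem_filter] at ht
    exact (mem_roots h0).2 ht.2
  have h2n : n ≤ n ^ 2 := Nat.le_self_pow (by norm_num) n
  have hen2 : e * n ≤ n ^ 2 := by rw [sq]; exact Nat.mul_le_mul_right _ hen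
  have hst := stepanov_aux (K := K) hp (M := M) (J := M - n) (B := B) he hpq
    (h := h.map φ) (n := n) (by rwa [natDegree_map]) (by simpa using hα) hα' (φ (c ^ q))
    (bad.map ⟨φ, hφ⟩) (by
      intro t ht
      simp only [bad, Finset.mem_map, Finset.mem_filter, Finset.mem_univ, true_and,
        Function.Embedding.coeFn_mk] at ht
      obtain ⟨s, ⟨hs0, hs⟩, rfl⟩ := ht
      refine ⟨by rw [← map_pow, ZMod.pow_card], ?_⟩
      rw [eval_map_apply, ← map_pow]
      have h1 : (∑ i ∈ Finset.range e, (h.eval s ^ q) ^ i * (c ^ q) ^ (e - 1 - i)) = 0 := by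
        have := (Commute.all (h.eval s ^ q) (c ^ q)).geom_sum₂_mul e
        rw [hfer _ hs0, hfer _ hc, sub_self] at this
        exact (mul_eq_zero.1 this).resolve_right (sub_ne_zero.2 hs)
      rw [← map_zero φ, ← h1, map_sum]
      simp only [map_mul, map_pow])
    (by omega)
    (by
      by_contra hlt
      have h1 : e * q ≤ n * B := Nat.mul_le_mul hen (by omega)
      omega)
    (by omega)
    (by
      obtain ⟨J, hJ⟩ : ∃ J, J = M - n := ⟨_, rfl⟩
      obtain ⟨e', rfl⟩ : ∃ e', e = e' + 1 := ⟨e - 1, by omega⟩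
      rw [← hJ]
      have hJM : J + n = M := by omega
      simp only [Nat.add_sub_cancel]
      have h3 : (e' + 1) * n + n ^ 2 ≤ M := by omega
      have h4 : M * e' * (M * n + J) ≤ 8 * n ^ 6 := by
        have : M * n + J ≤ 4 * n ^ 3 := by
          have : n ^ 2 ≤ n ^ 3 := Nat.pow_le_pow_right hn0 (by norm_num)
          have h5 : M * n = 2 * n ^ 3 := by rw [hM]; ring
          omega
        calc M * e' * (M * n + J) ≤ M * n * (4 * n ^ 3) :=
              Nat.mul_le_mul (Nat.mul_le_mul_left _ (by omega)) this
          _ = 8 * n ^ 6 := by rw [hM]; ring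
      have h6 : 8 * n ^ 6 < n ^ 2 * B := by rw [hB]; nlinarith [pow_pos hn0 2]
      have h7 : (e' + 1) * J + (e' + 1) * n = (e' + 1) * M := by rw [← hJM]; ring
      have h8 : M * e' + n ^ 2 ≤ (e' + 1) * J := by nlinarith
      calc M * e' * (B + M * n + J) = M * e' * B + M * e' * (M * n + J) := by ring
        _ < M * e' * B + n ^ 2 * B := by omega
        _ = (M * e' + n ^ 2) * B := by ring
        _ ≤ (e' + 1) * J * B := Nat.mul_le_mul_right _ h8
        _ = _ := by ring)
  rw [Finset.card_map] at hst
  have h5 : q * (e - 1) ≤ p := by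
    calc q * (e - 1) ≤ q * e := Nat.mul_le_mul_left _ (by omega)
      _ ≤ p := by rw [hpq, mul_comm]; omega
  have h6 : p * (M - n - 1) + p * n + p = p * M := by
    rw [← Nat.mul_add, ← Nat.mul_succ]
    congr 1
    omega
  have h7 : n * (q * (e - 1) + M) ≤ p * n + n * M := by nlinarith
  have h8 : p * M ≤ (n + (good.card + bad.card)) * M := Nat.mul_le_mul_right _ (by omega)
  change p ≤ 2 * M * good.card
  nlinarith

lemma exists_log_le_sum_log_div : ∃ C : ℝ, 0 ≤ C ∧ ∀ n : ℕ, 0 < n →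
    Real.log n - C ≤ ∑ p ∈ (Finset.Icc 1 n).filter Nat.Prime, Real.log p / p := by
  have hs : Summable fun m : ℕ => 4 * ((m : ℝ) ^ (3 / 2 : ℝ))⁻¹ :=
    (Real.summable_nat_rpow_inv.2 (by norm_num)).mul_left 4
  refine ⟨1 + ∑' m : ℕ, 4 * ((m : ℝ) ^ (3 / 2 : ℝ))⁻¹, ?_, fun n hn => ?_⟩
  · have : 0 ≤ ∑' m : ℕ, 4 * ((m : ℝ) ^ (3 / 2 : ℝ))⁻¹ := tsum_nonneg fun m => by positivity
    linarith
  have hn' : (0 : ℝ) < n := by exact_mod_cast hn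
  have h1 : Real.log (n.factorial : ℕ) ≤
      ∑ p ∈ (Finset.Icc 1 n).filter Nat.Prime, (n / (p - 1) : ℝ) * Real.log p := by
    rw [Real.log_nat_eq_sum_factorization, Finsupp.sum]
    have hsub : (n.factorial.factorization).support ⊆ (Finset.Icc 1 n).filter Nat.Prime := by
      intro p hp
      rw [Nat.support_factorization] at hp
      have hpp := Nat.prime_of_mem_primeFactors hp
      rw [Finset.mem_filter, Finset.mem_Icc]
      exact ⟨⟨hpp.one_le, (hpp.dvd_factorial).1 (Nat.dvd_of_mem_primeFactors hp)⟩, hpp⟩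
    refine (Finset.sum_le_sum_of_subset_of_nonneg hsub fun p _ _ => ?_).trans
      (Finset.sum_le_sum fun p hp => ?_)
    · have := Real.log_natCast_nonneg p
      positivity
    · obtain ⟨-, hpp⟩ := Finset.mem_filter.1 hp
      refine mul_le_mul_of_nonneg_right ?_ (Real.log_natCast_nonneg p)
      have h2 := Nat.factorization_factorial_le_div_pred hpp n
      refine (Nat.cast_le.2 h2).trans (Nat.cast_div_le.trans ?_)
      rw [Nat.cast_sub hpp.one_le, Nat.cast_one]
  have h2 := Stirling.le_log_factorial_stirling (n := n) (by omega)
  have h3 : ∀ p ∈ (Finset.Icc 1 n).filter Nat.Prime, (n / (p - 1) : ℝ) * Real.log p ≤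
      n * (Real.log p / p + 4 * ((p : ℝ) ^ (3 / 2 : ℝ))⁻¹) := by
    intro p hp
    obtain ⟨-, hpp⟩ := Finset.mem_filter.1 hp
    have hp2 : (2 : ℝ) ≤ p := by exact_mod_cast hpp.two_le
    have hp0 : (0 : ℝ) < p := by linarith
    have h4 : Real.log p ≤ (p : ℝ) ^ (1 / 2 : ℝ) / (1 / 2) :=
      Real.log_le_rpow_div hp0.le (by norm_num)
    have h5 : (p : ℝ) ^ (3 / 2 : ℝ) * (p : ℝ) ^ (1 / 2 : ℝ) = (p : ℝ) ^ 2 := by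
      rw [← Real.rpow_add hp0, ← Real.rpow_natCast]; norm_num
    have h6 : (0 : ℝ) < (p : ℝ) ^ (3 / 2 : ℝ) := by positivity
    have h7 : Real.log p / (p * (p - 1)) ≤ 4 * ((p : ℝ) ^ (3 / 2 : ℝ))⁻¹ := by
      rw [div_le_iff₀ (mul_pos hp0 (by linarith))]
      have h8 : (p : ℝ) ^ 2 / 2 ≤ p * (p - 1) := by nlinarith
      calc Real.log p ≤ 2 * (p : ℝ) ^ (1 / 2 : ℝ) := by linarith
        _ = 4 * ((p : ℝ) ^ (3 / 2 : ℝ))⁻¹ * ((p : ℝ) ^ 2 / 2) := by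
            rw [← h5]; field_simp; ring
        _ ≤ _ := mul_le_mul_of_nonneg_left h8 (by positivity)
    have h9 : (n / (p - 1) : ℝ) * Real.log p =
        n * (Real.log p / p + Real.log p / (p * (p - 1))) := by
      have : (p : ℝ) - 1 ≠ 0 := by linarith
      field_simp; ring
    rw [h9]
    gcongr
  have h4 := h1.trans (Finset.sum_le_sum h3)
  rw [← Finset.mul_sum, Finset.sum_add_distrib] at h4
  have h5 : ∑ p ∈ (Finset.Icc 1 n).filter Nat.Prime, 4 * ((p : ℝ) ^ (3 / 2 : ℝ))⁻¹ ≤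
      ∑' m : ℕ, 4 * ((m : ℝ) ^ (3 / 2 : ℝ))⁻¹ :=
    hs.sum_le_tsum _ fun m _ => by positivity
  have h6 : 0 ≤ Real.log n := Real.log_natCast_nonneg n
  have h7 : 0 ≤ Real.log (2 * Real.pi) := Real.log_nonneg (by linarith [Real.pi_gt_three])
  have h8 : n * Real.log n - n ≤ n * (∑ p ∈ (Finset.Icc 1 n).filter Nat.Prime, Real.log p / p +
      ∑' m : ℕ, 4 * ((m : ℝ) ^ (3 / 2 : ℝ))⁻¹) := by
    refine le_trans ?_ (h4.trans (mul_le_mul_of_nonneg_left (add_le_add_right h5 _) hn'.le))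
    linarith
  rw [← mul_sub_one] at h8
  have := le_of_mul_le_mul_left h8 hn'
  linarith

/-- Gallagher's larger sieve. -/
lemma larger_sieve {ι κ : Type*} [DecidableEq ι] [DecidableEq κ] (Z : Finset ι) (P : Finset ℕ)
    (hP : ∀ l ∈ P, l.Prime) (D : ι → ι → ℤ) (T : ℝ)
    (hD0 : ∀ z ∈ Z, ∀ z' ∈ Z, z ≠ z' → D z z' ≠ 0)
    (hDT : ∀ z ∈ Z, ∀ z' ∈ Z, z ≠ z' → |(D z z' : ℝ)| ≤ T) (hT : 1 ≤ T)
    (r : ℕ → ι → κ) (hr : ∀ l ∈ P, ∀ z ∈ Z, ∀ z' ∈ Z, r l z = r l z' → (l : ℤ) ∣ D z z')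
    (ν : ℕ → ℝ) (hν0 : ∀ l ∈ P, 0 < ν l) (hν : ∀ l ∈ P, ((Z.image (r l)).card : ℝ) ≤ ν l) :
    Z.card * (∑ l ∈ P, Real.log l / ν l - Real.log T) ≤ ∑ l ∈ P, Real.log l := by
  have hpair : ∀ z ∈ Z, ∀ z' ∈ Z, z ≠ z' →
      ∑ l ∈ P.filter (fun l => r l z = r l z'), Real.log l ≤ Real.log T := by
    intro z hz z' hz' hzz
    have hdvd : (∏ l ∈ P.filter (fun l => r l z = r l z'), l) ∣ (D z z').natAbs := by
      refine Finset.prod_primes_dvd _ (fun l hl => (hP l (Finset.mem_filter.1 hl).1).prime)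
        fun l hl => ?_
      obtain ⟨h1, h2⟩ := Finset.mem_filter.1 hl
      exact Int.natCast_dvd.1 (hr l h1 z hz z' hz' h2)
    have hle := Nat.le_of_dvd (Int.natAbs_pos.2 (hD0 z hz z' hz' hzz)) hdvd
    rw [← Real.log_prod (fun l hl => by
      exact_mod_cast (hP l (Finset.mem_filter.1 hl).1).ne_zero)]
    refine Real.log_le_log (Finset.prod_pos fun l hl => by
      exact_mod_cast (hP l (Finset.mem_filter.1 hl).1).pos) ?_
    refine le_trans ?_ (hDT z hz z' hz' hzz)
    rw [← Nat.cast_prod, ← Int.cast_abs, Int.abs_eq_natAbs, Int.cast_natCast]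
    exact_mod_cast hle
  have hlog : 0 ≤ Real.log T := Real.log_nonneg hT
  have hupper : ∑ z ∈ Z, ∑ z' ∈ Z, ∑ l ∈ P.filter (fun l => r l z = r l z'), Real.log l ≤
      Z.card * (∑ l ∈ P, Real.log l + Z.card * Real.log T) := by
    rw [← nsmul_eq_mul]
    refine Finset.sum_le_card_nsmul _ _ _ fun z hz => ?_
    rw [← Finset.add_sum_erase _ _ hz]
    refine add_le_add ?_ ?_
    · simp
    · calc _ ≤ ((Z.erase z).card : ℝ) * Real.log T := by
            rw [← nsmul_eq_mul]
            refine Finset.sum_le_card_nsmul _ _ _ fun z' hz' => ?_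
            obtain ⟨h1, h2⟩ := Finset.mem_erase.1 hz'
            exact hpair z hz z' h2 h1.symm
        _ ≤ _ := by
            gcongr
            exact Finset.erase_subset _ _
  have hlower : (Z.card : ℝ) ^ 2 * ∑ l ∈ P, Real.log l / ν l ≤
      ∑ z ∈ Z, ∑ z' ∈ Z, ∑ l ∈ P.filter (fun l => r l z = r l z'), Real.log l := by
    simp_rw [Finset.sum_filter]
    rw [Finset.sum_congr rfl fun z _ => Finset.sum_comm, Finset.sum_comm, Finset.mul_sum]
    refine Finset.sum_le_sum fun l hl => ?_
    have hinner : ∑ z ∈ Z, ∑ z' ∈ Z, (if r l z = r l z' then Real.log l else 0) =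
        (∑ b ∈ Z.image (r l), ((Z.filter fun z => r l z = b).card : ℝ) ^ 2) * Real.log l := by
      rw [← Finset.sum_fiberwise_of_maps_to (t := Z.image (r l)) (g := r l)
        (fun z hz => Finset.mem_image_of_mem _ hz), Finset.sum_mul]
      refine Finset.sum_congr rfl fun b _ => ?_
      rw [Finset.sum_congr rfl (g := fun _ =>
        ((Z.filter fun z => r l z = b).card : ℝ) * Real.log l)]
      · rw [Finset.sum_const, nsmul_eq_mul]; ring
      · intro z hz
        obtain ⟨-, rfl⟩ := Finset.mem_filter.1 hz
        rw [← Finset.sum_filter, Finset.sum_const, nsmul_eq_mul]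
        simp only [eq_comm]
    rw [hinner]
    have hlog0 := Real.log_natCast_nonneg l
    have hcs := sq_sum_le_card_mul_sum_sq (s := Z.image (r l))
      (f := fun b => ((Z.filter fun z => r l z = b).card : ℝ))
    rw [← Nat.cast_sum, ← Finset.card_eq_sum_card_image] at hcs
    have hsq : 0 ≤ ∑ b ∈ Z.image (r l), ((Z.filter fun z => r l z = b).card : ℝ) ^ 2 :=
      Finset.sum_nonneg fun _ _ => sq_nonneg _
    have h1 : (Z.card : ℝ) ^ 2 / ν l ≤
        ∑ b ∈ Z.image (r l), ((Z.filter fun z => r l z = b).card : ℝ) ^ 2 := by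
      rw [div_le_iff₀ (hν0 l hl), mul_comm]
      exact hcs.trans (mul_le_mul_of_nonneg_right (hν l hl) hsq)
    calc _ = (Z.card : ℝ) ^ 2 / ν l * Real.log l := by ring
      _ ≤ _ := mul_le_mul_of_nonneg_right h1 hlog0
  rcases Nat.eq_zero_or_pos Z.card with h0 | h0
  · rw [h0]
    simpa using Finset.sum_nonneg fun l _ => Real.log_natCast_nonneg l
  · have h1 := hlower.trans hupper
    have h0' : (0 : ℝ) < Z.card := by exact_mod_cast h0
    have h2 : (Z.card : ℝ) * (Z.card * ∑ l ∈ P, Real.log l / ν l) ≤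
      Z.card * (∑ l ∈ P, Real.log l + Z.card * Real.log T) := by
      rw [← mul_assoc, ← sq]; exact h1
    have := le_of_mul_le_mul_left h2 h0'
    linarith

/-- The sum of `l ^ (-1/2)` over the prime factors `l` of `c`. -/
noncomputable def primeFactorWeight (c : ℕ) : ℝ := ∑ l ∈ c.primeFactors, ((l : ℝ) ^ (1 / 2 : ℝ))⁻¹

lemma primeFactorWeight_nonneg (c : ℕ) : 0 ≤ primeFactorWeight c :=
  Finset.sum_nonneg fun _ _ => by positivity

lemma primeFactorWeight_mul_le {a b : ℕ} (ha : a ≠ 0) (hb : b ≠ 0) :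
    primeFactorWeight (a * b) ≤ primeFactorWeight a + primeFactorWeight b := by
  classical
  unfold primeFactorWeight
  rw [Nat.primeFactors_mul ha hb, ← Finset.sum_union_inter]
  have : 0 ≤ ∑ l ∈ a.primeFactors ∩ b.primeFactors, ((l : ℝ) ^ (1 / 2 : ℝ))⁻¹ :=
    Finset.sum_nonneg fun _ _ => by positivity
  linarith

lemma sq_sum_log_div_le : ∃ C : ℝ, 0 ≤ C ∧ ∀ c : ℕ,
    (∑ l ∈ c.primeFactors, Real.log l / l) ^ 2 ≤ C * primeFactorWeight c := by
  have hs : Summable fun m : ℕ => 64 * ((m : ℝ) ^ (5 / 4 : ℝ))⁻¹ :=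
    (Real.summable_nat_rpow_inv.2 (by norm_num)).mul_left 64
  refine ⟨∑' m : ℕ, 64 * ((m : ℝ) ^ (5 / 4 : ℝ))⁻¹, tsum_nonneg fun _ => by positivity,
    fun c => ?_⟩
  have h1 := Finset.sum_mul_sq_le_sq_mul_sq c.primeFactors
    (fun l => Real.log l * ((l : ℝ) ^ (3 / 4 : ℝ))⁻¹) (fun l => ((l : ℝ) ^ (1 / 4 : ℝ))⁻¹)
  have h2 : ∀ l ∈ c.primeFactors, Real.log l / l =
      Real.log l * ((l : ℝ) ^ (3 / 4 : ℝ))⁻¹ * ((l : ℝ) ^ (1 / 4 : ℝ))⁻¹ := by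
    intro l hl
    have hl0 : (0 : ℝ) < l := by exact_mod_cast (Nat.prime_of_mem_primeFactors hl).pos
    rw [mul_assoc, ← mul_inv, ← Real.rpow_add hl0, div_eq_mul_inv]
    norm_num
  have h3 : ∀ l ∈ c.primeFactors, (((l : ℝ) ^ (1 / 4 : ℝ))⁻¹) ^ 2 = ((l : ℝ) ^ (1 / 2 : ℝ))⁻¹ := by
    intro l hl
    rw [inv_pow, ← Real.rpow_natCast, ← Real.rpow_mul (by positivity)]
    norm_num
  rw [← Finset.sum_congr rfl h2, Finset.sum_congr rfl h3] at h1
  refine h1.trans (mul_le_mul_of_nonneg_right ?_ (primeFactorWeight_nonneg c))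
  refine (Finset.sum_le_sum fun l hl => ?_).trans
    (hs.sum_le_tsum c.primeFactors fun m _ => by positivity)
  have hl0 : (0 : ℝ) < l := by exact_mod_cast (Nat.prime_of_mem_primeFactors hl).pos
  have h4 : Real.log l ≤ (l : ℝ) ^ (1 / 8 : ℝ) / (1 / 8) :=
    Real.log_le_rpow_div hl0.le (by norm_num)
  have h5 : Real.log l ^ 2 ≤ 64 * (l : ℝ) ^ (1 / 4 : ℝ) := by
    have h6 : ((l : ℝ) ^ (1 / 8 : ℝ)) ^ 2 = (l : ℝ) ^ (1 / 4 : ℝ) := by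
      rw [← Real.rpow_natCast, ← Real.rpow_mul (by positivity)]; norm_num
    have := pow_le_pow_left₀ (Real.log_natCast_nonneg l) h4 2
    rw [div_pow, h6] at this
    norm_num at this ⊢
    linarith
  have h6 : (l : ℝ) ^ (1 / 4 : ℝ) * (((l : ℝ) ^ (3 / 4 : ℝ))⁻¹) ^ 2 =
      ((l : ℝ) ^ (5 / 4 : ℝ))⁻¹ := by
    rw [inv_pow, ← Real.rpow_natCast, ← Real.rpow_mul hl0.le, ← Real.rpow_neg hl0.le,
      ← Real.rpow_neg hl0.le, ← Real.rpow_add hl0]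
    norm_num
  rw [mul_pow, ← h6, ← mul_assoc]
  gcongr

set_option maxHeartbeats 1000000 in
lemma card_le_of_residues {δ : ℝ} (hδ0 : 0 < δ) (hδ1 : δ ≤ 1) (R : ℕ) : ∃ C : ℝ, 0 ≤ C ∧
    ∀ {ι κ : Type} [DecidableEq ι] [DecidableEq κ] (Z : Finset ι) (T : ℝ) (c : ℕ)
      (D : ι → ι → ℤ) (r : ℕ → ι → κ), 2 ≤ T → c ≠ 0 →
      (∀ z ∈ Z, ∀ z' ∈ Z, z ≠ z' → D z z' ≠ 0) →
      (∀ z ∈ Z, ∀ z' ∈ Z, z ≠ z' → |(D z z' : ℝ)| ≤ T) →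
      (∀ l : ℕ, l.Prime → R < l → ¬ l ∣ c → (1 + δ) * ((Z.image (r l)).card : ℝ) ≤ l ∧
        ∀ z ∈ Z, ∀ z' ∈ Z, r l z = r l z' → (l : ℤ) ∣ D z z') →
      (Z.card : ℝ) ≤ 3 * T →
      (Z.card : ℝ) ≤ C * (T * (1 + primeFactorWeight c) / Real.log T ^ 2) := by
  obtain ⟨C₁, hC₁0, hC₁⟩ := exists_log_le_sum_log_div
  obtain ⟨C₂, hC₂0, hC₂⟩ := sq_sum_log_div_le
  set C₃ := C₁ + 1 + ∑ l ∈ (Finset.Icc 1 R).filter Nat.Prime, Real.log l / l with hC₃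
  have hC₃0 : 0 ≤ C₃ := by
    have : 0 ≤ ∑ l ∈ (Finset.Icc 1 R).filter Nat.Prime, Real.log l / l :=
      Finset.sum_nonneg fun l _ => div_nonneg (Real.log_natCast_nonneg l) (by positivity)
    positivity
  set L₀ := (2 * C₃ + 1) * (5 / δ) with hL₀
  have hL₀0 : 0 ≤ L₀ := by positivity
  refine ⟨3 * L₀ ^ 2 + 300 * C₂ / δ ^ 2 + Real.log 4 * (20 / δ) ^ 2, by positivity, ?_⟩
  intro ι κ _ _ Z T c D r hT hc hD0 hDT hr htriv
  have hTp : 0 < T := by linarith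
  have hL : 0 < Real.log T := Real.log_pos (by linarith)
  have hw := primeFactorWeight_nonneg c
  set L := Real.log T with hLdef
  have hL2 : 0 < L ^ 2 := by positivity
  rw [← mul_div_assoc, le_div_iff₀ hL2]
  rw [show ∀ A B E : ℝ, (A + B + E) * (T * (1 + primeFactorWeight c)) =
    A * T + B * (T * primeFactorWeight c) + E * T + A * (T * primeFactorWeight c) + B * T +
      E * (T * primeFactorWeight c) from fun _ _ _ => by ring]
  have hlog4 : 0 ≤ Real.log 4 := Real.log_nonneg (by norm_num)
  have hA : 0 ≤ 3 * L₀ ^ 2 * T := by positivity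
  have hB : 0 ≤ 300 * C₂ / δ ^ 2 * (T * primeFactorWeight c) := by positivity
  have hE : 0 ≤ Real.log 4 * (20 / δ) ^ 2 * T := by positivity
  have hA' : 0 ≤ 3 * L₀ ^ 2 * (T * primeFactorWeight c) := by positivity
  have hB' : 0 ≤ 300 * C₂ / δ ^ 2 * T := by positivity
  have hE' : 0 ≤ Real.log 4 * (20 / δ) ^ 2 * (T * primeFactorWeight c) := by positivity
  set σ := ∑ l ∈ c.primeFactors, Real.log l / l with hσ
  have hσ0 : 0 ≤ σ :=
    Finset.sum_nonneg fun l _ => div_nonneg (Real.log_natCast_nonneg l) (by positivity)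
  by_cases h1 : L < L₀
  · have : (Z.card : ℝ) * L ^ 2 ≤ 3 * T * L₀ ^ 2 := by gcongr
    linarith
  by_cases h2 : δ / 10 * L < σ
  · have h3 : L ^ 2 ≤ 100 / δ ^ 2 * (C₂ * primeFactorWeight c) := by
      calc L ^ 2 = 100 / δ ^ 2 * (δ / 10 * L) ^ 2 := by field_simp; norm_num
        _ ≤ 100 / δ ^ 2 * σ ^ 2 := by gcongr
        _ ≤ _ := by gcongr; exact hC₂ c
    have : (Z.card : ℝ) * L ^ 2 ≤ 3 * T * (100 / δ ^ 2 * (C₂ * primeFactorWeight c)) := by gcongr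
    have h4 : 3 * T * (100 / δ ^ 2 * (C₂ * primeFactorWeight c)) =
      300 * C₂ / δ ^ 2 * (T * primeFactorWeight c) := by ring
    linarith
  push Not at h1 h2
  set y := T ^ (1 - δ / 10) with hy
  have hy1 : 1 ≤ y := Real.one_le_rpow (by linarith) (by linarith)
  have hlogy : Real.log y = (1 - δ / 10) * L := Real.log_rpow hTp _
  have hfl : 0 < ⌊y⌋₊ := Nat.floor_pos.2 hy1
  have hlogfl : Real.log y - 1 ≤ Real.log ⌊y⌋₊ := by
    have h3 : y ≤ 2 * ⌊y⌋₊ := by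
      have := Nat.lt_floor_add_one y
      have : (1 : ℝ) ≤ ⌊y⌋₊ := by exact_mod_cast hfl
      linarith
    have h4 := Real.log_le_log (by linarith) h3
    rw [Real.log_mul (by norm_num) (by positivity)] at h4
    linarith [Real.log_two_lt_d9]
  set P := ((Finset.Icc 1 ⌊y⌋₊).filter Nat.Prime).filter fun l => R < l ∧ ¬ l ∣ c with hP
  have hPm : ∀ l ∈ P, l.Prime ∧ R < l ∧ ¬ l ∣ c := by
    intro l hl
    simp only [hP, Finset.mem_filter] at hl
    exact ⟨hl.1.2, hl.2⟩
  have hls := larger_sieve Z P (fun l hl => (hPm l hl).1) D T hD0 hDT (by linarith) r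
    (fun l hl => (hr l (hPm l hl).1 (hPm l hl).2.1 (hPm l hl).2.2).2)
    (fun l => (l : ℝ) / (1 + δ))
    (fun l hl => div_pos (by exact_mod_cast (hPm l hl).1.pos) (by linarith))
    (fun l hl => by
      rw [le_div_iff₀ (by linarith), mul_comm]
      exact (hr l (hPm l hl).1 (hPm l hl).2.1 (hPm l hl).2.2).1)
  have h3 : ∑ l ∈ P, Real.log l / ((l : ℝ) / (1 + δ)) =
      (1 + δ) * ∑ l ∈ P, Real.log l / l := by
    rw [Finset.mul_sum]
    refine Finset.sum_congr rfl fun l _ => ?_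
    rw [div_div_eq_mul_div]; ring
  have h4 : Real.log ⌊y⌋₊ - C₁ ≤ ∑ l ∈ P, Real.log l / l +
      ∑ l ∈ (Finset.Icc 1 R).filter Nat.Prime, Real.log l / l + σ := by
    refine (hC₁ _ hfl).trans ?_
    have hsub : (Finset.Icc 1 ⌊y⌋₊).filter Nat.Prime ⊆
        P ∪ (Finset.Icc 1 R).filter Nat.Prime ∪ c.primeFactors := by
      intro l hl
      obtain ⟨hl1, hl2⟩ := Finset.mem_filter.1 hl
      by_cases hlc : l ∣ c
      · exact Finset.mem_union_right _ (Nat.mem_primeFactors.2 ⟨hl2, hlc, hc⟩)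
      by_cases hRl : R < l
      · exact Finset.mem_union_left _ (Finset.mem_union_left _
          (Finset.mem_filter.2 ⟨hl, hRl, hlc⟩))
      · exact Finset.mem_union_left _ (Finset.mem_union_right _
          (Finset.mem_filter.2 ⟨Finset.mem_Icc.2 ⟨hl2.one_le, not_lt.1 hRl⟩, hl2⟩))
    have hnn : ∀ l : ℕ, 0 ≤ Real.log l / l := fun l =>
      div_nonneg (Real.log_natCast_nonneg l) (by positivity)
    refine (Finset.sum_le_sum_of_subset_of_nonneg hsub fun l _ _ => hnn l).trans ?_
    have e1 := Finset.sum_union_inter (s₁ := P ∪ (Finset.Icc 1 R).filter Nat.Prime)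
      (s₂ := c.primeFactors) (f := fun l : ℕ => Real.log l / l)
    have e2 := Finset.sum_union_inter (s₁ := P) (s₂ := (Finset.Icc 1 R).filter Nat.Prime)
      (f := fun l : ℕ => Real.log l / l)
    have e3 : 0 ≤ ∑ l ∈ (P ∪ (Finset.Icc 1 R).filter Nat.Prime) ∩ c.primeFactors,
      Real.log l / l := Finset.sum_nonneg fun l _ => hnn l
    have e4 : 0 ≤ ∑ l ∈ P ∩ (Finset.Icc 1 R).filter Nat.Prime,
      Real.log l / l := Finset.sum_nonneg fun l _ => hnn l
    linarith
  have h5 : (1 - δ / 5) * L - C₃ ≤ ∑ l ∈ P, Real.log l / l := by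
    rw [hlogy] at hlogfl
    linarith
  have h6 : 1 ≤ ∑ l ∈ P, Real.log l / ((l : ℝ) / (1 + δ)) - L := by
    rw [h3]
    have h7 : (1 + δ) * ((1 - δ / 5) * L - C₃) ≤ (1 + δ) * ∑ l ∈ P, Real.log l / l := by gcongr
    have h8 : 2 * C₃ + 1 ≤ δ / 5 * L := by
      have := mul_le_mul_of_nonneg_left h1 (by positivity : 0 ≤ δ / 5)
      rw [hL₀] at this
      field_simp at this ⊢
      linarith
    have h9 : (1 + δ) * C₃ ≤ 2 * C₃ := by gcongr; linarith
    have h10 : 0 ≤ δ * L * (1 - δ) := by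
      have : 0 ≤ 1 - δ := by linarith
      positivity
    nlinarith
  have h7 : (Z.card : ℝ) ≤ Real.log 4 * y := by
    have h8 : (Z.card : ℝ) * 1 ≤ _ := (mul_le_mul_of_nonneg_left h6 (by positivity)).trans hls
    rw [mul_one] at h8
    refine h8.trans (le_trans ?_ (Chebyshev.theta_le_log4_mul_x (by linarith)))
    rw [Chebyshev.theta_eq_sum_Icc]
    refine Finset.sum_le_sum_of_subset_of_nonneg ?_ fun l _ _ => Real.log_natCast_nonneg l
    intro l hl
    simp only [hP, Finset.mem_filter, Finset.mem_Icc] at hl ⊢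
    exact ⟨⟨by omega, hl.1.1.2⟩, hl.1.2⟩
  have h8 : L ≤ T ^ (δ / 20) / (δ / 20) := Real.log_le_rpow_div hTp.le (by positivity)
  have h9 : L ^ 2 ≤ (20 / δ) ^ 2 * T ^ (δ / 10) := by
    have h10 : (T ^ (δ / 20)) ^ 2 = T ^ (δ / 10) := by
      rw [← Real.rpow_natCast, ← Real.rpow_mul hTp.le]; congr 1; push_cast; ring
    calc L ^ 2 ≤ (T ^ (δ / 20) / (δ / 20)) ^ 2 := by gcongr
      _ = _ := by rw [div_pow, h10]; field_simp
  have h10 : y * T ^ (δ / 10) = T := by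
    rw [hy, ← Real.rpow_add hTp]; simp
  have h11 : (Z.card : ℝ) * L ^ 2 ≤ Real.log 4 * y * ((20 / δ) ^ 2 * T ^ (δ / 10)) := by gcongr
  have h12 : Real.log 4 * y * ((20 / δ) ^ 2 * T ^ (δ / 10)) = Real.log 4 * (20 / δ) ^ 2 * T := by
    conv_rhs => rw [← h10]
    ring
  linarith

lemma exists_int_multiple (P : ℚ[X]) :
    ∃ d : ℤ, d ≠ 0 ∧ ∃ Q : ℤ[X], Q.map (Int.castRingHom ℚ) = C (d : ℚ) * P := by
  obtain ⟨b, hb0, hb⟩ := IsLocalization.integerNormalization_spec (nonZeroDivisors ℤ) P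
  refine ⟨b, nonZeroDivisors.ne_zero hb0,
    IsLocalization.integerNormalization (nonZeroDivisors ℤ) P, ?_⟩
  rw [← smul_eq_C_mul, Int.cast_smul_eq_zsmul]
  exact hb

lemma exists_bezout {f : ℤ[X]} (hsep : (f.map (Int.castRingHom ℚ)).Separable) :
    ∃ r : ℤ, r ≠ 0 ∧ ∃ u v : ℤ[X], u * f + v * derivative f = C r := by
  obtain ⟨a, b, hab⟩ := hsep
  obtain ⟨d, hd, A, hA⟩ := exists_int_multiple a
  obtain ⟨e, he, B, hB⟩ := exists_int_multiple b
  refine ⟨d * e, mul_ne_zero hd he, C e * A, C d * B, ?_⟩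
  apply map_injective (Int.castRingHom ℚ) Int.cast_injective
  simp only [Polynomial.map_add, Polynomial.map_mul, map_C, hA, hB, ← derivative_map]
  simp only [eq_intCast, Int.cast_mul, C_mul]
  linear_combination (C (d : ℚ) * C (e : ℚ)) * hab

lemma derivative_eval_ne_of_bezout {f u v : ℤ[X]} {r : ℤ} (h : u * f + v * derivative f = C r)
    {l : ℤ} (hl : ¬ l ∣ r) {w : ℤ} (hw : l ∣ f.eval w) : ¬ l ∣ (derivative f).eval w := by
  intro h'
  apply hl
  have := congrArg (eval w) h
  rw [eval_add, eval_mul, eval_mul, eval_C] at this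
  rw [← this]
  exact dvd_add (hw.mul_left _) (h'.mul_left _)

lemma mul_dvd_sub_of_simple_root {f : ℤ[X]} {l m w w' : ℤ} (hl : Prime l) (hm : m ≠ 0)
    (hw : l * m ∣ f.eval w) (hw' : l * m ∣ f.eval w') (hd : ¬ l ∣ (derivative f).eval w)
    (h1 : m ∣ w' - w) (h2 : l ∣ w' - w) : l * m ∣ w' - w := by
  obtain ⟨t, ht⟩ := h1
  obtain ⟨s, hs⟩ := Polynomial.binomExpansion f w (w' - w)
  rw [add_sub_cancel] at hs
  have h3 : l * m ∣ m * (t * ((derivative f).eval w + s * (w' - w))) := by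
    have : m * (t * ((derivative f).eval w + s * (w' - w))) = f.eval w' - f.eval w := by
      rw [hs, ← mul_assoc, ← ht]; ring
    rw [this]
    exact dvd_sub hw' hw
  rw [mul_comm l m] at h3 ⊢
  have h4 := (mul_dvd_mul_iff_left hm).1 h3
  rcases hl.dvd_or_dvd h4 with h5 | h5
  · rw [ht]; exact mul_dvd_mul_left m h5
  · exact absurd ((dvd_add_left (h2.mul_left s)).1 h5) hd

section NumberField

open NumberField

lemma exists_ringHom_zmod {K : Type*} [Field K] {g : ℤ[X]} {θ : K}
    (hg : ∀ P : ℤ[X], aeval θ P = 0 → g ∣ P)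
    {D : ℤ} (hD : ∀ x : 𝓞 K, ∃ P : ℤ[X], aeval θ P = (D : K) * (x : K))
    {m : ℕ} (hm : IsCoprime D (m : ℤ)) {w : ℤ} (hw : (m : ℤ) ∣ g.eval w) :
    ∃ ψ : 𝓞 K →+* ZMod m, ∀ (x : 𝓞 K) (P : ℤ[X]), aeval θ P = (x : K) →
      ψ x = ((P.eval w : ℤ) : ZMod m) := by
  choose P hP using hD
  have hzero : ∀ Q : ℤ[X], aeval θ Q = 0 → ((Q.eval w : ℤ) : ZMod m) = 0 := by
    intro Q hQ
    obtain ⟨Q', rfl⟩ := hg Q hQ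
    rw [ZMod.intCast_zmod_eq_zero_iff_dvd, eval_mul]
    exact hw.mul_right _
  obtain ⟨e, s, hes⟩ := hm
  have he : (e : ZMod m) * (D : ZMod m) = 1 := by
    have := congrArg (Int.cast : ℤ → ZMod m) hes
    simpa using this
  have key : ∀ Q Q' : ℤ[X], aeval θ Q = aeval θ Q' →
      ((Q.eval w : ℤ) : ZMod m) = ((Q'.eval w : ℤ) : ZMod m) := by
    intro Q Q' h
    have := hzero (Q - Q') (by rw [map_sub, h, sub_self])
    rw [eval_sub, Int.cast_sub] at this
    exact sub_eq_zero.1 this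
  have key' : ∀ (x : 𝓞 K) (Q : ℤ[X]), aeval θ Q = (x : K) →
      (((P x).eval w : ℤ) : ZMod m) = (D : ZMod m) * ((Q.eval w : ℤ) : ZMod m) := by
    intro x Q h
    rw [key (P x) (C D * Q) (by rw [hP, map_mul, aeval_C, h]; simp), eval_mul, eval_C,
      Int.cast_mul]
  refine ⟨{ toFun := fun x => e * (((P x).eval w : ℤ) : ZMod m)
            map_one' := ?_, map_mul' := ?_, map_zero' := ?_, map_add' := ?_ }, ?_⟩
  · rw [key' 1 1 (by simp), ← mul_assoc, he]; simp
  · intro x y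
    have h1 := key (P x * P y) (C D * P (x * y)) (by
      rw [map_mul, map_mul, hP, hP, hP, aeval_C]; simp; ring)
    rw [eval_mul, eval_mul, eval_C, Int.cast_mul, Int.cast_mul] at h1
    linear_combination (-(e : ZMod m) * (((P (x * y)).eval w : ℤ) : ZMod m)) * he -
      (e : ZMod m) ^ 2 * h1
  · rw [key' 0 0 (by simp)]; simp
  · intro x y
    rw [key (P (x + y)) (P x + P y) (by rw [map_add, hP, hP, hP]; simp [mul_add]), eval_add,
      Int.cast_add, mul_add]
  · intro x Q h
    change (e : ZMod m) * (((P x).eval w : ℤ) : ZMod m) = _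
    rw [key' x Q h, ← mul_assoc, he, one_mul]

variable {K : Type*} [Field K] [NumberField K]

lemma exists_common_denominator {θ : K} (hθ : ∀ x : K, ∃ P : ℚ[X], aeval θ P = x) :
    ∃ D : ℤ, D ≠ 0 ∧ ∀ x : 𝓞 K, ∃ P : ℤ[X], aeval θ P = (D : K) * (x : K) := by
  have h1 : ∀ x : K, ∃ d : ℤ, d ≠ 0 ∧ ∃ P : ℤ[X], aeval θ P = (d : K) * x := by
    intro x
    obtain ⟨P, rfl⟩ := hθ x
    obtain ⟨d, hd, Q, hQ⟩ := exists_int_multiple P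
    refine ⟨d, hd, Q, ?_⟩
    have := congrArg (aeval θ) hQ
    rw [map_mul, aeval_C, ← algebraMap_int_eq, aeval_map_algebraMap] at this
    simpa using this
  let b := RingOfIntegers.basis K
  choose d hd P hP using fun i => h1 (b i : K)
  classical
  refine ⟨∏ i, d i, Finset.prod_ne_zero_iff.2 fun i _ => hd i, ?_⟩
  intro x
  refine Submodule.span_induction (R := ℤ) (M := 𝓞 K) (s := Set.range b)
    (p := fun x _ => ∃ P : ℤ[X], aeval θ P =
    ((∏ i, d i : ℤ) : K) * (x : K)) ?_ ⟨0, by simp⟩ ?_ ?_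
    (show x ∈ Submodule.span ℤ (Set.range b) by rw [b.span_eq]; trivial)
  · rintro _ ⟨i, rfl⟩
    refine ⟨C (∏ j ∈ Finset.univ.erase i, d j) * P i, ?_⟩
    rw [map_mul, hP, aeval_C, ← Finset.mul_prod_erase _ _ (Finset.mem_univ i)]
    simp only [algebraMap_int_eq, eq_intCast, Int.cast_mul]
    ring
  · rintro x y - - ⟨P, hP⟩ ⟨Q, hQ⟩
    exact ⟨P + Q, by rw [map_add, hP, hQ]; simp [mul_add]⟩
  · rintro a x - ⟨P, hP⟩
    refine ⟨C a * P, ?_⟩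
    rw [map_mul, hP, aeval_C]
    simp only [zsmul_eq_mul, map_mul, map_intCast, algebraMap_int_eq, eq_intCast]
    ring

variable (K) in
lemma exists_card_ideal_le : ∃ C : ℝ, 0 ≤ C ∧ ∀ X : ℕ,
    (Nat.card {I : Ideal (𝓞 K) // 1 ≤ Ideal.absNorm I ∧ Ideal.absNorm I ≤ X} : ℝ) ≤ C * X := by
  have h := (NumberField.Ideal.tendsto_norm_le_div_atTop K).comp tendsto_natCast_atTop_atTop
  obtain ⟨A, hA⟩ := h.bddAbove_range
  refine ⟨max A 0, le_max_right _ _, fun X => ?_⟩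
  rcases Nat.eq_zero_or_pos X with rfl | hX
  · have : IsEmpty {I : Ideal (𝓞 K) // 1 ≤ Ideal.absNorm I ∧ Ideal.absNorm I ≤ 0} :=
      ⟨fun I => by have := I.2; omega⟩
    rw [Nat.card_of_isEmpty]
    simp
  · have hX' : (0 : ℝ) < X := by exact_mod_cast hX
    have h1 := hA ⟨X, rfl⟩
    simp only [Function.comp_apply] at h1
    rw [div_le_iff₀ hX'] at h1
    refine le_trans ?_ (h1.trans (mul_le_mul_of_nonneg_right (le_max_left _ _) hX'.le))
    have hfin : Finite {I : Ideal (𝓞 K) // (Ideal.absNorm I : ℝ) ≤ (X : ℝ)} := by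
      simp only [Nat.cast_le]
      exact (Ideal.finite_setOfPred_absNorm_le (S := 𝓞 K) X).to_subtype
    exact_mod_cast Nat.card_le_card_of_injective
      (fun I : {I : Ideal (𝓞 K) // 1 ≤ Ideal.absNorm I ∧ Ideal.absNorm I ≤ X} =>
        (⟨I.1, by exact_mod_cast I.2.2⟩ : {I : Ideal (𝓞 K) // (Ideal.absNorm I : ℝ) ≤ (X : ℝ)}))
      fun I J hIJ => Subtype.ext (by simpa using hIJ)

end NumberField

/-- Pairs `(m, w)` with `1 ≤ m ≤ X`, `m` coprime to `B` and `w` a root of `g` modulo `m`. -/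
def rootPairs (g : ℤ[X]) (B X : ℕ) : Finset (ℕ × ℕ) :=
  (Finset.Icc 1 X ×ˢ Finset.range X).filter fun z =>
    z.2 < z.1 ∧ z.1.Coprime B ∧ (z.1 : ℤ) ∣ g.eval (z.2 : ℤ)

lemma mem_rootPairs {g : ℤ[X]} {B X : ℕ} {z : ℕ × ℕ} : z ∈ rootPairs g B X ↔
    (1 ≤ z.1 ∧ z.1 ≤ X) ∧ z.2 < z.1 ∧ z.1.Coprime B ∧ (z.1 : ℤ) ∣ g.eval (z.2 : ℤ) := by
  simp only [rootPairs, Finset.mem_filter, Finset.mem_product, Finset.mem_Icc, Finset.mem_range]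
  constructor
  · tauto
  · rintro ⟨h1, h2, h3⟩
    exact ⟨⟨h1, by omega⟩, h2, h3⟩

open NumberField in
lemma card_rootPairs_le_card_ideal {K : Type*} [Field K] [NumberField K] {θ : K}
    (hθ : ∀ x : K, ∃ P : ℚ[X], aeval θ P = x) {g : ℤ[X]} (hg0 : g ≠ 0) (hθg : aeval θ g = 0)
    (hgθ : ∀ P : ℤ[X], aeval θ P = 0 → g ∣ P) :
    ∃ D : ℕ, D ≠ 0 ∧ ∀ B : ℕ, D ∣ B → ∀ X : ℕ, (rootPairs g B X).card ≤
      Nat.card {I : Ideal (𝓞 K) // 1 ≤ Ideal.absNorm I ∧ Ideal.absNorm I ≤ X} := by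
  obtain ⟨D, hD0, hD⟩ := exists_common_denominator hθ
  let α : 𝓞 K := ⟨g.leadingCoeff • θ, isIntegral_leadingCoeff_smul g θ hθg⟩
  refine ⟨(D * g.leadingCoeff).natAbs, by simpa using ⟨hD0, hg0⟩, fun B hB X => ?_⟩
  have hcop : ∀ z ∈ rootPairs g B X, IsCoprime D (z.1 : ℤ) ∧
      IsCoprime (z.1 : ℤ) g.leadingCoeff := by
    intro z hz
    have h1 := (mem_rootPairs.1 hz).2.2.1
    have h2 : IsCoprime (z.1 : ℤ) (D * g.leadingCoeff) := by
      refine (Nat.isCoprime_iff_coprime.2 h1).of_isCoprime_of_dvd_right ?_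
      exact Int.natAbs_dvd.1 (Int.natCast_dvd_natCast.2 hB)
    exact ⟨(IsCoprime.of_mul_right_left h2).symm, IsCoprime.of_mul_right_right h2⟩
  have hI : ∀ z ∈ rootPairs g B X, ∃ I : Ideal (𝓞 K), Ideal.absNorm I = z.1 ∧
      ∀ k : ℤ, α - k ∈ I ↔ (z.1 : ℤ) ∣ g.leadingCoeff * z.2 - k := by
    intro z hz
    obtain ⟨ψ, hψ⟩ := exists_ringHom_zmod hgθ hD (hcop z hz).1 (mem_rootPairs.1 hz).2.2.2
    have : NeZero z.1 := ⟨by have := (mem_rootPairs.1 hz).1.1; omega⟩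
    have hsurj : Function.Surjective ψ := ZMod.ringHom_surjective _
    refine ⟨RingHom.ker ψ, ?_, fun k => ?_⟩
    · rw [Ideal.absNorm_apply, Submodule.cardQuot_apply,
        Nat.card_congr (RingHom.quotientKerEquivOfSurjective hsurj).toEquiv, Nat.card_zmod]
    · rw [RingHom.mem_ker, map_sub, hψ α (C g.leadingCoeff * Polynomial.X) (by simp [α]),
        map_intCast, ← Int.cast_sub, ZMod.intCast_zmod_eq_zero_iff_dvd]
      simp
  choose! I hI1 hI2 using hI
  have hfin : Finite {I : Ideal (𝓞 K) // 1 ≤ Ideal.absNorm I ∧ Ideal.absNorm I ≤ X} :=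
    ((Ideal.finite_setOfPred_absNorm_le (S := 𝓞 K) X).subset fun I hI => hI.2).to_subtype
  have hinj : Function.Injective (fun z : {z // z ∈ rootPairs g B X} =>
      (⟨I z.1, by rw [hI1 z.1 z.2]; exact (mem_rootPairs.1 z.2).1⟩ :
        {I : Ideal (𝓞 K) // 1 ≤ Ideal.absNorm I ∧ Ideal.absNorm I ≤ X})) := by
    rintro ⟨⟨m, w⟩, hz⟩ ⟨⟨m', w'⟩, hz'⟩ h
    have hI' : I (m, w) = I (m', w') := congrArg Subtype.val h
    have hm : m = m' := by
      have := hI1 _ hz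
      rw [hI', hI1 _ hz'] at this
      exact this.symm
    subst hm
    have h1 : α - ((g.leadingCoeff * w : ℤ) : 𝓞 K) ∈ I (m, w) := by
      rw [hI2 _ hz]; simp
    rw [hI', hI2 _ hz', ← mul_sub] at h1
    have h2 := (hcop _ hz).2.dvd_of_dvd_mul_left h1
    have hw := (mem_rootPairs.1 hz).2.1
    have hw' := (mem_rootPairs.1 hz').2.1
    have h3 : (w : ℤ) = w' := by
      have := Int.eq_zero_of_abs_lt_dvd h2 (by simp only at hw hw'; rw [abs_lt]; omega)
      omega
    have : w = w' := by exact_mod_cast h3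
    subst this
    rfl
  have := Nat.card_le_card_of_injective _ hinj
  rwa [Nat.card_eq_fintype_card, Fintype.card_coe] at this

lemma exists_numberField_root {p : ℚ[X]} (hp : Irreducible p) :
    ∃ (K : Type) (_ : Field K) (_ : NumberField K) (θ : K),
      (∀ x : K, ∃ P : ℚ[X], aeval θ P = x) ∧ ∀ P : ℚ[X], aeval θ P = 0 ↔ p ∣ P := by
  have : Fact (Irreducible p) := ⟨hp⟩
  have : FiniteDimensional ℚ (AdjoinRoot p) := (AdjoinRoot.powerBasis hp.ne_zero).finite
  refine ⟨AdjoinRoot p, inferInstance,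
    { to_charZero := charZero_of_injective_algebraMap (algebraMap ℚ (AdjoinRoot p)).injective },
    AdjoinRoot.root p, fun x => ?_, fun P => ?_⟩
  · obtain ⟨P, rfl⟩ := AdjoinRoot.mk_surjective x
    exact ⟨P, AdjoinRoot.aeval_eq _⟩
  · rw [← AdjoinRoot.mk_eq_zero]
    exact Eq.congr_left (AdjoinRoot.aeval_eq P)

lemma exists_card_rootPairs_le {g : ℤ[X]} (hg : Irreducible g) (hdeg : 0 < g.natDegree) :
    ∃ D : ℕ, D ≠ 0 ∧ ∃ C : ℝ, 0 ≤ C ∧ ∀ B : ℕ, D ∣ B → ∀ X : ℕ,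
      ((rootPairs g B X).card : ℝ) ≤ C * X := by
  have hprim := hg.isPrimitive hdeg.ne'
  obtain ⟨K, _, _, θ, hθ, hdvd⟩ := exists_numberField_root
    ((IsPrimitive.Int.irreducible_iff_irreducible_map_cast hprim).1 hg)
  have hmap : ∀ P : ℤ[X], aeval θ P = 0 ↔ g ∣ P := by
    intro P
    rw [← aeval_map_algebraMap ℚ, algebraMap_int_eq, hdvd]
    exact (hprim.dvd_iff_fraction_map_dvd_fraction_map ℚ).symm
  obtain ⟨D, hD0, hD⟩ := card_rootPairs_le_card_ideal hθ hg.ne_zero ((hmap g).2 dvd_rfl)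
    fun P hP => (hmap P).1 hP
  obtain ⟨C, hC0, hC⟩ := exists_card_ideal_le K
  exact ⟨D, hD0, C, hC0, fun B hB X => (Nat.cast_le.2 (hD B hB X)).trans (hC X)⟩

/-- The roots of `g` modulo `l`, as natural numbers below `l`. -/
def rootsMod (g : ℤ[X]) (l : ℕ) : Finset ℕ :=
  (Finset.range l).filter fun v => (l : ℤ) ∣ g.eval (v : ℤ)

lemma dvd_eval_iff_of_dvd_sub {g : ℤ[X]} {m a b : ℤ} (h : m ∣ a - b) :
    m ∣ g.eval a ↔ m ∣ g.eval b :=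
  (dvd_iff_dvd_of_dvd_sub (h.trans (g.sub_dvd_eval_sub a b)))

lemma intCast_dvd_sub_mod (w m : ℕ) : (m : ℤ) ∣ (w : ℤ) - ((w % m : ℕ) : ℤ) := by
  rw [Int.natCast_mod]
  exact Int.dvd_self_sub_emod

lemma card_rootsMod_le {g : ℤ[X]} {l : ℕ} (hl : l.Prime) (hlead : ¬ (l : ℤ) ∣ g.leadingCoeff) :
    (rootsMod g l).card ≤ g.natDegree := by
  have : Fact l.Prime := ⟨hl⟩
  have h0 : g.map (Int.castRingHom (ZMod l)) ≠ 0 := by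
    intro h
    apply hlead
    have := congrArg (fun P => coeff P g.natDegree) h
    simpa [ZMod.intCast_zmod_eq_zero_iff_dvd] using this
  have hdeg : (g.map (Int.castRingHom (ZMod l))).natDegree ≤ g.natDegree := natDegree_map_le
  rw [← Finset.card_image_of_injOn (f := fun v : ℕ => (v : ZMod l)) (s := rootsMod g l)]
  · refine (card_le_degree_of_subset_roots ?_).trans hdeg
    intro x hx
    rw [Finset.mem_val, Finset.mem_image] at hx
    obtain ⟨v, hv, rfl⟩ := hx
    rw [mem_roots h0, IsRoot, ← Int.cast_natCast, eval_intCast_map, eq_intCast,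
      ZMod.intCast_zmod_eq_zero_iff_dvd]
    exact (Finset.mem_filter.1 hv).2
  · intro v hv v' hv' h
    have h1 := Finset.mem_range.1 (Finset.mem_filter.1 hv).1
    have h2 := Finset.mem_range.1 (Finset.mem_filter.1 hv').1
    have h3 := (ZMod.natCast_eq_natCast_iff' v v' l).1 h
    rwa [Nat.mod_eq_of_lt h1, Nat.mod_eq_of_lt h2] at h3

lemma card_filter_dvd_rootPairs_le {g u v : ℤ[X]} {r : ℤ} (h : u * g + v * derivative g = C r)
    {B : ℕ} (hrB : r ∣ B) (hlB : g.leadingCoeff ∣ B) {l : ℕ} (hl : l.Prime) (X : ℕ) :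
    ((rootPairs g B X).filter fun z => l ∣ z.1).card ≤
      (rootPairs g B (X / l)).card * g.natDegree := by
  by_cases hlB' : l ∣ B
  · rw [Finset.filter_false_of_mem, Finset.card_empty]
    · exact Nat.zero_le _
    · intro z hz hlz
      exact Nat.Prime.not_coprime_iff_dvd.2 ⟨l, hl, hlz, hlB'⟩ (mem_rootPairs.1 hz).2.2.1
  have hndvd : ∀ s : ℤ, s ∣ B → ¬ (l : ℤ) ∣ s := fun s hs hls =>
    hlB' (Int.natCast_dvd_natCast.1 (hls.trans hs))
  refine le_trans ?_ (Nat.mul_le_mul_left _ (card_rootsMod_le hl (hndvd _ hlB)))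
  rw [← Finset.card_product]
  have hlp := Nat.prime_iff_prime_int.1 hl
  refine Finset.card_le_card_of_injOn
    (fun z => ((z.1 / l, z.2 % (z.1 / l)), z.2 % l)) ?_ ?_
  · rintro ⟨m, w⟩ hz
    obtain ⟨hz1, m', rfl⟩ := Finset.mem_filter.1 (Finset.mem_coe.1 hz)
    obtain ⟨⟨h1, h2⟩, h3, h4, h5⟩ := mem_rootPairs.1 hz1
    simp only at h1 h2 h3 h4 h5
    push_cast at h5
    have hm' : 0 < m' := Nat.pos_of_mul_pos_left h1
    simp only [Finset.coe_product, Set.mem_prod, Finset.mem_coe,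
      Nat.mul_div_cancel_left _ hl.pos]
    refine ⟨mem_rootPairs.2 ⟨⟨hm', ?_⟩, Nat.mod_lt _ hm', h4.coprime_dvd_left ⟨l, mul_comm _ _⟩,
      ?_⟩, Finset.mem_filter.2 ⟨Finset.mem_range.2 (Nat.mod_lt _ hl.pos), ?_⟩⟩
    · rwa [Nat.le_div_iff_mul_le hl.pos, mul_comm]
    · exact (dvd_eval_iff_of_dvd_sub (intCast_dvd_sub_mod w m')).1 ((Dvd.intro_left _ rfl).trans h5)
    · exact (dvd_eval_iff_of_dvd_sub (intCast_dvd_sub_mod w l)).1 ((Dvd.intro _ rfl).trans h5)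
  · rintro ⟨m, w⟩ hz ⟨m₂, w₂⟩ hz' heq
    obtain ⟨hz1, m', rfl⟩ := Finset.mem_filter.1 (Finset.mem_coe.1 hz)
    obtain ⟨hz1', m₂', rfl⟩ := Finset.mem_filter.1 (Finset.mem_coe.1 hz')
    simp only [Nat.mul_div_cancel_left _ hl.pos, Prod.mk.injEq] at heq
    obtain ⟨⟨rfl, h1⟩, h2⟩ := heq
    obtain ⟨⟨h3, -⟩, h4, -, h5⟩ := mem_rootPairs.1 hz1
    obtain ⟨-, h4', -, h5'⟩ := mem_rootPairs.1 hz1'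
    simp only at h3 h4 h5 h4' h5'
    push_cast at h5 h5'
    have hm' : 0 < m' := Nat.pos_of_mul_pos_left h3
    have h6 := mul_dvd_sub_of_simple_root hlp (m := m') (by exact_mod_cast hm'.ne') h5 h5'
      (derivative_eval_ne_of_bezout h (hndvd _ hrB) ((Dvd.intro _ rfl).trans h5))
      (Nat.modEq_iff_dvd.1 h1) (Nat.modEq_iff_dvd.1 h2)
    have h7 := Int.eq_zero_of_abs_lt_dvd h6 (by
      rw [abs_lt]; push_cast at *; constructor <;> nlinarith)
    have : w = w₂ := by omega
    rw [this]

lemma primeFactorWeight_eq_sum {m X : ℕ} (h1 : 1 ≤ m) (h2 : m ≤ X) :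
    primeFactorWeight m = ∑ l ∈ (Finset.Icc 1 X).filter Nat.Prime,
      if l ∣ m then ((l : ℝ) ^ (1 / 2 : ℝ))⁻¹ else 0 := by
  rw [← Finset.sum_filter, primeFactorWeight]
  refine Finset.sum_congr ?_ fun _ _ => rfl
  ext l
  simp only [Nat.mem_primeFactors, Finset.mem_filter, Finset.mem_Icc]
  constructor
  · rintro ⟨h3, h4, h5⟩
    exact ⟨⟨⟨h3.one_le, (Nat.le_of_dvd h1 h4).trans h2⟩, h3⟩, h4⟩
  · rintro ⟨⟨-, h3⟩, h4⟩
    exact ⟨h3, h4, by omega⟩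

lemma exists_sum_weight_rootPairs_le {g : ℤ[X]} (hg : Irreducible g) (hdeg : 0 < g.natDegree) :
    ∃ D : ℕ, D ≠ 0 ∧ ∃ C : ℝ, 0 ≤ C ∧ ∀ B : ℕ, D ∣ B → ∀ X : ℕ,
      ∑ z ∈ rootPairs g B X, (1 + primeFactorWeight z.1) ≤ C * X := by
  have hprim := hg.isPrimitive hdeg.ne'
  obtain ⟨D, hD0, C, hC0, hC⟩ := exists_card_rootPairs_le hg hdeg
  obtain ⟨r, hr0, u, v, huv⟩ := exists_bezout
    ((IsPrimitive.Int.irreducible_iff_irreducible_map_cast hprim).1 hg).separable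
  have hs : Summable fun m : ℕ => ((m : ℝ) ^ (3 / 2 : ℝ))⁻¹ :=
    Real.summable_nat_rpow_inv.2 (by norm_num)
  have hts : 0 ≤ ∑' m : ℕ, ((m : ℝ) ^ (3 / 2 : ℝ))⁻¹ := tsum_nonneg fun m => by positivity
  refine ⟨D * (r * g.leadingCoeff).natAbs, mul_ne_zero hD0 (by simpa using ⟨hr0, hg.ne_zero⟩),
    C + C * g.natDegree * ∑' m : ℕ, ((m : ℝ) ^ (3 / 2 : ℝ))⁻¹, by positivity,
    fun B hB X => ?_⟩
  have hB1 : D ∣ B := (Dvd.intro _ rfl).trans hB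
  have hB2 : r * g.leadingCoeff ∣ (B : ℤ) :=
    Int.natAbs_dvd.1 (Int.natCast_dvd_natCast.2 ((Dvd.intro_left _ rfl).trans hB))
  rw [Finset.sum_add_distrib, add_mul]
  refine add_le_add (by simpa using hC B hB1 X) ?_
  have h1 : ∀ z ∈ rootPairs g B X, primeFactorWeight z.1 =
      ∑ l ∈ (Finset.Icc 1 X).filter Nat.Prime,
        if l ∣ z.1 then ((l : ℝ) ^ (1 / 2 : ℝ))⁻¹ else 0 := by
    intro z hz
    exact primeFactorWeight_eq_sum (mem_rootPairs.1 hz).1.1 (mem_rootPairs.1 hz).1.2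
  rw [Finset.sum_congr rfl h1, Finset.sum_comm]
  have h2 : ∀ l ∈ (Finset.Icc 1 X).filter Nat.Prime, (∑ z ∈ rootPairs g B X,
      if l ∣ z.1 then ((l : ℝ) ^ (1 / 2 : ℝ))⁻¹ else 0) ≤
      C * g.natDegree * X * ((l : ℝ) ^ (3 / 2 : ℝ))⁻¹ := by
    intro l hl
    have hlp := (Finset.mem_filter.1 hl).2
    have hl0 : (0 : ℝ) < l := by exact_mod_cast hlp.pos
    rw [← Finset.sum_filter, Finset.sum_const, nsmul_eq_mul]
    have h3 : (((rootPairs g B X).filter fun z => l ∣ z.1).card : ℝ) ≤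
        C * (X / l) * g.natDegree := by
      have h4 := card_filter_dvd_rootPairs_le huv ((Dvd.intro _ rfl).trans hB2)
        ((Dvd.intro_left _ rfl).trans hB2) hlp X
      have h5 : ((rootPairs g B (X / l)).card : ℝ) ≤ C * (X / l) :=
        (hC B hB1 _).trans (mul_le_mul_of_nonneg_left Nat.cast_div_le hC0)
      calc _ ≤ (((rootPairs g B (X / l)).card * g.natDegree : ℕ) : ℝ) := Nat.cast_le.2 h4
        _ ≤ _ := by push_cast; gcongr
    have h6 : ((l : ℝ) ^ (3 / 2 : ℝ))⁻¹ = (l : ℝ)⁻¹ * ((l : ℝ) ^ (1 / 2 : ℝ))⁻¹ := by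
      rw [← mul_inv, ← Real.rpow_one_add' hl0.le (by norm_num)]
      norm_num
    calc _ ≤ C * (X / l) * g.natDegree * ((l : ℝ) ^ (1 / 2 : ℝ))⁻¹ := by gcongr
      _ = _ := by rw [h6, div_eq_mul_inv]; ring
  refine (Finset.sum_le_sum h2).trans ?_
  rw [← Finset.mul_sum]
  calc _ ≤ C * g.natDegree * X * ∑' m : ℕ, ((m : ℝ) ^ (3 / 2 : ℝ))⁻¹ := by
        gcongr
        exact hs.sum_le_tsum _ fun m _ => by positivity
    _ = _ := by ring

lemma exists_sum_weight_Icc_le : ∃ C : ℝ, 0 ≤ C ∧ ∀ W : ℕ,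
    ∑ b ∈ Finset.Icc 1 W, (1 + primeFactorWeight b) ≤ C * W := by
  have hs : Summable fun m : ℕ => ((m : ℝ) ^ (3 / 2 : ℝ))⁻¹ :=
    Real.summable_nat_rpow_inv.2 (by norm_num)
  have hts : 0 ≤ ∑' m : ℕ, ((m : ℝ) ^ (3 / 2 : ℝ))⁻¹ := tsum_nonneg fun m => by positivity
  refine ⟨1 + ∑' m : ℕ, ((m : ℝ) ^ (3 / 2 : ℝ))⁻¹, by positivity, fun W => ?_⟩
  rw [Finset.sum_add_distrib, add_mul]
  refine add_le_add (by simp) ?_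
  have h1 : ∀ b ∈ Finset.Icc 1 W, primeFactorWeight b = ∑ l ∈ (Finset.Icc 1 W).filter Nat.Prime,
        if l ∣ b then ((l : ℝ) ^ (1 / 2 : ℝ))⁻¹ else 0 := by
    intro b hb
    exact primeFactorWeight_eq_sum (Finset.mem_Icc.1 hb).1 (Finset.mem_Icc.1 hb).2
  rw [Finset.sum_congr rfl h1, Finset.sum_comm]
  have h2 : ∀ l ∈ (Finset.Icc 1 W).filter Nat.Prime, (∑ b ∈ Finset.Icc 1 W,
      if l ∣ b then ((l : ℝ) ^ (1 / 2 : ℝ))⁻¹ else 0) ≤ W * ((l : ℝ) ^ (3 / 2 : ℝ))⁻¹ := by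
    intro l hl
    have hlp := (Finset.mem_filter.1 hl).2
    have hl0 : (0 : ℝ) < l := by exact_mod_cast hlp.pos
    rw [← Finset.sum_filter, Finset.sum_const, nsmul_eq_mul]
    have h3 : (((Finset.Icc 1 W).filter fun b => l ∣ b).card : ℝ) ≤ W / l := by
      rw [show Finset.Icc 1 W = Finset.Ioc 0 W from rfl, Nat.Ioc_filter_dvd_card_eq_div]
      exact Nat.cast_div_le
    have h6 : ((l : ℝ) ^ (3 / 2 : ℝ))⁻¹ = (l : ℝ)⁻¹ * ((l : ℝ) ^ (1 / 2 : ℝ))⁻¹ := by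
      rw [← mul_inv, ← Real.rpow_one_add' hl0.le (by norm_num)]
      norm_num
    calc _ ≤ (W / l) * ((l : ℝ) ^ (1 / 2 : ℝ))⁻¹ := by gcongr
      _ = _ := by rw [h6, div_eq_mul_inv]; ring
  refine (Finset.sum_le_sum h2).trans ?_
  rw [← Finset.mul_sum, mul_comm]
  gcongr
  exact hs.sum_le_tsum _ fun m _ => by positivity

/-- The degree `n` homogenization of `f`, evaluated at `(a, b)`. -/
def homEval (f : ℤ[X]) (n : ℕ) (a b : ℤ) : ℤ :=
  ∑ i ∈ Finset.range (n + 1), f.coeff i * a ^ i * b ^ (n - i)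

lemma intCast_homEval {A : Type*} [CommRing A] {f : ℤ[X]} {n : ℕ} (hn : f.natDegree ≤ n)
    {a b : ℤ} {t : A} (h : (a : A) = b * t) : (homEval f n a b : A) = b ^ n * aeval t f := by
  rw [homEval, aeval_eq_sum_range' (Nat.lt_succ_of_le hn), Finset.mul_sum, Int.cast_sum]
  refine Finset.sum_congr rfl fun i hi => ?_
  have hi : i ≤ n := Nat.lt_succ_iff.1 (Finset.mem_range.1 hi)
  simp only [Int.cast_mul, Int.cast_pow, h, zsmul_eq_mul]
  rw [mul_pow]
  conv_rhs => rw [← Nat.sub_add_cancel hi, pow_add]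
  ring

lemma homEval_one (f : ℤ[X]) {n : ℕ} (hn : f.natDegree ≤ n) (a : ℤ) :
    homEval f n a 1 = f.eval a := by
  have := intCast_homEval (A := ℤ) hn (a := a) (b := 1) (t := a) (by simp)
  simpa [coe_aeval_eq_eval] using this

lemma homEval_modEq (f : ℤ[X]) (n : ℕ) {m a a' b b' : ℤ} (ha : a ≡ a' [ZMOD m])
    (hb : b ≡ b' [ZMOD m]) : homEval f n a b ≡ homEval f n a' b' [ZMOD m] := by
  rw [Int.modEq_iff_dvd, homEval, homEval, ← Finset.sum_sub_distrib]
  refine Finset.dvd_sum fun i _ => Int.modEq_iff_dvd.1 ?_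
  exact ((ha.pow i).mul_left _).mul (hb.pow _)

lemma abs_homEval_le (f : ℤ[X]) (n : ℕ) {a b W : ℤ} (ha : |a| ≤ W) (hb : |b| ≤ W) :
    |homEval f n a b| ≤ (∑ i ∈ Finset.range (n + 1), |f.coeff i|) * W ^ n := by
  rw [homEval, Finset.sum_mul]
  refine (Finset.abs_sum_le_sum_abs _ _).trans (Finset.sum_le_sum fun i hi => ?_)
  have hi : i ≤ n := Nat.lt_succ_iff.1 (Finset.mem_range.1 hi)
  have hW : 0 ≤ W := (abs_nonneg a).trans ha
  rw [abs_mul, abs_mul, abs_pow, abs_pow, mul_assoc]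
  conv_rhs => rw [← Nat.add_sub_cancel' hi, pow_add]
  gcongr

lemma dvd_pow_of_dvd_homEval {f : ℤ[X]} {n : ℕ} {a b l : ℤ} (hl : l ∣ b)
    (h : l ∣ homEval f n a b) : l ∣ f.coeff n * a ^ n := by
  rw [homEval, Finset.sum_range_succ, Nat.sub_self, pow_zero, mul_one] at h
  refine (dvd_add_right (Finset.dvd_sum fun i hi => ?_)).1 h
  have hi := Finset.mem_range.1 hi
  exact (hl.trans (dvd_pow_self b (by omega))).mul_left _

lemma separable_map_zmod {f u v : ℤ[X]} {r : ℤ} (h : u * f + v * derivative f = C r) {l : ℕ}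
    [Fact l.Prime] (hl : ¬ (l : ℤ) ∣ r) : (f.map (Int.castRingHom (ZMod l))).Separable := by
  have hr : (r : ZMod l) ≠ 0 := by rwa [Ne, ZMod.intCast_zmod_eq_zero_iff_dvd]
  have h1 := congrArg (Polynomial.map (Int.castRingHom (ZMod l))) h
  rw [Polynomial.map_add, Polynomial.map_mul, Polynomial.map_mul, map_C, ← derivative_map] at h1
  refine ⟨C (r : ZMod l)⁻¹ * u.map (Int.castRingHom (ZMod l)),
    C (r : ZMod l)⁻¹ * v.map (Int.castRingHom (ZMod l)), ?_⟩
  rw [mul_assoc, mul_assoc, ← mul_add, h1, ← C_mul, eq_intCast, inv_mul_cancel₀ hr, C_1]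

lemma natDegree_map_zmod {f : ℤ[X]} {l : ℕ} (hl : ¬ (l : ℤ) ∣ f.leadingCoeff) :
    (f.map (Int.castRingHom (ZMod l))).natDegree = f.natDegree := by
  refine natDegree_map_of_leadingCoeff_ne_zero _ ?_
  rwa [eq_intCast, Ne, ZMod.intCast_zmod_eq_zero_iff_dvd]

lemma not_dvd_of_natAbs_lt {l : ℕ} {s : ℤ} (hs : s ≠ 0) (h : s.natAbs < l) : ¬ (l : ℤ) ∣ s :=
  fun hd => by
    have := Nat.le_of_dvd (Int.natAbs_pos.2 hs) (Int.natCast_dvd.1 hd)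
    omega

lemma card_square_values_le {g : ℤ[X]} (hdeg : 0 < g.natDegree)
    (hsep : (g.map (Int.castRingHom ℚ)).Separable) : ∃ δ : ℝ, 0 < δ ∧ δ ≤ 1 ∧ ∃ R : ℕ,
    ∀ l : ℕ, l.Prime → R < l → ∀ c : ℤ, ¬ (l : ℤ) ∣ c → ∀ s : Finset ℕ,
      (∀ v ∈ s, v = l ∨ v < l ∧ IsSquare ((g.eval (v : ℤ) * c : ℤ) : ZMod l)) →
      (1 + δ) * (s.card : ℝ) ≤ l := by
  obtain ⟨r, hr0, u, v, huv⟩ := exists_bezout hsep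
  obtain ⟨P₀, D, hD0, hD⟩ := card_values_in_coset (max g.natDegree 2) (by omega)
  have hg0 : g ≠ 0 := by rintro rfl; simp at hdeg
  have hD' : (1 : ℝ) ≤ D := by exact_mod_cast hD0
  refine ⟨1 / (2 * D), by positivity, ?_, P₀ + r.natAbs + g.leadingCoeff.natAbs + 4 * D, ?_⟩
  · rw [div_le_one (by positivity)]; linarith
  intro l hl hRl c hc s hs
  have : Fact l.Prime := ⟨hl⟩
  have hlead : ¬ (l : ℤ) ∣ g.leadingCoeff :=
    not_dvd_of_natAbs_lt (leadingCoeff_ne_zero.2 hg0) (by omega)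
  have hdeg' := natDegree_map_zmod hlead
  have hsep' := separable_map_zmod huv (not_dvd_of_natAbs_lt hr0 (by omega) : ¬ (l : ℤ) ∣ r)
  have hodd : l = 2 * (l / 2) + 1 := by
    rcases hl.eq_two_or_odd with h | h <;> omega
  have hc0 : (c : ZMod l) ≠ 0 := by rwa [Ne, ZMod.intCast_zmod_eq_zero_iff_dvd]
  obtain ⟨ν, hν⟩ := FiniteField.exists_nonsquare (F := ZMod l) (by
    rw [ZMod.ringChar_zmod_n]; omega)
  have hν0 : ν ≠ 0 := by rintro rfl; exact hν (IsSquare.zero)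
  have hst := hD l (by omega) 2 (l / 2) (by norm_num) (by omega) hodd
    (g.map (Int.castRingHom (ZMod l))) (by rw [hdeg']; omega) (by rwa [hdeg']) hsep' (ν * c)
    (mul_ne_zero hν0 hc0)
  set bad := Finset.univ.filter fun t : ZMod l =>
    (g.map (Int.castRingHom (ZMod l))).eval t ≠ 0 ∧
      (g.map (Int.castRingHom (ZMod l))).eval t ^ (l / 2) = (ν * c) ^ (l / 2) with hbad
  have hdisj : Disjoint (s.erase l) (bad.image ZMod.val) := by
    rw [Finset.disjoint_left]
    intro w hw hw'
    obtain ⟨hwl, hws⟩ := Finset.mem_erase.1 hw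
    obtain ⟨t, ht, rfl⟩ := Finset.mem_image.1 hw'
    obtain ⟨-, hsq⟩ := (hs _ hws).resolve_left hwl
    obtain ⟨-, ht1, ht2⟩ := Finset.mem_filter.1 ht
    have hev : ((g.eval ((t.val : ℕ) : ℤ) * c : ℤ) : ZMod l) =
        (g.map (Int.castRingHom (ZMod l))).eval t * c := by
      have := eval_intCast_map (Int.castRingHom (ZMod l)) g ((t.val : ℕ) : ℤ)
      rw [Int.cast_natCast, ZMod.natCast_zmod_val, eq_intCast] at this
      rw [Int.cast_mul, this, Int.cast_id]
    rw [hev, ZMod.euler_criterion l (mul_ne_zero ht1 hc0), mul_pow, ht2, ← mul_pow] at hsq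
    have h1 := (ZMod.euler_criterion l (mul_ne_zero (mul_ne_zero hν0 hc0) hc0)).2 hsq
    rw [mul_assoc] at h1
    obtain ⟨y, hy⟩ := h1
    exact hν ⟨y / c, by field_simp; linear_combination hy⟩
  have hcard : (s.erase l ∪ bad.image ZMod.val).card ≤ l := by
    refine (Finset.card_le_card fun w hw => ?_).trans_eq (Finset.card_range l)
    rcases Finset.mem_union.1 hw with h | h
    · obtain ⟨hwl, hws⟩ := Finset.mem_erase.1 h
      exact Finset.mem_range.2 ((hs _ hws).resolve_left hwl).1
    · obtain ⟨t, -, rfl⟩ := Finset.mem_image.1 h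
      exact Finset.mem_range.2 (ZMod.val_lt t)
  rw [Finset.card_union_of_disjoint hdisj,
    Finset.card_image_of_injective _ (ZMod.val_injective l)] at hcard
  have h1 : s.card - 1 ≤ (s.erase l).card := Finset.pred_card_le_card_erase
  have h2 : (s.card : ℝ) + bad.card ≤ l + 1 := by
    exact_mod_cast (by omega : s.card + bad.card ≤ l + 1)
  have h3 : (l : ℝ) ≤ D * bad.card := by exact_mod_cast hst
  have h4 : (4 * D : ℝ) ≤ l := by exact_mod_cast (by omega : 4 * D ≤ l)
  have h5 : (D : ℝ) * s.card ≤ D * l + D - l := by nlinarith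
  have hD1 : (D : ℝ) ≠ 0 := by positivity
  have h6 : (1 + 1 / (2 * D) : ℝ) * s.card = (2 * D + 1) * (D * s.card) / (2 * D ^ 2) := by
    clear * - hD1
    field_simp
  rw [h6, div_le_iff₀ (by positivity)]
  calc (2 * D + 1 : ℝ) * (D * s.card) ≤ (2 * D + 1) * (D * l + D - l) := by gcongr
    _ ≤ l * (2 * D ^ 2) := by nlinarith [mul_le_mul_of_nonneg_left h4 (by linarith : (0:ℝ) ≤ D)]

lemma exists_sum_div_log_sq_le {C ε : ℝ} (hC : 0 ≤ C) (hε : 0 < ε) : ∃ T₀ : ℕ, 2 ≤ T₀ ∧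
    ∀ {ι : Type} (P : Finset ι) (h : ι → ℕ) (w : ι → ℝ) (V : ℕ), (∀ i ∈ P, 0 < h i) →
      (∀ i ∈ P, 0 ≤ w i) → (∀ i ∈ P, h i * T₀ ≤ V) →
      (∀ X : ℕ, ∑ i ∈ P with h i ≤ X, w i ≤ C * X) →
      ∑ i ∈ P, (V / h i : ℝ) * w i / Real.log (V / h i) ^ 2 ≤ ε * V := by
  obtain ⟨k, hk⟩ := exists_nat_gt (16 * C / ε)
  have hk0 : 0 < k := by
    have : (0 : ℝ) < k := lt_of_le_of_lt (by positivity) hk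
    exact_mod_cast this
  refine ⟨2 ^ k, by simpa using Nat.pow_le_pow_right (n := 2) (by norm_num) hk0, ?_⟩
  intro ι P h w V hh hw hV hX
  have hlog2 : (1 / 2 : ℝ) ≤ Real.log 2 := by linarith [Real.log_two_gt_d9]
  set j : ι → ℕ := fun i => Nat.log 2 (V / h i) with hj
  have hVpos : ∀ i ∈ P, 0 < V := fun i hi => lt_of_lt_of_le
    (Nat.mul_pos (hh i hi) (by positivity)) (hV i hi)
  have hle : ∀ i ∈ P, 2 ^ j i * h i ≤ V := fun i hi => by
    refine (Nat.le_div_iff_mul_le (hh i hi)).1 (Nat.pow_log_le_self 2 ?_)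
    have : 2 ^ k ≤ V / h i := (Nat.le_div_iff_mul_le (hh i hi)).2 (by linarith [hV i hi])
    have : 0 < 2 ^ k := by positivity
    omega
  have hlt : ∀ i ∈ P, V < 2 ^ (j i + 1) * h i := fun i hi =>
    (Nat.div_lt_iff_lt_mul (hh i hi)).1 (Nat.lt_pow_succ_log_self (by norm_num) _)
  have hkj : ∀ i ∈ P, k ≤ j i := fun i hi => by
    refine Nat.le_log_of_pow_le (by norm_num) ((Nat.le_div_iff_mul_le (hh i hi)).2 ?_)
    linarith [hV i hi]
  have hmap : Set.MapsTo j P (Finset.Ioo (k - 1) (V + 1)) := fun i hi => by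
    have h1 := hkj i hi
    have h2 : j i ≤ V := by
      have := hle i hi
      have h3 : j i < 2 ^ j i := Nat.lt_two_pow_self
      nlinarith [hh i hi]
    simp only [Finset.coe_Ioo, Set.mem_Ioo]
    omega
  rw [← Finset.sum_fiberwise_of_maps_to hmap]
  have hfib : ∀ t ∈ Finset.Ioo (k - 1) (V + 1),
      ∑ i ∈ P with j i = t, (V / h i : ℝ) * w i / Real.log (V / h i) ^ 2 ≤
        8 * C * V * ((t : ℝ) ^ 2)⁻¹ := by
    intro t ht
    have ht0 : (0 : ℝ) < t := by
      have := (Finset.mem_Ioo.1 ht).1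
      exact_mod_cast (by omega : 0 < t)
    have h1 : ∀ i ∈ P.filter (fun i => j i = t),
        (V / h i : ℝ) * w i / Real.log (V / h i) ^ 2 ≤ 2 ^ (t + 1) * 4 / (t : ℝ) ^ 2 * w i := by
      intro i hit
      obtain ⟨hi, rfl⟩ := Finset.mem_filter.1 hit
      have hh0 : (0 : ℝ) < h i := by exact_mod_cast hh i hi
      have ha : (V / h i : ℝ) ≤ 2 ^ (j i + 1) := by
        rw [div_le_iff₀ hh0]; exact_mod_cast (hlt i hi).le
      have hb : (2 : ℝ) ^ j i ≤ V / h i := by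
        rw [le_div_iff₀ hh0]; exact_mod_cast hle i hi
      have hc : (j i : ℝ) / 2 ≤ Real.log (V / h i) := by
        have := Real.log_le_log (by positivity) hb
        rw [Real.log_pow] at this
        nlinarith
      calc (V / h i : ℝ) * w i / Real.log (V / h i) ^ 2
          ≤ 2 ^ (j i + 1) * w i / ((j i : ℝ) / 2) ^ 2 := by
            have := hw i hi
            gcongr
        _ = _ := by field_simp; ring
    have h2 : ∑ i ∈ P with j i = t, w i ≤ C * (V / 2 ^ t) := by
      refine le_trans (Finset.sum_le_sum_of_subset_of_nonneg ?_ ?_)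
        ((hX (V / 2 ^ t)).trans ?_)
      · intro i hit
        obtain ⟨hi, rfl⟩ := Finset.mem_filter.1 hit
        refine Finset.mem_filter.2 ⟨hi, (Nat.le_div_iff_mul_le (by positivity)).2 ?_⟩
        rw [mul_comm]
        exact hle i hi
      · exact fun i hi _ => hw i (Finset.mem_filter.1 hi).1
      · gcongr
        exact_mod_cast Nat.cast_div_le (α := ℝ) (m := V) (n := 2 ^ t)
    refine (Finset.sum_le_sum h1).trans ?_
    rw [← Finset.mul_sum]
    calc 2 ^ (t + 1) * 4 / (t : ℝ) ^ 2 * ∑ i ∈ P with j i = t, w i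
        ≤ 2 ^ (t + 1) * 4 / (t : ℝ) ^ 2 * (C * (V / 2 ^ t)) := by gcongr
      _ = _ := by field_simp; ring
  refine (Finset.sum_le_sum hfib).trans ?_
  rw [← Finset.mul_sum]
  have h1 := sum_Ioo_inv_sq_le (α := ℝ) (k - 1) (V + 1)
  have h2 : ((k - 1 : ℕ) : ℝ) + 1 = k := by
    exact_mod_cast (by omega : k - 1 + 1 = k)
  rw [h2] at h1
  have hk' : (0 : ℝ) < k := by exact_mod_cast hk0
  calc 8 * C * V * ∑ i ∈ Finset.Ioo (k - 1) (V + 1), ((i : ℝ) ^ 2)⁻¹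
      ≤ 8 * C * V * (2 / k) := by gcongr
    _ = 16 * C / k * V := by ring
    _ ≤ ε * V := by
      gcongr
      rw [div_le_iff₀ hk']
      rw [div_lt_iff₀ hε] at hk
      linarith

lemma card_le_three_mul_of_injOn {ι : Type} {Z : Finset ι} {T : ℝ} (hT : 1 ≤ T) (D : ι → ℤ)
    (hinj : Set.InjOn D Z) (hD : ∀ z ∈ Z, |(D z : ℝ)| ≤ T) : (Z.card : ℝ) ≤ 3 * T := by
  have h1 : Z.card ≤ (Finset.Icc (-⌊T⌋) ⌊T⌋).card := by
    refine Finset.card_le_card_of_injOn D (fun z hz => ?_) hinj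
    obtain ⟨h1, h2⟩ := abs_le.1 (hD z hz)
    simp only [Finset.coe_Icc, Set.mem_Icc]
    refine ⟨?_, Int.le_floor.2 h2⟩
    rw [neg_le]
    exact Int.le_floor.2 (by push_cast; linarith)
  have hf : 0 ≤ ⌊T⌋ := Int.floor_nonneg.2 (by linarith)
  have h2 : (Z.card : ℤ) ≤ 2 * ⌊T⌋ + 1 := by
    rw [Int.card_Icc] at h1
    omega
  have h3 : (Z.card : ℝ) ≤ 2 * ⌊T⌋ + 1 := by exact_mod_cast h2
  linarith [Int.floor_le T]

lemma eq_of_mul_eq_mul_of_coprime {a b a' b' : ℕ} (h : a.Coprime b) (h' : a'.Coprime b')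
    (he : a * b' = a' * b) : a = a' ∧ b = b' := by
  refine ⟨Nat.dvd_antisymm ?_ ?_, Nat.dvd_antisymm ?_ ?_⟩
  · exact h.dvd_of_dvd_mul_right (Dvd.intro _ he)
  · exact h'.dvd_of_dvd_mul_right (Dvd.intro _ he.symm)
  · exact h.symm.dvd_of_dvd_mul_left (Dvd.intro_left _ he.symm)
  · exact h'.symm.dvd_of_dvd_mul_left (Dvd.intro_left _ he)

/-- The slope `a / b` modulo `l`, with `l` standing for the point at infinity. -/
def slope (l : ℕ) (z : ℕ × ℕ) : ℕ :=
  if l ∣ z.2 then l else ((z.1 : ZMod l) * (z.2 : ZMod l)⁻¹).val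

lemma dvd_of_slope_eq {l : ℕ} (hl : l.Prime) {z z' : ℕ × ℕ} (h : slope l z = slope l z') :
    (l : ℤ) ∣ z.1 * z'.2 - z'.1 * z.2 := by
  have : Fact l.Prime := ⟨hl⟩
  unfold slope at h
  split_ifs at h with h1 h2 h2
  · exact dvd_sub ((Int.natCast_dvd_natCast.2 h2).mul_left _)
      ((Int.natCast_dvd_natCast.2 h1).mul_left _)
  · exact absurd h.symm (ZMod.val_lt _).ne
  · exact absurd h (ZMod.val_lt _).ne
  · have h3 := ZMod.val_injective l h
    have hz : (z.2 : ZMod l) ≠ 0 := by rwa [Ne, ZMod.natCast_eq_zero_iff]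
    have hz' : (z'.2 : ZMod l) ≠ 0 := by rwa [Ne, ZMod.natCast_eq_zero_iff]
    rw [← ZMod.intCast_zmod_eq_zero_iff_dvd]
    push_cast
    field_simp at h3
    linear_combination h3

lemma isSquare_eval_slope {g : ℤ[X]} {n : ℕ} (hn : g.natDegree ≤ n) {l : ℕ} (hl : l.Prime)
    {z : ℕ × ℕ} {β s : ℤ} {q : ℕ} (hz : ¬ l ∣ z.2) (hβ : IsSquare (β * (z.2 : ℤ) ^ n))
    (h : homEval g n z.1 z.2 = s * q ^ 2) :
    IsSquare ((g.eval (slope l z : ℤ) * (β * s) : ℤ) : ZMod l) := by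
  have : Fact l.Prime := ⟨hl⟩
  have hz : (z.2 : ZMod l) ≠ 0 := by rwa [Ne, ZMod.natCast_eq_zero_iff]
  have hs : ((slope l z : ℕ) : ZMod l) = (z.1 : ZMod l) * (z.2 : ZMod l)⁻¹ := by
    rw [slope, if_neg (by assumption), ZMod.natCast_zmod_val]
  have h1 := intCast_homEval (A := ZMod l) hn (a := z.1) (b := z.2) (t := slope l z) (by
    rw [hs]; push_cast; field_simp)
  rw [h] at h1
  have h2 : aeval ((slope l z : ℕ) : ZMod l) g = ((g.eval (slope l z : ℤ) : ℤ) : ZMod l) := by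
    have := eval_intCast_map (Int.castRingHom (ZMod l)) g (slope l z : ℤ)
    rw [Int.cast_natCast, eq_intCast, Int.cast_id] at this
    rw [← this, aeval_def, eval_map, algebraMap_int_eq]
  rw [h2] at h1
  obtain ⟨y, hy⟩ := hβ
  have hy' : (β : ZMod l) * (z.2 : ZMod l) ^ n = y * y := by exact_mod_cast congrArg _ hy
  push_cast at h1 ⊢
  refine ⟨s * q * y / (z.2 : ZMod l) ^ n, ?_⟩
  have : (z.2 : ZMod l) ^ n ≠ 0 := pow_ne_zero _ hz
  field_simp
  linear_combination (s : ZMod l)^2 * q^2 * hy' - s * β * (z.2 : ZMod l) ^ n * h1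

lemma exists_card_fiber_le {g : ℤ[X]} (hdeg : 0 < g.natDegree)
    (hsep : (g.map (Int.castRingHom ℚ)).Separable) : ∃ C : ℝ, 0 ≤ C ∧
    ∀ (Z : Finset (ℕ × ℕ)) (s : ℤ) (m β : ℕ) (T : ℝ), 2 ≤ T → s ≠ 0 → m ≠ 0 → β ≠ 0 →
      (∀ z ∈ Z, 0 < z.1 ∧ 0 < z.2 ∧ z.1.Coprime z.2 ∧ IsSquare ((β : ℤ) * (z.2 : ℤ) ^ g.natDegree) ∧
        ∃ q : ℕ, homEval g g.natDegree z.1 z.2 = s * m * q ^ 2) →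
      (∀ z ∈ Z, ∀ z' ∈ Z, ((β * m : ℕ) : ℤ) ∣ z.1 * z'.2 - z'.1 * z.2 ∧
        |((z.1 * z'.2 - z'.1 * z.2 : ℤ) : ℝ)| ≤ T * (β * m : ℕ)) →
      (Z.card : ℝ) ≤ C * (T * (1 + primeFactorWeight (β * m * s.natAbs)) / Real.log T ^ 2) := by
  obtain ⟨δ, hδ0, hδ1, R, hR⟩ := card_square_values_le hdeg hsep
  obtain ⟨C, hC0, hC⟩ := card_le_of_residues hδ0 hδ1 R
  refine ⟨C, hC0, fun Z s m β T hT hs hm hβ hZ hZZ => ?_⟩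
  have hβm : ((β * m : ℕ) : ℤ) ≠ 0 := by exact_mod_cast mul_ne_zero hβ hm
  set D : ℕ × ℕ → ℕ × ℕ → ℤ := fun z z' => (z.1 * z'.2 - z'.1 * z.2) / (β * m : ℕ) with hD
  have hDmul : ∀ z ∈ Z, ∀ z' ∈ Z, (z.1 * z'.2 - z'.1 * z.2 : ℤ) = (β * m : ℕ) * D z z' :=
    fun z hz z' hz' => (Int.mul_ediv_cancel' (hZZ z hz z' hz').1).symm
  have hDT : ∀ z ∈ Z, ∀ z' ∈ Z, |(D z z' : ℝ)| ≤ T := fun z hz z' hz' => by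
    have h1 := (hZZ z hz z' hz').2
    have h2 : (0 : ℝ) < (β * m : ℕ) := by exact_mod_cast Nat.pos_of_ne_zero (mul_ne_zero hβ hm)
    rw [hDmul z hz z' hz', Int.cast_mul, Int.cast_natCast, abs_mul, abs_of_pos h2, mul_comm] at h1
    exact le_of_mul_le_mul_right h1 h2
  have hc : β * m * s.natAbs ≠ 0 := mul_ne_zero (mul_ne_zero hβ hm) (Int.natAbs_ne_zero.2 hs)
  refine hC Z T (β * m * s.natAbs) D slope hT hc ?_ (fun z hz z' hz' _ => hDT z hz z' hz') ?_ ?_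
  · intro z hz z' hz' hne h0
    have h1 := hDmul z hz z' hz'
    rw [h0, mul_zero, sub_eq_zero] at h1
    have := eq_of_mul_eq_mul_of_coprime (hZ z hz).2.2.1 (hZ z' hz').2.2.1 (by exact_mod_cast h1)
    exact hne (Prod.ext this.1 this.2)
  · intro l hl hRl hlc
    have hlp : Prime (l : ℤ) := Nat.prime_iff_prime_int.1 hl
    refine ⟨?_, fun z hz z' hz' h => ?_⟩
    · refine hR l hl hRl (β * (s * m)) ?_ _ fun v hv => ?_
      · intro h
        refine hlc ?_
        have := Int.natCast_dvd.1 h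
        simpa [Int.natAbs_mul, mul_comm, mul_left_comm, mul_assoc] using this
      · obtain ⟨z, hz, rfl⟩ := Finset.mem_image.1 hv
        obtain ⟨-, -, -, hsq, q, hq⟩ := hZ z hz
        by_cases hlz : l ∣ z.2
        · exact Or.inl (if_pos hlz)
        · refine Or.inr ⟨?_, isSquare_eval_slope le_rfl hl hlz hsq hq⟩
          have : NeZero l := ⟨hl.ne_zero⟩
          rw [slope, if_neg hlz]
          exact ZMod.val_lt _
    · have h1 := dvd_of_slope_eq hl h
      rw [hDmul z hz z' hz'] at h1
      refine (hlp.dvd_mul.1 h1).resolve_left fun h2 => hlc ?_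
      exact (Int.natCast_dvd_natCast.1 h2).mul_right _
  · rcases Z.eq_empty_or_nonempty with rfl | hne
    · simp; linarith
    obtain ⟨z₀, hz₀, hmax⟩ := Z.exists_max_image Prod.fst hne
    refine card_le_three_mul_of_injOn (by linarith) (fun z => D z z₀) ?_
      fun z hz => hDT z hz z₀ hz₀
    intro z hz z' hz' h
    have h1 := hDmul z hz z₀ hz₀
    have h2 := hDmul z' hz' z₀ hz₀
    have h3 : D z z₀ = D z' z₀ := h
    rw [h3, ← h2] at h1
    have h4 : ((z.1 : ℤ) - z'.1) * z₀.2 = z₀.1 * (z.2 - z'.2) := by linear_combination h1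
    have h5 : (z₀.1 : ℤ) ∣ z.1 - z'.1 := by
      have hcop : IsCoprime (z₀.1 : ℤ) z₀.2 := Nat.isCoprime_iff_coprime.2 (hZ z₀ hz₀).2.2.1
      exact hcop.dvd_of_dvd_mul_right (Dvd.intro _ h4.symm)
    have h6 : (z.1 : ℤ) - z'.1 = 0 := by
      refine Int.eq_zero_of_abs_lt_dvd h5 ?_
      have := hmax z hz
      have := hmax z' hz'
      have := (hZ z hz).1
      have := (hZ z' hz').1
      rw [abs_lt]
      constructor <;> omega
    rw [h6, zero_mul] at h4
    have h7 : (z₀.1 : ℤ) ≠ 0 := by exact_mod_cast (hZ z₀ hz₀).1.ne'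
    have h8 := (mul_eq_zero.1 h4.symm).resolve_left h7
    exact Prod.ext (by omega) (by omega)

lemma separable_of_irreducible {g : ℤ[X]} (hg : Irreducible g) (hdeg : 0 < g.natDegree) :
    (g.map (Int.castRingHom ℚ)).Separable :=
  ((IsPrimitive.Int.irreducible_iff_irreducible_map_cast
    (hg.isPrimitive hdeg.ne')).1 hg).separable

lemma exists_card_le_of_keys {g : ℤ[X]} (hg : Irreducible g) (hdeg : 0 < g.natDegree) :
    ∃ D : ℕ, D ≠ 0 ∧ ∀ B : ℕ, D ∣ B → ∀ S : ℤ, S ≠ 0 → ∀ ε : ℝ, 0 < ε → ∃ T₀ : ℕ, 2 ≤ T₀ ∧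
    ∀ (V L : ℕ) (Z : Finset (ℕ × ℕ)) (m : ℕ × ℕ → ℤ) (ω β : ℕ × ℕ → ℕ),
      (∀ z ∈ Z, 0 < z.1 ∧ 0 < z.2 ∧ z.1.Coprime z.2 ∧
        IsSquare ((β z : ℤ) * (z.2 : ℤ) ^ g.natDegree) ∧
        ∃ q : ℕ, homEval g g.natDegree z.1 z.2 = S * m z * q ^ 2) →
      (∀ z ∈ Z, (m z).natAbs.Coprime B ∧ ω z < (m z).natAbs ∧ m z ∣ g.eval (ω z : ℤ) ∧
        (m z).natAbs * T₀ ≤ V ∧ 0 < β z ∧ β z ≤ L) →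
      (∀ z ∈ Z, ∀ z' ∈ Z, (m z).natAbs = (m z').natAbs → ω z = ω z' → β z = β z' →
        ((β z * (m z).natAbs : ℕ) : ℤ) ∣ z.1 * z'.2 - z'.1 * z.2 ∧
        |(z.1 * z'.2 - z'.1 * z.2 : ℤ)| ≤ V * β z) →
      (Z.card : ℝ) ≤ ε * (V * L) := by
  obtain ⟨D, hD0, C₁, hC₁, hsum₁⟩ := exists_sum_weight_rootPairs_le hg hdeg
  obtain ⟨C₂, hC₂, hsum₂⟩ := exists_sum_weight_Icc_le
  obtain ⟨C, hC0, hC⟩ := exists_card_fiber_le hdeg (separable_of_irreducible hg hdeg)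
  refine ⟨D, hD0, fun B hB S hS ε hε => ?_⟩
  set τ := primeFactorWeight with hτ
  have hτ0 : ∀ c, 0 ≤ τ c := primeFactorWeight_nonneg
  set E : ℝ := 2 * C * (1 + τ S.natAbs) * C₂ with hE
  have hE0 : 0 ≤ E := by have := hτ0 S.natAbs; positivity
  obtain ⟨T₀, hT₀, hT⟩ := exists_sum_div_log_sq_le hC₁ (by positivity : 0 < ε / (E + 1))
  refine ⟨T₀, hT₀, fun V L Z m ω β hZ hZm hZZ => ?_⟩
  set P := rootPairs g B (V / T₀) with hP
  have hPm : ∀ p ∈ P, 0 < p.1 ∧ p.1 * T₀ ≤ V := fun p hp => by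
    have h := (mem_rootPairs.1 hp).1
    exact ⟨h.1, (Nat.le_div_iff_mul_le (by omega)).1 h.2⟩
  set key : ℕ × ℕ → Bool × (ℕ × ℕ) × ℕ := fun z =>
    (decide (0 < m z), ((m z).natAbs, ω z), β z) with hkey
  have hmaps : Set.MapsTo key Z
      ((Finset.univ : Finset Bool) ×ˢ P ×ˢ Finset.Icc 1 L : Finset (Bool × (ℕ × ℕ) × ℕ)) := by
    intro z hz
    obtain ⟨h1, h2, h3, h4, h5, h6⟩ := hZm z hz
    simp only [hkey, Finset.mem_coe, Finset.mem_product, Finset.mem_univ, true_and,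
      Finset.mem_Icc, hP, mem_rootPairs]
    refine ⟨⟨⟨by omega, (Nat.le_div_iff_mul_le (by omega)).2 h4⟩, h2, h1, ?_⟩, h5, h6⟩
    exact Int.natAbs_dvd.2 h3
  have hfib : ∀ k ∈ (Finset.univ : Finset Bool) ×ˢ P ×ˢ Finset.Icc 1 L,
      ((Z.filter fun z => key z = k).card : ℝ) ≤ C * (1 + τ S.natAbs) * (1 + τ k.2.2) *
        ((V / k.2.1.1 : ℝ) * (1 + τ k.2.1.1) / Real.log (V / k.2.1.1) ^ 2) := by
    rintro ⟨σ, ⟨m₀, ω₀⟩, β₀⟩ hk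
    obtain ⟨-, hk2⟩ := Finset.mem_product.1 hk
    obtain ⟨hk2, hk3⟩ := Finset.mem_product.1 hk2
    obtain ⟨hm₀, hm₀V⟩ := hPm _ hk2
    have hβ₀ : 0 < β₀ := (Finset.mem_Icc.1 hk3).1
    simp only at hm₀ hm₀V ⊢
    have hm₀' : (0 : ℝ) < m₀ := by exact_mod_cast hm₀
    have hkz : ∀ z ∈ Z.filter (fun z => key z = (σ, (m₀, ω₀), β₀)), z ∈ Z ∧
        decide (0 < m z) = σ ∧ (m z).natAbs = m₀ ∧ ω z = ω₀ ∧ β z = β₀ := fun z hz => by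
      obtain ⟨h1, h2⟩ := Finset.mem_filter.1 hz
      simp only [hkey, Prod.mk.injEq] at h2
      exact ⟨h1, h2.1, h2.2.1.1, h2.2.1.2, h2.2.2⟩
    have hS' : (if σ then S else -S) ≠ 0 := by split_ifs <;> simpa
    have h1 := hC (Z.filter fun z => key z = (σ, (m₀, ω₀), β₀)) (if σ then S else -S) m₀ β₀
      (V / m₀) ?_ hS' hm₀.ne' hβ₀.ne' ?_ ?_
    · have h2 : τ (β₀ * m₀ * (if σ then S else -S).natAbs) ≤ τ β₀ + τ m₀ + τ S.natAbs := by
        have h3 : (if σ then S else -S).natAbs = S.natAbs := by split_ifs <;> simp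
        rw [h3]
        have h4 := primeFactorWeight_mul_le (mul_ne_zero hβ₀.ne' hm₀.ne')
          (Int.natAbs_ne_zero.2 hS)
        have h5 := primeFactorWeight_mul_le hβ₀.ne' hm₀.ne'
        linarith
      have h3 : 1 + τ (β₀ * m₀ * (if σ then S else -S).natAbs) ≤
          (1 + τ S.natAbs) * (1 + τ β₀) * (1 + τ m₀) := by
        have ha := hτ0 β₀
        have hb := hτ0 m₀
        have hc := hτ0 S.natAbs
        have := mul_nonneg ha hb
        have := mul_nonneg ha hc
        have := mul_nonneg hb hc
        have := mul_nonneg (mul_nonneg ha hb) hc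
        nlinarith
      calc _ ≤ _ := h1
        _ ≤ C * ((V / m₀ : ℝ) * ((1 + τ S.natAbs) * (1 + τ β₀) * (1 + τ m₀)) /
            Real.log (V / m₀) ^ 2) := by gcongr
        _ = _ := by ring
    · rw [le_div_iff₀ hm₀']
      have : 2 * m₀ ≤ V := by nlinarith
      exact_mod_cast this
    · intro z hz
      obtain ⟨hz, hσ, hm, -, hβ⟩ := hkz z hz
      obtain ⟨h1, h2, h3, h4, q, hq⟩ := hZ z hz
      refine ⟨h1, h2, h3, by rwa [← hβ], q, ?_⟩
      rw [hq]
      congr 1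
      rcases le_or_gt (m z) 0 with h | h
      · have h5 : σ = false := by rw [← hσ]; simpa using h
        have h6 : m z = -m₀ := by omega
        rw [h5, h6]; simp
      · have h5 : σ = true := by rw [← hσ]; simpa using h
        have h6 : m z = m₀ := by omega
        rw [h5, h6]; simp
    · intro z hz z' hz'
      obtain ⟨hz, -, hm, hω, hβ⟩ := hkz z hz
      obtain ⟨hz', -, hm', hω', hβ'⟩ := hkz z' hz'
      obtain ⟨h1, h2⟩ := hZZ z hz z' hz' (hm.trans hm'.symm) (hω.trans hω'.symm)
        (hβ.trans hβ'.symm)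
      rw [hβ, hm] at h1
      refine ⟨h1, ?_⟩
      have h3 : (V / m₀ : ℝ) * ((β₀ * m₀ : ℕ) : ℝ) = V * β₀ := by push_cast; field_simp
      rw [h3]
      rw [hβ] at h2
      exact_mod_cast h2
  have hsumT := hT P Prod.fst (fun p => 1 + τ p.1) V (fun p hp => (hPm p hp).1)
    (fun p _ => by have := hτ0 p.1; linarith) (fun p hp => (hPm p hp).2) fun X => ?_
  · have hterm : ∀ p ∈ P, 0 ≤ (V / p.1 : ℝ) * (1 + τ p.1) / Real.log (V / p.1) ^ 2 := fun p _ => by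
      have := hτ0 p.1
      positivity
    calc (Z.card : ℝ) = ∑ k ∈ (Finset.univ : Finset Bool) ×ˢ P ×ˢ Finset.Icc 1 L,
          ((Z.filter fun z => key z = k).card : ℝ) := by
          rw [Finset.card_eq_sum_card_fiberwise hmaps]; push_cast; rfl
      _ ≤ ∑ k ∈ (Finset.univ : Finset Bool) ×ˢ P ×ˢ Finset.Icc 1 L,
          C * (1 + τ S.natAbs) * (1 + τ k.2.2) *
          ((V / k.2.1.1 : ℝ) * (1 + τ k.2.1.1) / Real.log (V / k.2.1.1) ^ 2) :=
          Finset.sum_le_sum hfib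
      _ = 2 * (C * (1 + τ S.natAbs)) * ((∑ p ∈ P,
          (V / p.1 : ℝ) * (1 + τ p.1) / Real.log (V / p.1) ^ 2) *
          ∑ b ∈ Finset.Icc 1 L, (1 + τ b)) := by
          rw [Finset.sum_product]
          dsimp only
          rw [Finset.sum_const, Finset.card_univ, Fintype.card_bool,
            Finset.sum_product, Finset.sum_mul_sum, nsmul_eq_mul, Nat.cast_ofNat,
            mul_assoc (2 : ℝ)]
          congr 1
          rw [Finset.mul_sum]
          refine Finset.sum_congr rfl fun p _ => ?_
          rw [Finset.mul_sum]
          exact Finset.sum_congr rfl fun b _ => by ring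
      _ ≤ 2 * (C * (1 + τ S.natAbs)) * ((ε / (E + 1) * V) * (C₂ * L)) := by
          have h1 := hτ0 S.natAbs
          have h2 := Finset.sum_nonneg hterm
          have h3 : 0 ≤ ∑ b ∈ Finset.Icc 1 L, (1 + τ b) :=
            Finset.sum_nonneg fun b _ => by have := hτ0 b; linarith
          gcongr
          exact hsum₂ L
      _ = E / (E + 1) * (ε * (V * L)) := by rw [hE]; ring
      _ ≤ 1 * (ε * (V * L)) := by
          gcongr
          rw [div_le_one (by linarith)]
          linarith
      _ = _ := one_mul _
  · refine le_trans (Finset.sum_le_sum_of_subset_of_nonneg ?_ ?_) (hsum₁ B hB X)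
    · intro p hp
      obtain ⟨hp, hpX⟩ := Finset.mem_filter.1 hp
      have h := mem_rootPairs.1 hp
      exact mem_rootPairs.2 ⟨⟨h.1.1, hpX⟩, h.2⟩
    · intro p _ _
      have := hτ0 p.1
      linarith

lemma exists_lt_dvd_sub_mul {m : ℕ} (hm : m ≠ 0) {b : ℕ} (hb : b.Coprime m) (a : ℤ) :
    ∃ w : ℕ, w < m ∧ (m : ℤ) ∣ a - b * w := by
  have : NeZero m := ⟨hm⟩
  refine ⟨((a : ZMod m) * (b : ZMod m)⁻¹).val, ZMod.val_lt _, ?_⟩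
  rw [← ZMod.intCast_zmod_eq_zero_iff_dvd]
  push_cast
  rw [ZMod.natCast_zmod_val, mul_left_comm, ZMod.coe_mul_inv_eq_one b hb, mul_one, sub_self]

lemma dvd_eval_of_dvd_homEval {f : ℤ[X]} {n : ℕ} (hn : f.natDegree ≤ n) {m a b w : ℤ}
    (hb : IsCoprime m b) (hw : m ∣ a - b * w) (h : m ∣ homEval f n a b) : m ∣ f.eval w := by
  have h1 := homEval_modEq f n (Int.modEq_iff_dvd.2 hw).symm (Int.ModEq.refl b)
  have h2 := intCast_homEval (A := ℤ) hn (a := b * w) (b := b) (t := w) (by simp)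
  rw [coe_aeval_eq_eval] at h2
  simp only [Int.cast_id] at h2
  rw [h2] at h1
  exact hb.pow_right.dvd_of_dvd_mul_left (h1.dvd_iff.1 h)

/-- A binary form of degree at most `6` is rarely divisible by the square of an integer much
larger than `W ^ 2` on the coprime pairs in `[1, W] ^ 2`. -/
lemma exists_card_large_square_le {g : ℤ[X]} (hg : Irreducible g) (hdeg : 0 < g.natDegree)
    (hdeg6 : g.natDegree ≤ 6) : ∃ B : ℕ, B ≠ 0 ∧ ∀ S : ℤ, S ≠ 0 → ∀ ε : ℝ, 0 < ε → ∃ K : ℕ,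
    ∀ (W : ℕ) (Z : Finset (ℕ × ℕ)),
      (∀ z ∈ Z, 0 < z.1 ∧ 0 < z.2 ∧ z.1 ≤ W ∧ z.2 ≤ W ∧ z.1.Coprime z.2 ∧
        ∃ (m : ℤ) (q : ℕ), m ≠ 0 ∧ m.natAbs.Coprime B ∧
          homEval g g.natDegree z.1 z.2 = S * m * q ^ 2 ∧ K * W ^ 2 < q) →
      (Z.card : ℝ) ≤ ε * W ^ 2 := by
  obtain ⟨D, hD0, hD⟩ := exists_card_le_of_keys hg hdeg
  have hlead : g.leadingCoeff ≠ 0 := leadingCoeff_ne_zero.2 hg.ne_zero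
  refine ⟨D * g.leadingCoeff.natAbs, mul_ne_zero hD0 (Int.natAbs_ne_zero.2 hlead),
    fun S hS ε hε => ?_⟩
  obtain ⟨T₀, hT₀, hT⟩ := hD _ (Dvd.intro _ rfl) S hS ε hε
  set n := g.natDegree with hn
  set A := (∑ i ∈ Finset.range (n + 1), |g.coeff i|).toNat with hA
  have hA' : (A : ℤ) = ∑ i ∈ Finset.range (n + 1), |g.coeff i| :=
    Int.toNat_of_nonneg (Finset.sum_nonneg fun _ _ => abs_nonneg _)
  refine ⟨A * T₀, fun W Z hZ => ?_⟩
  rcases Z.eq_empty_or_nonempty with rfl | ⟨z₁, hz₁⟩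
  · simp; positivity
  have hW : 0 < W := (hZ z₁ hz₁).1.trans_le (hZ z₁ hz₁).2.2.1
  choose! m q hm0 hmB hmq hq using fun z hz => (hZ z hz).2.2.2.2.2
  have hsize : ∀ z ∈ Z, (m z).natAbs * T₀ * W ^ 4 < W ^ n := by
    intro z hz
    obtain ⟨-, -, h1, h2, -⟩ := hZ z hz
    have h3 := abs_homEval_le g n (a := z.1) (b := z.2) (W := W)
      (by rw [Nat.abs_cast]; exact_mod_cast h1) (by rw [Nat.abs_cast]; exact_mod_cast h2)
    rw [← hA', hmq z hz, abs_mul, abs_mul, abs_pow, Nat.abs_cast] at h3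
    have h4 : S.natAbs * (m z).natAbs * q z ^ 2 ≤ A * W ^ n := by
      zify; exact h3
    have h5 := hq z hz
    have h6 : 0 < S.natAbs := Int.natAbs_pos.2 hS
    have h7 : 0 < (m z).natAbs := Int.natAbs_pos.2 (hm0 z hz)
    have h8 : (A * T₀ * W ^ 2) ^ 2 < q z ^ 2 := Nat.pow_lt_pow_left h5 (by norm_num)
    have h9 : (m z).natAbs * (A * T₀ * W ^ 2) ^ 2 < A * W ^ n := by
      calc _ < (m z).natAbs * q z ^ 2 := by gcongr
        _ ≤ S.natAbs * (m z).natAbs * q z ^ 2 := by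
            rw [mul_assoc]; exact Nat.le_mul_of_pos_left _ h6
        _ ≤ _ := h4
    have h10 : A * ((m z).natAbs * T₀ * W ^ 4) < A * W ^ n := by
      refine lt_of_le_of_lt ?_ h9
      have hA1 : A ≤ A ^ 2 := Nat.le_self_pow (by norm_num) A
      have hT1 : T₀ ≤ T₀ ^ 2 := Nat.le_self_pow (by norm_num) T₀
      calc A * ((m z).natAbs * T₀ * W ^ 4) ≤ A ^ 2 * ((m z).natAbs * T₀ ^ 2 * W ^ 4) := by gcongr
        _ = _ := by ring
    exact lt_of_mul_lt_mul_left h10 (Nat.zero_le _)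
  have hn5 : 5 ≤ n := by
    by_contra! h
    have h1 := hsize z₁ hz₁
    have h2 : W ^ n ≤ W ^ 4 := Nat.pow_le_pow_right hW (by omega)
    have h3 : 0 < (m z₁).natAbs * T₀ := Nat.mul_pos (Int.natAbs_pos.2 (hm0 z₁ hz₁)) (by omega)
    nlinarith [Nat.le_mul_of_pos_left (W ^ 4) h3]
  have hsize' : ∀ z ∈ Z, (m z).natAbs * T₀ ≤ W ^ (n - 4) := fun z hz => by
    have h1 := hsize z hz
    rw [show n = n - 4 + 4 by omega, pow_add] at h1
    exact (lt_of_mul_lt_mul_right h1 (Nat.zero_le _)).le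
  have hcop : ∀ z ∈ Z, z.2.Coprime (m z).natAbs := by
    intro z hz
    refine Nat.coprime_of_dvd fun l hl hlb hlm => ?_
    have hlp : Prime (l : ℤ) := Nat.prime_iff_prime_int.1 hl
    have h1 : (l : ℤ) ∣ homEval g n z.1 z.2 := by
      rw [hmq z hz]
      exact ((Int.natCast_dvd.2 hlm).mul_left _).mul_right _
    rcases hlp.dvd_mul.1 (dvd_pow_of_dvd_homEval (Int.natCast_dvd_natCast.2 hlb) h1) with h2 | h2
    · exact Nat.not_coprime_of_dvd_of_dvd hl.one_lt hlm
        ((Int.natCast_dvd.1 h2).mul_left D) (hmB z hz)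
    · exact Nat.not_coprime_of_dvd_of_dvd hl.one_lt
        (Int.natCast_dvd_natCast.1 (hlp.dvd_of_dvd_pow h2)) hlb (hZ z hz).2.2.2.2.1
  choose! ω hω hωm using fun z hz => exists_lt_dvd_sub_mul
    (Int.natAbs_ne_zero.2 (hm0 z hz)) (hcop z hz) (z.1 : ℤ)
  have hωg : ∀ z ∈ Z, m z ∣ g.eval (ω z : ℤ) := fun z hz => by
    refine dvd_eval_of_dvd_homEval (a := z.1) (b := z.2) le_rfl ?_ (Int.natAbs_dvd.1 (hωm z hz)) ?_
    · exact Int.isCoprime_iff_gcd_eq_one.2 (hcop z hz).symm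
    · rw [hmq z hz]
      exact (dvd_mul_left _ _).mul_right _
  set β : ℕ × ℕ → ℕ := fun z => if n = 6 then 1 else z.2 with hβ
  have hVL : W ^ (n - 4) * W ^ (6 - n) = W ^ 2 := by
    rw [← pow_add]; congr 1; omega
  have key := hT (W ^ (n - 4)) (W ^ (6 - n)) Z m ω β ?_ ?_ ?_
  · refine key.trans_eq ?_
    rw [← Nat.cast_mul, hVL]
    push_cast
    rfl
  · intro z hz
    obtain ⟨h1, h2, -, -, h3, -⟩ := hZ z hz
    refine ⟨h1, h2, h3, ?_, q z, hmq z hz⟩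
    simp only [hβ]
    refine ⟨(z.2 : ℤ) ^ 3, ?_⟩
    split_ifs with h
    · rw [h]; push_cast; ring
    · rw [show n = 5 by omega]; ring
  · intro z hz
    obtain ⟨h1, h2, -, h3, -⟩ := hZ z hz
    refine ⟨hmB z hz, hω z hz, hωg z hz, hsize' z hz, ?_⟩
    simp only [hβ]
    split_ifs with h
    · simp [h]
    · rw [show 6 - n = 1 by omega, pow_one]
      exact ⟨h2, h3⟩
  · intro z hz z' hz' hmm hωω hββ
    obtain ⟨h1, h2, h3, h4, -⟩ := hZ z hz
    obtain ⟨h1', h2', h3', h4', -⟩ := hZ z' hz'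
    have hd := hωm z hz
    have hd' := hωm z' hz'
    rw [← hmm, ← hωω] at hd'
    have key : ∀ x y X Y : ℕ, x ≤ X → y ≤ Y → |(x : ℤ) - y| ≤ max X Y := by
      intro x y X Y hx hy
      rw [abs_le]
      constructor <;> push_cast <;> omega
    by_cases h : n = 6
    · simp only [hβ, if_pos h, one_mul, Nat.cast_one, mul_one]
      refine ⟨?_, ?_⟩
      · have he : (z.1 * z'.2 - z'.1 * z.2 : ℤ) =
            (z.1 - z.2 * ω z) * z'.2 - (z'.1 - z'.2 * ω z) * z.2 := by ring
        rw [he]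
        exact dvd_sub (hd.mul_right _) (hd'.mul_right _)
      · rw [h]
        have ha : z.1 * z'.2 ≤ W ^ 2 := by rw [sq]; gcongr
        have hb : z'.1 * z.2 ≤ W ^ 2 := by rw [sq]; gcongr
        have := key _ _ _ _ ha hb
        rw [max_self] at this
        exact_mod_cast this
    · simp only [hβ, if_neg h] at hββ ⊢
      rw [← hββ] at hd' ⊢
      have he : (z.1 * z.2 - z'.1 * z.2 : ℤ) = z.2 * (z.1 - z'.1) := by ring
      rw [he]
      refine ⟨?_, ?_⟩
      · rw [Nat.cast_mul]
        refine mul_dvd_mul_left _ ?_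
        have := dvd_sub hd hd'
        rwa [sub_sub_sub_cancel_right] at this
      · rw [abs_mul, Nat.abs_cast, mul_comm, show n - 4 = 1 by omega, pow_one]
        gcongr
        have := key _ _ _ _ h3 h3'
        rwa [max_self] at this

lemma card_le_of_progression {N Q d α : ℕ} (hQ : d.Coprime Q) (s : Finset ℕ)
    (hs : ∀ u ∈ s, u ∈ Finset.Icc 1 N)
    (h : ∀ u ∈ s, ∀ u' ∈ s, (d : ℤ) ∣ (α + Q * u : ℕ) - (α + Q * u' : ℕ)) :
    s.card ≤ N / d + 1 := by
  rw [← Finset.card_range (N / d + 1)]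
  refine Finset.card_le_card_of_injOn (fun u => u / d) (fun u hu => ?_) fun u hu u' hu' he => ?_
  · exact Finset.mem_coe.2 (Finset.mem_range.2
      (Nat.lt_succ_of_le (Nat.div_le_div_right (Finset.mem_Icc.1 (hs u hu)).2)))
  · have h1 := h u hu u' hu'
    have h2 : ((α + Q * u : ℕ) : ℤ) - (α + Q * u' : ℕ) = Q * (u - u') := by push_cast; ring
    rw [h2] at h1
    have h3 : (d : ℤ) ∣ u - u' := (Nat.isCoprime_iff_coprime.2 hQ).dvd_of_dvd_mul_left h1
    have h4 : u' % d = u % d := (Nat.modEq_iff_dvd.2 h3)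
    have h5 : u / d = u' / d := he
    rw [← Nat.div_add_mod u d, ← Nat.div_add_mod u' d, h4, h5]

lemma sum_Ioc_inv_sq_le_inv {R : ℕ} (hR : R ≠ 0) (W : ℕ) :
    ∑ r ∈ Finset.Ioc R W, ((r : ℝ) ^ 2)⁻¹ ≤ (R : ℝ)⁻¹ := by
  rcases le_or_gt R W with h | h
  · refine (sum_Ioc_inv_sq_le_sub hR h).trans ?_
    have : (0 : ℝ) ≤ (W : ℝ)⁻¹ := by positivity
    linarith
  · rw [Finset.Ioc_eq_empty (by omega)]
    simp

lemma slope_lt_and_dvd {q : ℕ} (hq : q.Prime) {z : ℕ × ℕ} (hz : ¬ q ∣ z.2) :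
    slope q z < q ∧ (q : ℤ) ∣ z.1 - z.2 * slope q z := by
  have : Fact q.Prime := ⟨hq⟩
  have hz' : (z.2 : ZMod q) ≠ 0 := by rwa [Ne, ZMod.natCast_eq_zero_iff]
  rw [slope, if_neg hz]
  refine ⟨ZMod.val_lt _, ?_⟩
  rw [← ZMod.intCast_zmod_eq_zero_iff_dvd]
  push_cast
  rw [ZMod.natCast_zmod_val]
  field_simp
  ring

lemma slope_mem_rootsMod {f : ℤ[X]} {n : ℕ} (hn : f.natDegree ≤ n) {q : ℕ} (hq : q.Prime)
    {z : ℕ × ℕ} (hz : ¬ q ∣ z.2) (h : (q : ℤ) ∣ homEval f n z.1 z.2) :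
    slope q z ∈ rootsMod f q := by
  obtain ⟨h1, h2⟩ := slope_lt_and_dvd hq hz
  refine Finset.mem_filter.2 ⟨Finset.mem_range.2 h1, ?_⟩
  refine dvd_eval_of_dvd_homEval hn ?_ h2 h
  exact Nat.isCoprime_iff_coprime.2 ((Nat.Prime.coprime_iff_not_dvd hq).2 hz)

lemma sq_dvd_of_slope_eq {f u v : ℤ[X]} {r : ℤ} (hr : u * f + v * derivative f = C r) {n : ℕ}
    (hn : f.natDegree ≤ n) {q : ℕ} (hq : q.Prime) (hqr : ¬ (q : ℤ) ∣ r) {z z' : ℕ × ℕ}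
    (hz : ¬ q ∣ z.2) (hz' : ¬ q ∣ z'.2) (h : (q : ℤ) ^ 2 ∣ homEval f n z.1 z.2)
    (h' : (q : ℤ) ^ 2 ∣ homEval f n z'.1 z'.2) (hs : slope q z = slope q z') :
    (q : ℤ) ^ 2 ∣ z.1 * z'.2 - z'.1 * z.2 := by
  have hqp : Prime (q : ℤ) := Nat.prime_iff_prime_int.1 hq
  have hc : z.2.Coprime (q ^ 2) := ((Nat.Prime.coprime_iff_not_dvd hq).2 hz).symm.pow_right 2
  have hc' : z'.2.Coprime (q ^ 2) := ((Nat.Prime.coprime_iff_not_dvd hq).2 hz').symm.pow_right 2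
  have hq2 : q ^ 2 ≠ 0 := pow_ne_zero _ hq.ne_zero
  obtain ⟨w, -, hw⟩ := exists_lt_dvd_sub_mul hq2 hc z.1
  obtain ⟨w', -, hw'⟩ := exists_lt_dvd_sub_mul hq2 hc' z'.1
  push_cast at hw hw'
  have hI : IsCoprime ((q : ℤ) ^ 2) z.2 := by
    have := Nat.isCoprime_iff_coprime.2 hc.symm
    exact_mod_cast this
  have hI' : IsCoprime ((q : ℤ) ^ 2) z'.2 := by
    have := Nat.isCoprime_iff_coprime.2 hc'.symm
    exact_mod_cast this
  have hfw := dvd_eval_of_dvd_homEval hn hI hw h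
  have hfw' := dvd_eval_of_dvd_homEval hn hI' hw' h'
  have hqq : (q : ℤ) ∣ (q : ℤ) ^ 2 := dvd_pow_self _ two_ne_zero
  have h1 := dvd_of_slope_eq hq hs
  have h2 : (q : ℤ) ∣ z.2 * z'.2 * (w' - w) := by
    have he : (z.2 * z'.2 * (w' - w) : ℤ) = (z.1 - z.2 * w) * z'.2 - (z'.1 - z'.2 * w') * z.2 -
      (z.1 * z'.2 - z'.1 * z.2) := by ring
    rw [he]
    exact dvd_sub (dvd_sub ((hqq.trans hw).mul_right _) ((hqq.trans hw').mul_right _)) h1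
  have h3 : (q : ℤ) ∣ w' - w := by
    refine (hqp.dvd_mul.1 h2).resolve_left fun h4 => ?_
    rcases hqp.dvd_mul.1 h4 with h5 | h5
    · exact hz (Int.natCast_dvd_natCast.1 h5)
    · exact hz' (Int.natCast_dvd_natCast.1 h5)
  have h4 : (q : ℤ) * q ∣ w' - w := by
    rw [sq] at hfw hfw'
    exact mul_dvd_sub_of_simple_root hqp hqp.ne_zero hfw hfw'
      (derivative_eval_ne_of_bezout hr hqr ((dvd_mul_right _ _).trans hfw)) h3 h3
  rw [← sq] at h4
  have he : (z.1 * z'.2 - z'.1 * z.2 : ℤ) = (z.1 - z.2 * w) * z'.2 - (z'.1 - z'.2 * w') * z.2 -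
      z.2 * z'.2 * (w' - w) := by ring
  rw [he]
  exact dvd_sub (dvd_sub (hw.mul_right _) (hw'.mul_right _)) (h4.mul_left _)

lemma card_le_sum_card_filter {ι κ : Type} [DecidableEq ι] {Z : Finset ι} {I : Finset κ}
    {P : κ → ι → Prop} [∀ k, DecidablePred (P k)]
    (h : ∀ z ∈ Z, ∃ k ∈ I, P k z) : Z.card ≤ ∑ k ∈ I, (Z.filter (P k)).card := by
  refine le_trans (Finset.card_le_card fun z hz => ?_) Finset.card_biUnion_le
  obtain ⟨k, hk, hkz⟩ := h z hz
  exact Finset.mem_biUnion.2 ⟨k, hk, Finset.mem_filter.2 ⟨hz, hkz⟩⟩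

/-- The square box of side `N`. -/
def box (N : ℕ) : Finset (ℕ × ℕ) := Finset.Icc 1 N ×ˢ Finset.Icc 1 N

lemma mem_box {N : ℕ} {p : ℕ × ℕ} : p ∈ box N ↔ (1 ≤ p.1 ∧ p.1 ≤ N) ∧ 1 ≤ p.2 ∧ p.2 ≤ N := by
  simp [box]

/-- The point of the lattice coset `(α, β) + Q ℤ²` with coordinates `p`. -/
def cosetPoint (α β Q : ℕ) (p : ℕ × ℕ) : ℕ × ℕ := (α + Q * p.1, β + Q * p.2)

lemma cosetPoint_mem {α β Q N : ℕ} (hQ : 0 < Q) (hα : α ≤ Q) (hβ : β ≤ Q) {p : ℕ × ℕ}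
    (hp : p ∈ box N) : (0 < (cosetPoint α β Q p).1 ∧ (cosetPoint α β Q p).1 ≤ Q * (N + 1)) ∧
      0 < (cosetPoint α β Q p).2 ∧ (cosetPoint α β Q p).2 ≤ Q * (N + 1) := by
  obtain ⟨⟨h1, h2⟩, h3, h4⟩ := mem_box.1 hp
  simp only [cosetPoint]
  refine ⟨⟨?_, ?_⟩, ?_, ?_⟩ <;> nlinarith

lemma cosetPoint_injective {α β Q : ℕ} (hQ : 0 < Q) : Function.Injective (cosetPoint α β Q) := by
  rintro ⟨u, v⟩ ⟨u', v'⟩ h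
  simp only [cosetPoint, Prod.mk.injEq, add_right_inj, mul_eq_mul_left_iff] at h ⊢
  omega

lemma card_not_coprime_le {α β Q R N : ℕ} (hQ : 0 < Q) (hα : α ≤ Q) (hβ : β ≤ Q) (hR : R ≠ 0)
    {Z : Finset (ℕ × ℕ)} (hZ : Z ⊆ box N)
    (h : ∀ p ∈ Z, ∃ l : ℕ, l.Prime ∧ R < l ∧ ¬ l ∣ Q ∧ l ∣ (cosetPoint α β Q p).1 ∧
      l ∣ (cosetPoint α β Q p).2) :
    (Z.card : ℝ) ≤ 2 * N ^ 2 / R + 2 * (Q * (N + 1)) := by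
  classical
  have h1 : Z.card ≤ ∑ l ∈ Finset.Ioc R (Q * (N + 1)), (Z.filter fun p => l.Prime ∧ ¬ l ∣ Q ∧
      l ∣ (cosetPoint α β Q p).1 ∧ l ∣ (cosetPoint α β Q p).2).card := by
    refine card_le_sum_card_filter fun p hp => ?_
    obtain ⟨l, hl, hRl, hlQ, ha, hb⟩ := h p hp
    have hp' := cosetPoint_mem hQ hα hβ (hZ hp)
    exact ⟨l, Finset.mem_Ioc.2 ⟨hRl, (Nat.le_of_dvd hp'.1.1 ha).trans hp'.1.2⟩, hl, hlQ, ha, hb⟩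
  have h2 : ∀ l ∈ Finset.Ioc R (Q * (N + 1)), ((Z.filter fun p => l.Prime ∧ ¬ l ∣ Q ∧
      l ∣ (cosetPoint α β Q p).1 ∧ l ∣ (cosetPoint α β Q p).2).card : ℝ) ≤
        2 * N ^ 2 * ((l : ℝ) ^ 2)⁻¹ + 2 := by
    intro l hl
    by_cases hlQ : l.Prime ∧ ¬ l ∣ Q
    · have hc : l.Coprime Q := (Nat.Prime.coprime_iff_not_dvd hlQ.1).2 hlQ.2
      have hline : ∀ γ : ℕ, ((Finset.Icc 1 N).filter fun u => l ∣ γ + Q * u).card ≤ N / l + 1 := by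
        intro γ
        refine card_le_of_progression (α := γ) hc _ (fun u hu => (Finset.mem_filter.1 hu).1) ?_
        intro u hu u' hu'
        exact dvd_sub (Int.natCast_dvd_natCast.2 (Finset.mem_filter.1 hu).2)
          (Int.natCast_dvd_natCast.2 (Finset.mem_filter.1 hu').2)
      have h3 : (Z.filter fun p => l.Prime ∧ ¬ l ∣ Q ∧
          l ∣ (cosetPoint α β Q p).1 ∧ l ∣ (cosetPoint α β Q p).2).card ≤
          (N / l + 1) * (N / l + 1) := by
        refine le_trans (Finset.card_le_card (t := ((Finset.Icc 1 N).filter fun u => l ∣ α + Q * u)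
          ×ˢ ((Finset.Icc 1 N).filter fun u => l ∣ β + Q * u)) fun p hp => ?_) ?_
        · obtain ⟨hp, -, -, ha, hb⟩ := Finset.mem_filter.1 hp
          obtain ⟨h3, h4⟩ := Finset.mem_product.1 (hZ hp)
          exact Finset.mem_product.2
            ⟨Finset.mem_filter.2 ⟨h3, ha⟩, Finset.mem_filter.2 ⟨h4, hb⟩⟩
        · rw [Finset.card_product]
          exact Nat.mul_le_mul (hline α) (hline β)
      have h4 : ((N / l : ℕ) : ℝ) ≤ N * (l : ℝ)⁻¹ := by
        rw [← div_eq_mul_inv]; exact Nat.cast_div_le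
      calc _ ≤ (((N / l + 1) * (N / l + 1) : ℕ) : ℝ) := by exact_mod_cast h3
        _ = (((N / l : ℕ) : ℝ) + 1) ^ 2 := by push_cast; ring
        _ ≤ (N * (l : ℝ)⁻¹ + 1) ^ 2 := by gcongr
        _ ≤ _ := by
          rw [← inv_pow]
          nlinarith [sq_nonneg ((N : ℝ) * (l : ℝ)⁻¹ - 1)]
    · rw [Finset.filter_false_of_mem (fun p _ hp => hlQ ⟨hp.1, hp.2.1⟩), Finset.card_empty]
      push_cast
      positivity
  refine (Nat.cast_le.2 h1).trans ?_
  rw [Nat.cast_sum]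
  calc _ ≤ ∑ l ∈ Finset.Ioc R (Q * (N + 1)), (2 * N ^ 2 * ((l : ℝ) ^ 2)⁻¹ + 2) :=
      Finset.sum_le_sum h2
    _ = 2 * N ^ 2 * ∑ l ∈ Finset.Ioc R (Q * (N + 1)), ((l : ℝ) ^ 2)⁻¹ +
        2 * ((Q * (N + 1) - R : ℕ) : ℝ) := by
      rw [Finset.sum_add_distrib, Finset.mul_sum, Finset.sum_const, Nat.card_Ioc, nsmul_eq_mul,
        mul_comm (2 : ℝ) (Nat.cast _)]
    _ ≤ 2 * N ^ 2 * (R : ℝ)⁻¹ + 2 * (Q * (N + 1)) := by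
      gcongr
      · exact sum_Ioc_inv_sq_le_inv hR _
      · exact_mod_cast Nat.sub_le _ _
    _ = _ := by rw [div_eq_mul_inv]

lemma card_sq_dvd_snd_le {α β Q R N : ℕ} (hQ : 0 < Q) (hα : α ≤ Q) (hβ : β ≤ Q) (hR : R ≠ 0)
    {Z : Finset (ℕ × ℕ)} (hZ : Z ⊆ box N)
    (h : ∀ p ∈ Z, ∃ q : ℕ, q.Prime ∧ R < q ∧ ¬ q ∣ Q ∧ q ^ 2 ∣ (cosetPoint α β Q p).2) :
    (Z.card : ℝ) ≤ N ^ 2 / R + N * Nat.sqrt (Q * (N + 1)) := by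
  classical
  have h1 : Z.card ≤ ∑ q ∈ Finset.Ioc R (Nat.sqrt (Q * (N + 1))),
      (Z.filter fun p => q.Prime ∧ ¬ q ∣ Q ∧ q ^ 2 ∣ (cosetPoint α β Q p).2).card := by
    refine card_le_sum_card_filter fun p hp => ?_
    obtain ⟨q, hq, hRq, hqQ, hb⟩ := h p hp
    have hp' := cosetPoint_mem hQ hα hβ (hZ hp)
    refine ⟨q, Finset.mem_Ioc.2 ⟨hRq, Nat.le_sqrt'.2 ?_⟩, hq, hqQ, hb⟩
    exact (Nat.le_of_dvd hp'.2.1 hb).trans hp'.2.2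
  have h2 : ∀ q ∈ Finset.Ioc R (Nat.sqrt (Q * (N + 1))),
      ((Z.filter fun p => q.Prime ∧ ¬ q ∣ Q ∧ q ^ 2 ∣ (cosetPoint α β Q p).2).card : ℝ) ≤
        N ^ 2 * ((q : ℝ) ^ 2)⁻¹ + N := by
    intro q hq
    by_cases hqQ : q.Prime ∧ ¬ q ∣ Q
    · have hc : (q ^ 2).Coprime Q := ((Nat.Prime.coprime_iff_not_dvd hqQ.1).2 hqQ.2).pow_left 2
      have hline : ((Finset.Icc 1 N).filter fun u => q ^ 2 ∣ β + Q * u).card ≤ N / q ^ 2 + 1 := by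
        refine card_le_of_progression (α := β) hc _ (fun u hu => (Finset.mem_filter.1 hu).1) ?_
        intro u hu u' hu'
        exact dvd_sub (Int.natCast_dvd_natCast.2 (Finset.mem_filter.1 hu).2)
          (Int.natCast_dvd_natCast.2 (Finset.mem_filter.1 hu').2)
      have h3 : (Z.filter fun p => q.Prime ∧ ¬ q ∣ Q ∧ q ^ 2 ∣ (cosetPoint α β Q p).2).card ≤
          N * (N / q ^ 2 + 1) := by
        refine le_trans (Finset.card_le_card (t := Finset.Icc 1 N ×ˢ
          ((Finset.Icc 1 N).filter fun u => q ^ 2 ∣ β + Q * u)) fun p hp => ?_) ?_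
        · obtain ⟨hp, -, -, hb⟩ := Finset.mem_filter.1 hp
          obtain ⟨h3, h4⟩ := Finset.mem_product.1 (hZ hp)
          exact Finset.mem_product.2 ⟨h3, Finset.mem_filter.2 ⟨h4, hb⟩⟩
        · rw [Finset.card_product, Nat.card_Icc, Nat.add_sub_cancel]
          exact Nat.mul_le_mul_left _ hline
      have h4 : ((N / q ^ 2 : ℕ) : ℝ) ≤ N * ((q : ℝ) ^ 2)⁻¹ := by
        rw [← div_eq_mul_inv]; exact_mod_cast Nat.cast_div_le (α := ℝ) (m := N) (n := q ^ 2)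
      calc _ ≤ ((N * (N / q ^ 2 + 1) : ℕ) : ℝ) := by exact_mod_cast h3
        _ = N * (((N / q ^ 2 : ℕ) : ℝ) + 1) := by push_cast; ring
        _ ≤ N * (N * ((q : ℝ) ^ 2)⁻¹ + 1) := by gcongr
        _ = _ := by ring
    · rw [Finset.filter_false_of_mem (fun p _ hp => hqQ ⟨hp.1, hp.2.1⟩), Finset.card_empty]
      push_cast
      positivity
  refine (Nat.cast_le.2 h1).trans ?_
  rw [Nat.cast_sum]
  calc _ ≤ ∑ q ∈ Finset.Ioc R (Nat.sqrt (Q * (N + 1))), (N ^ 2 * ((q : ℝ) ^ 2)⁻¹ + N : ℝ) :=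
      Finset.sum_le_sum h2
    _ = N ^ 2 * ∑ q ∈ Finset.Ioc R (Nat.sqrt (Q * (N + 1))), ((q : ℝ) ^ 2)⁻¹ +
        N * ((Nat.sqrt (Q * (N + 1)) - R : ℕ) : ℝ) := by
      rw [Finset.sum_add_distrib, Finset.mul_sum, Finset.sum_const, Nat.card_Ioc, nsmul_eq_mul,
        mul_comm (N : ℝ) (Nat.cast _)]
    _ ≤ N ^ 2 * (R : ℝ)⁻¹ + N * Nat.sqrt (Q * (N + 1)) := by
      gcongr
      · exact sum_Ioc_inv_sq_le_inv hR _
      · exact Nat.sub_le _ _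
    _ = _ := by rw [div_eq_mul_inv]

lemma card_small_sq_dvd_le {f u v : ℤ[X]} {r : ℤ} (hr : u * f + v * derivative f = C r)
    (hr0 : r ≠ 0) (hf : f ≠ 0) {n : ℕ} (hn : f.natDegree ≤ n) {α β Q R N : ℕ} (hR : R ≠ 0)
    (hrR : r.natAbs ≤ R) (hfR : f.leadingCoeff.natAbs ≤ R)
    {Z : Finset (ℕ × ℕ)} (hZ : Z ⊆ box N)
    (h : ∀ p ∈ Z, ∃ q : ℕ, q.Prime ∧ R < q ∧ q ≤ Q * (N + 1) ∧ ¬ q ∣ Q ∧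
      ¬ q ∣ (cosetPoint α β Q p).2 ∧
      (q : ℤ) ^ 2 ∣ homEval f n (cosetPoint α β Q p).1 (cosetPoint α β Q p).2) :
    (Z.card : ℝ) ≤ f.natDegree * (N ^ 2 / R + N * (Q * (N + 1)).primeCounting) := by
  classical
  set P : ℕ → ℕ × ℕ → Prop := fun q p => ¬ q ∣ Q ∧ ¬ q ∣ (cosetPoint α β Q p).2 ∧
      (q : ℤ) ^ 2 ∣ homEval f n (cosetPoint α β Q p).1 (cosetPoint α β Q p).2 with hP
  set I := (Nat.primesLE (Q * (N + 1))).filter fun q => R < q with hI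
  have h1 : Z.card ≤ ∑ q ∈ I, (Z.filter (P q)).card := by
    refine card_le_sum_card_filter fun p hp => ?_
    obtain ⟨q, hq, hRq, hqW, hqQ, hqb, hqH⟩ := h p hp
    exact ⟨q, Finset.mem_filter.2 ⟨Nat.mem_primesLE.2 ⟨hqW, hq⟩, hRq⟩, hqQ, hqb, hqH⟩
  have h2 : ∀ q ∈ I, ((Z.filter (P q)).card : ℝ) ≤
      f.natDegree * (N ^ 2 * ((q : ℝ) ^ 2)⁻¹ + N) := by
    intro q hqI
    obtain ⟨hqI, hRq⟩ := Finset.mem_filter.1 hqI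
    have hq := (Nat.mem_primesLE.1 hqI).2
    have hroots : (rootsMod f q).card ≤ f.natDegree := card_rootsMod_le hq
      (not_dvd_of_natAbs_lt (leadingCoeff_ne_zero.2 hf) (by omega))
    have hqr : ¬ (q : ℤ) ∣ r := not_dvd_of_natAbs_lt hr0 (by omega)
    have h3 : (Z.filter (P q)).card ≤
        (N / q ^ 2 + 1) * (Finset.Icc 1 N ×ˢ rootsMod f q).card := by
      refine Finset.card_le_mul_card_image_of_maps_to
        (f := fun p => (p.2, slope q (cosetPoint α β Q p))) (fun p hp => ?_) _ fun k _ => ?_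
      · obtain ⟨hp, -, hqb, hqH⟩ := Finset.mem_filter.1 hp
        exact Finset.mem_product.2 ⟨(Finset.mem_product.1 (hZ hp)).2,
          slope_mem_rootsMod hn hq hqb ((dvd_pow_self _ two_ne_zero).trans hqH)⟩
      · have hmem : ∀ p ∈ (Z.filter (P q)).filter
            (fun p => (p.2, slope q (cosetPoint α β Q p)) = k),
            p ∈ Z ∧ P q p ∧ p.2 = k.1 ∧ slope q (cosetPoint α β Q p) = k.2 := fun p hp => by
          obtain ⟨hpf, hpk⟩ := Finset.mem_filter.1 hp
          obtain ⟨hpZ, hpP⟩ := Finset.mem_filter.1 hpf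
          exact ⟨hpZ, hpP, congrArg Prod.fst hpk, congrArg Prod.snd hpk⟩
        generalize (Z.filter (P q)).filter
            (fun p => (p.2, slope q (cosetPoint α β Q p)) = k) = Y at hmem ⊢
        rcases Y.eq_empty_or_nonempty with rfl | ⟨p₀, hp₀⟩
        · simp
        have hqQ := (hmem p₀ hp₀).2.1.1
        rw [← Finset.card_image_of_injOn (f := Prod.fst) fun p hp p' hp' he =>
          Prod.ext he ((hmem p hp).2.2.1.trans (hmem p' hp').2.2.1.symm)]
        have hc : (q ^ 2).Coprime Q := ((Nat.Prime.coprime_iff_not_dvd hq).2 hqQ).pow_left 2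
        refine card_le_of_progression (α := α) hc _ (fun x hx => ?_) fun x hx x' hx' => ?_
        · obtain ⟨p, hp, rfl⟩ := Finset.mem_image.1 hx
          exact (Finset.mem_product.1 (hZ (hmem p hp).1)).1
        · obtain ⟨p, hp, rfl⟩ := Finset.mem_image.1 hx
          obtain ⟨p', hp', rfl⟩ := Finset.mem_image.1 hx'
          obtain ⟨-, ⟨-, hb, hH⟩, hk, hs⟩ := hmem p hp
          obtain ⟨-, ⟨-, hb', hH'⟩, hk', hs'⟩ := hmem p' hp'
          have h4 := sq_dvd_of_slope_eq hr hn hq hqr hb hb' hH hH' (hs.trans hs'.symm)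
          have h5 : (cosetPoint α β Q p').2 = (cosetPoint α β Q p).2 := by
            simp only [cosetPoint, hk, hk']
          rw [h5, ← sub_mul] at h4
          have h6 : IsCoprime ((q : ℤ) ^ 2) (cosetPoint α β Q p).2 :=
            (Nat.isCoprime_iff_coprime.2 ((Nat.Prime.coprime_iff_not_dvd hq).2 hb)).pow_left
          rw [Nat.cast_pow]
          exact h6.dvd_of_dvd_mul_right h4
    rw [Finset.card_product, Nat.card_Icc, Nat.add_sub_cancel] at h3
    have h4 : ((N / q ^ 2 : ℕ) : ℝ) ≤ N * ((q : ℝ) ^ 2)⁻¹ := by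
      rw [← div_eq_mul_inv]; exact_mod_cast Nat.cast_div_le (α := ℝ) (m := N) (n := q ^ 2)
    calc _ ≤ (((N / q ^ 2 + 1) * (N * (rootsMod f q).card) : ℕ) : ℝ) := by exact_mod_cast h3
      _ = (((N / q ^ 2 : ℕ) : ℝ) + 1) * (N * (rootsMod f q).card) := by push_cast; ring
      _ ≤ (N * ((q : ℝ) ^ 2)⁻¹ + 1) * (N * f.natDegree) := by gcongr
      _ = _ := by ring
  refine (Nat.cast_le.2 h1).trans ?_
  rw [Nat.cast_sum]
  have hIsub : I ⊆ Finset.Ioc R (Q * (N + 1)) := fun q hq => by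
    obtain ⟨hqI, hRq⟩ := Finset.mem_filter.1 hq
    exact Finset.mem_Ioc.2 ⟨hRq, (Nat.mem_primesLE.1 hqI).1⟩
  have hIcard : I.card ≤ (Q * (N + 1)).primeCounting := by
    rw [← Nat.primesLE_card_eq_primeCounting]
    exact Finset.card_filter_le _ _
  calc _ ≤ ∑ q ∈ I, (f.natDegree * (N ^ 2 * ((q : ℝ) ^ 2)⁻¹ + N) : ℝ) := Finset.sum_le_sum h2
    _ = f.natDegree * (N ^ 2 * ∑ q ∈ I, ((q : ℝ) ^ 2)⁻¹ + N * I.card) := by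
      rw [← Finset.mul_sum, Finset.sum_add_distrib, Finset.mul_sum, Finset.sum_const,
        nsmul_eq_mul, mul_comm (N : ℝ) (Nat.cast _)]
    _ ≤ f.natDegree * (N ^ 2 * (R : ℝ)⁻¹ + N * (Q * (N + 1)).primeCounting) := by
      gcongr
      exact (Finset.sum_le_sum_of_subset_of_nonneg hIsub fun _ _ _ => by positivity).trans
        (sum_Ioc_inv_sq_le_inv hR _)
    _ = _ := by rw [div_eq_mul_inv]

lemma card_medium_sq_dvd_le {f u v : ℤ[X]} {r : ℤ} (hr : u * f + v * derivative f = C r)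
    (hr0 : r ≠ 0) (hf : f ≠ 0) {n : ℕ} (hn : f.natDegree ≤ n) {α β Q R N X : ℕ} (hQ : 0 < Q)
    (hα : α ≤ Q) (hβ : β ≤ Q) (hrR : r.natAbs ≤ R) (hfR : f.leadingCoeff.natAbs ≤ R)
    {Z : Finset (ℕ × ℕ)} (hZ : Z ⊆ box N)
    (hcop : ∀ p ∈ Z, (cosetPoint α β Q p).1.Coprime (cosetPoint α β Q p).2)
    (h : ∀ p ∈ Z, ∃ q : ℕ, q.Prime ∧ R < q ∧ Q * (N + 1) < q ∧ q ≤ X ∧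
      ¬ q ∣ (cosetPoint α β Q p).2 ∧
      (q : ℤ) ^ 2 ∣ homEval f n (cosetPoint α β Q p).1 (cosetPoint α β Q p).2) :
    (Z.card : ℝ) ≤ f.natDegree * X.primeCounting := by
  classical
  set P : ℕ → ℕ × ℕ → Prop := fun q p => ¬ q ∣ (cosetPoint α β Q p).2 ∧
      (q : ℤ) ^ 2 ∣ homEval f n (cosetPoint α β Q p).1 (cosetPoint α β Q p).2 with hP
  set I := (Nat.primesLE X).filter fun q => R < q ∧ Q * (N + 1) < q with hI
  have h1 : Z.card ≤ ∑ q ∈ I, (Z.filter (P q)).card := by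
    refine card_le_sum_card_filter fun p hp => ?_
    obtain ⟨q, hq, hRq, hWq, hqX, hqb, hqH⟩ := h p hp
    exact ⟨q, Finset.mem_filter.2 ⟨Nat.mem_primesLE.2 ⟨hqX, hq⟩, hRq, hWq⟩, hqb, hqH⟩
  have h2 : ∀ q ∈ I, (Z.filter (P q)).card ≤ f.natDegree := by
    intro q hqI
    obtain ⟨hqI, hRq, hWq⟩ := Finset.mem_filter.1 hqI
    have hq := (Nat.mem_primesLE.1 hqI).2
    have hroots : (rootsMod f q).card ≤ f.natDegree := card_rootsMod_le hq
      (not_dvd_of_natAbs_lt (leadingCoeff_ne_zero.2 hf) (by omega))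
    have hqr : ¬ (q : ℤ) ∣ r := not_dvd_of_natAbs_lt hr0 (by omega)
    refine (Finset.card_le_card_of_injOn (fun p => slope q (cosetPoint α β Q p))
      (fun p hp => ?_) fun p hp p' hp' he => ?_).trans hroots
    · obtain ⟨hp, hqb, hqH⟩ := Finset.mem_filter.1 hp
      exact slope_mem_rootsMod hn hq hqb ((dvd_pow_self _ two_ne_zero).trans hqH)
    · obtain ⟨hp, hqb, hqH⟩ := Finset.mem_filter.1 hp
      obtain ⟨hp', hqb', hqH'⟩ := Finset.mem_filter.1 hp'
      have h4 := sq_dvd_of_slope_eq hr hn hq hqr hqb hqb' hqH hqH' he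
      obtain ⟨⟨h5, h6⟩, h7, h8⟩ := cosetPoint_mem hQ hα hβ (hZ hp)
      obtain ⟨⟨h5', h6'⟩, h7', h8'⟩ := cosetPoint_mem hQ hα hβ (hZ hp')
      have h9 := Int.eq_zero_of_abs_lt_dvd h4 (by
        have ha : (cosetPoint α β Q p).1 * (cosetPoint α β Q p').2 < q * q :=
          Nat.mul_lt_mul'' (by omega) (by omega)
        have hb : (cosetPoint α β Q p').1 * (cosetPoint α β Q p).2 < q * q :=
          Nat.mul_lt_mul'' (by omega) (by omega)
        zify at ha hb
        rw [abs_lt]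
        constructor <;> nlinarith)
      have h10 := eq_of_mul_eq_mul_of_coprime (hcop p hp) (hcop p' hp')
        (by exact_mod_cast sub_eq_zero.1 h9)
      exact cosetPoint_injective hQ (Prod.ext h10.1 h10.2)
  have hIcard : I.card ≤ X.primeCounting := by
    rw [← Nat.primesLE_card_eq_primeCounting]
    exact Finset.card_filter_le _ _
  have h3 := h1.trans (Finset.sum_le_card_nsmul _ _ _ h2)
  rw [smul_eq_mul, mul_comm] at h3
  exact_mod_cast h3.trans (Nat.mul_le_mul_left _ hIcard)

lemma exists_irreducible_sq_dvd_homEval {f u v : ℤ[X]} {r : ℤ}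
    (hr : u * f + v * derivative f = C r) (hf : f ≠ 0) {n : ℕ} (hn : f.natDegree ≤ n) {q : ℕ}
    (hq : q.Prime) (hqr : ¬ (q : ℤ) ∣ r) (hqf : ¬ (q : ℤ) ∣ f.leadingCoeff) {a b : ℕ}
    (hb : ¬ q ∣ b) (h : (q : ℤ) ^ 2 ∣ homEval f n a b) :
    ∃ g ∈ UniqueFactorizationMonoid.factors f, 0 < g.natDegree ∧
      (q : ℤ) ^ 2 ∣ homEval g g.natDegree a b := by
  have hqp : Prime (q : ℤ) := Nat.prime_iff_prime_int.1 hq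
  have hbq : b.Coprime (q ^ 2) := (((Nat.Prime.coprime_iff_not_dvd hq).2 hb).pow_left 2).symm
  obtain ⟨w, -, hw⟩ := exists_lt_dvd_sub_mul (pow_ne_zero 2 hq.ne_zero) hbq a
  rw [Nat.cast_pow] at hw
  have hcop : IsCoprime ((q : ℤ) ^ 2) b := by
    exact_mod_cast Nat.isCoprime_iff_coprime.2 hbq.symm
  have hfw : (q : ℤ) ^ 2 ∣ f.eval (w : ℤ) := dvd_eval_of_dvd_homEval hn hcop hw h
  have hqfw : (q : ℤ) ∣ f.eval (w : ℤ) := (dvd_pow_self _ two_ne_zero).trans hfw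
  have h1 : (q : ℤ) ∣ ((UniqueFactorizationMonoid.factors f).map (eval (w : ℤ))).prod := by
    rw [← eval_multiset_prod]
    obtain ⟨c, hc⟩ := (UniqueFactorizationMonoid.factors_prod hf).symm
    rw [← hc, eval_mul]
    exact hqfw.mul_right _
  obtain ⟨_, hy, hqg⟩ := hqp.exists_mem_multiset_dvd h1
  obtain ⟨g, hg, rfl⟩ := Multiset.mem_map.1 hy
  obtain ⟨k, rfl⟩ := UniqueFactorizationMonoid.dvd_of_mem_factors hg
  have hqk : ¬ (q : ℤ) ∣ k.eval (w : ℤ) := fun hh => by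
    refine derivative_eval_ne_of_bezout hr hqr hqfw ?_
    rw [derivative_mul, eval_add, eval_mul, eval_mul]
    exact dvd_add (hh.mul_left _) (hqg.mul_right _)
  have hgw : (q : ℤ) ^ 2 ∣ g.eval (w : ℤ) := by
    rw [eval_mul] at hfw
    exact (((Prime.coprime_iff_not_dvd hqp).2 hqk).pow_left).dvd_of_dvd_mul_right hfw
  refine ⟨g, hg, Nat.pos_of_ne_zero fun h0 => hqf ?_, ?_⟩
  · rw [leadingCoeff_mul]
    rw [eq_C_of_natDegree_eq_zero h0, eval_C] at hqg
    rw [leadingCoeff, h0]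
    exact hqg.mul_right _
  · have h2 : homEval g g.natDegree (b * w) b = b ^ g.natDegree * g.eval (w : ℤ) := by
      have := intCast_homEval (A := ℤ) (le_refl g.natDegree) (a := b * w) (b := b) (t := w)
        (by simp)
      simpa [coe_aeval_eq_eval] using this
    have h3 := homEval_modEq g g.natDegree (Int.modEq_iff_dvd.2 hw)
      (Int.ModEq.refl (n := (q : ℤ) ^ 2) (b : ℤ))
    exact h3.dvd_iff.1 (h2 ▸ hgw.mul_left _)

/-- Values of a product of forms of degree at most `6` are rarely divisible by the square of a
prime much larger than the square of the size of the arguments. -/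
lemma exists_card_large_sq_dvd_le {f u v : ℤ[X]} {r : ℤ} (hr : u * f + v * derivative f = C r)
    (hr0 : r ≠ 0) (hf : f ≠ 0)
    (hfac : ∀ g : ℤ[X], Irreducible g → g ∣ f → 0 < g.natDegree → g.natDegree ≤ 6)
    {n : ℕ} (hn : f.natDegree ≤ n) :
    ∃ B : ℕ, B ≠ 0 ∧ ∀ {R : ℕ}, B ≤ R → 2 ≤ R → r.natAbs ≤ R → f.leadingCoeff.natAbs ≤ R →
      ∀ {a₀ : ℤ}, f.eval a₀ ≠ 0 → ∀ {α β Q : ℕ}, 0 < Q → α ≤ Q → β ≤ Q →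
      f.eval a₀ * R.factorial ∣ Q → (α : ℤ) ≡ a₀ [ZMOD f.eval a₀ * R.factorial] →
      (β : ℤ) ≡ 1 [ZMOD f.eval a₀ * R.factorial] → ∀ ε : ℝ, 0 < ε → ∃ K : ℕ,
      ∀ {N : ℕ} {Z : Finset (ℕ × ℕ)}, Z ⊆ box N →
      (∀ p ∈ Z, (cosetPoint α β Q p).1.Coprime (cosetPoint α β Q p).2) →
      (∀ p ∈ Z, ∃ q : ℕ, q.Prime ∧ R < q ∧ K * (Q * (N + 1)) ^ 2 < q ∧ ¬ q ∣ Q ∧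
        ¬ q ∣ (cosetPoint α β Q p).2 ∧
        (q : ℤ) ^ 2 ∣ homEval f n (cosetPoint α β Q p).1 (cosetPoint α β Q p).2) →
      (Z.card : ℝ) ≤ ε * (Q * (N + 1) : ℕ) ^ 2 := by
  classical
  set I := (UniqueFactorizationMonoid.factors f).toFinset.filter fun g => 0 < g.natDegree with hI
  have hIg : ∀ g : I, Irreducible g.1 ∧ g.1 ∣ f ∧ 0 < g.1.natDegree := fun g => by
    obtain ⟨hg, hpos⟩ := Finset.mem_filter.1 g.2
    have hg := Multiset.mem_toFinset.1 hg
    exact ⟨UniqueFactorizationMonoid.irreducible_of_factor _ hg,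
      UniqueFactorizationMonoid.dvd_of_mem_factors hg, hpos⟩
  choose B hB0 hB using fun g : I => exists_card_large_square_le (hIg g).1 (hIg g).2.2
    (hfac _ (hIg g).1 (hIg g).2.1 (hIg g).2.2)
  refine ⟨∏ g, B g, Finset.prod_ne_zero_iff.2 fun g _ => hB0 g, ?_⟩
  intro R hBR hR2 hrR hfR a₀ ha₀ α β Q hQ hα hβ hdQ hαa hβ1 ε hε
  have hS : ∀ g : I, g.1.eval a₀ ∣ f.eval a₀ := fun g => eval_dvd (hIg g).2.1
  have hS0 : ∀ g : I, g.1.eval a₀ ≠ 0 := fun g h0 => ha₀ (zero_dvd_iff.1 (h0 ▸ hS g))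
  set ε' : ℝ := ε / (I.card + 1) with hε'
  choose K hK using fun g : I => hB g _ (hS0 g) ε' (by positivity)
  refine ⟨∑ g, K g, ?_⟩
  intro N Z hZ hcop h
  set P : I → ℕ × ℕ → Prop := fun g p => ∃ q : ℕ, q.Prime ∧ R < q ∧
    (∑ g, K g) * (Q * (N + 1)) ^ 2 < q ∧ ¬ q ∣ Q ∧
    (q : ℤ) ^ 2 ∣ homEval g.1 g.1.natDegree (cosetPoint α β Q p).1 (cosetPoint α β Q p).2 with hP
  have h1 : Z.card ≤ ∑ g : I, (Z.filter (P g)).card := by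
    refine card_le_sum_card_filter fun p hp => ?_
    obtain ⟨q, hq, hRq, hKq, hqQ, hqb, hqH⟩ := h p hp
    obtain ⟨g, hg, hpos, hgH⟩ := exists_irreducible_sq_dvd_homEval hr hf hn hq
      (not_dvd_of_natAbs_lt hr0 (by omega))
      (not_dvd_of_natAbs_lt (leadingCoeff_ne_zero.2 hf) (by omega)) hqb hqH
    exact ⟨⟨g, Finset.mem_filter.2 ⟨Multiset.mem_toFinset.2 hg, hpos⟩⟩, Finset.mem_univ _,
      q, hq, hRq, hKq, hqQ, hgH⟩
  have h2 : ∀ g : I, ((Z.filter (P g)).card : ℝ) ≤ ε' * (Q * (N + 1) : ℕ) ^ 2 := by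
    intro g
    rw [← Finset.card_image_of_injective _ (cosetPoint_injective (α := α) (β := β) hQ)]
    refine hK g _ _ fun z hz => ?_
    obtain ⟨p, hp, rfl⟩ := Finset.mem_image.1 hz
    obtain ⟨hpZ, q, hq, hRq, hKq, hqQ, hqH⟩ := Finset.mem_filter.1 hp
    obtain ⟨⟨h3, h4⟩, h5, h6⟩ := cosetPoint_mem hQ hα hβ (hZ hpZ)
    refine ⟨h3, h5, h4, h6, hcop p hpZ, ?_⟩
    have hmod : ∀ γ x : ℕ, ∀ c : ℤ, (γ : ℤ) ≡ c [ZMOD f.eval a₀ * R.factorial] →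
        ((γ + Q * x : ℕ) : ℤ) ≡ c [ZMOD g.1.eval a₀ * R.factorial] := fun γ x c hγ => by
      refine Int.ModEq.of_dvd (mul_dvd_mul_right (hS g) _) ?_
      rw [Int.modEq_iff_dvd] at hγ ⊢
      push_cast
      rw [← sub_sub]
      exact dvd_sub hγ (hdQ.mul_right _)
    have h7 := homEval_modEq g.1 g.1.natDegree (hmod α p.1 _ hαa) (hmod β p.2 _ hβ1)
    rw [homEval_one _ le_rfl] at h7
    obtain ⟨t, ht⟩ := Int.modEq_iff_dvd.1 h7.symm
    have h8 : homEval g.1 g.1.natDegree (cosetPoint α β Q p).1 (cosetPoint α β Q p).2 =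
        g.1.eval a₀ * (1 + R.factorial * t) := by
      rw [mul_add, ← mul_assoc, mul_one, ← ht]
      simp only [cosetPoint]
      ring
    rw [h8] at hqH ⊢
    have hqS : IsCoprime ((q : ℤ) ^ 2) (g.1.eval a₀) :=
      ((Prime.coprime_iff_not_dvd (Nat.prime_iff_prime_int.1 hq)).2 fun hd => hqQ <|
        Int.natCast_dvd_natCast.1 (((hd.trans (hS g)).mul_right _).trans hdQ)).pow_left
    obtain ⟨m, hm⟩ := hqS.dvd_of_dvd_mul_left hqH
    have hmR : IsCoprime m (R.factorial : ℤ) := ⟨(q : ℤ) ^ 2, -t, by linear_combination -hm⟩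
    refine ⟨m, q, fun hm0 => ?_, ?_, by rw [hm]; ring, ?_⟩
    · rw [hm0, isCoprime_zero_left, Int.isUnit_iff] at hmR
      have := Nat.self_le_factorial R
      omega
    · have h9 : B g ∣ R.factorial :=
        Nat.dvd_factorial (Nat.pos_of_ne_zero (hB0 g)) <| le_trans
          (Nat.le_of_dvd (Finset.prod_pos fun g _ => Nat.pos_of_ne_zero (hB0 g))
            (Finset.dvd_prod_of_mem B (Finset.mem_univ g))) hBR
      exact (Int.isCoprime_iff_nat_coprime.1 hmR).coprime_dvd_right h9
    · refine lt_of_le_of_lt (Nat.mul_le_mul_right _ ?_) hKq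
      exact Finset.single_le_sum (f := K) (fun _ _ => Nat.zero_le _) (Finset.mem_univ g)
  refine (Nat.cast_le.2 h1).trans ?_
  rw [Nat.cast_sum]
  refine (Finset.sum_le_sum fun g _ => h2 g).trans ?_
  rw [Finset.sum_const, Finset.card_univ, Fintype.card_coe, nsmul_eq_mul, ← mul_assoc]
  gcongr
  rw [hε', mul_div_assoc', div_le_iff₀ (by positivity)]
  nlinarith

open Filter in
lemma eventually_primeCounting_le_mul {ε : ℝ} (hε : 0 < ε) :
    ∀ᶠ x : ℕ in atTop, (x.primeCounting : ℝ) ≤ ε * x := by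
  have h1 := tendsto_natCast_atTop_atTop.eventually
    (Chebyshev.eventually_primeCounting_le one_pos)
  have h2 := tendsto_natCast_atTop_atTop.eventually
    (Real.tendsto_log_atTop.eventually_ge_atTop ((Real.log 4 + 1) / ε))
  filter_upwards [h1, h2] with x hx hlog
  rw [Nat.floor_natCast] at hx
  have h4 : 0 < Real.log 4 + 1 := by have := Real.log_nonneg (x := 4) (by norm_num); linarith
  have hl : 0 < Real.log x := lt_of_lt_of_le (by positivity) hlog
  refine hx.trans ?_
  rw [div_le_iff₀ hl]
  rw [div_le_iff₀ hε] at hlog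
  nlinarith [mul_le_mul_of_nonneg_right hlog (Nat.cast_nonneg (α := ℝ) x)]

open Filter in
lemma eventually_error_le (Q K D : ℕ) (hQ : 0 < Q) :
    ∀ᶠ N : ℕ in atTop, (2 * (Q * (N + 1)) : ℝ) + N * Nat.sqrt (Q * (N + 1)) +
      D * (N * (Q * (N + 1)).primeCounting) +
      D * ((K + 1) * (Q * (N + 1)) ^ 2).primeCounting ≤ (N : ℝ) ^ 2 / 8 := by
  have hW : Tendsto (fun N : ℕ => Q * (N + 1)) atTop atTop :=
    tendsto_atTop_mono (fun N => by simp only [id]; nlinarith) tendsto_id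
  have hX : Tendsto (fun N : ℕ => (K + 1) * (Q * (N + 1)) ^ 2) atTop atTop :=
    tendsto_atTop_mono (fun N => by
      have := Nat.one_le_iff_ne_zero.2 hQ.ne'
      have h1 : N ≤ Q * (N + 1) := by nlinarith
      simp only [id]
      nlinarith [Nat.zero_le (K * (Q * (N + 1)) ^ 2)]) tendsto_id
  set ε₁ : ℝ := 1 / (32 * (D + 1) * (2 * Q)) with hε₁
  set ε₂ : ℝ := 1 / (32 * (D + 1) * ((K + 1) * (2 * Q) ^ 2)) with hε₂
  have h1 := hW.eventually (eventually_primeCounting_le_mul (ε := ε₁) (by positivity))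
  have h2 := hX.eventually (eventually_primeCounting_le_mul (ε := ε₂) (by positivity))
  filter_upwards [h1, h2, eventually_ge_atTop (2 * (32 * 32) * Q + 128 * Q + 1)] with N h1 h2 hN
  have hN1 : (2 * (32 * 32) * Q + 128 * Q + 1 : ℝ) ≤ N := by exact_mod_cast hN
  have hQ1 : (1 : ℝ) ≤ Q := by exact_mod_cast hQ
  have hWN : (Q * (N + 1) : ℝ) ≤ 2 * Q * N := by nlinarith
  have hD : (D : ℝ) / (D + 1) ≤ 1 := (div_le_one (by positivity)).2 (by linarith)
  have e1 : (2 * (Q * (N + 1)) : ℝ) ≤ N ^ 2 / 32 := by nlinarith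
  have e2 : (N : ℝ) * Nat.sqrt (Q * (N + 1)) ≤ N ^ 2 / 32 := by
    have h3 : ((Nat.sqrt (Q * (N + 1)) : ℕ) : ℝ) ^ 2 ≤ (N / 32) ^ 2 := by
      have : ((Nat.sqrt (Q * (N + 1)) ^ 2 : ℕ) : ℝ) ≤ (Q * (N + 1) : ℕ) :=
        Nat.cast_le.2 (Nat.sqrt_le' _)
      push_cast at this
      nlinarith
    have h4 := le_of_sq_le_sq h3 (by positivity)
    nlinarith
  have e3 : (D * (N * (Q * (N + 1)).primeCounting) : ℝ) ≤ N ^ 2 / 32 := by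
    push_cast at h1
    calc _ ≤ (D * (N * (ε₁ * (2 * Q * N))) : ℝ) := by
          gcongr; exact h1.trans (by gcongr)
      _ = D / (D + 1) * (N ^ 2 / 32) := by rw [hε₁]; field_simp
      _ ≤ 1 * (N ^ 2 / 32) := by gcongr
      _ = _ := one_mul _
  have e4 : (D * ((K + 1) * (Q * (N + 1)) ^ 2).primeCounting : ℝ) ≤ N ^ 2 / 32 := by
    push_cast at h2
    calc _ ≤ (D * (ε₂ * ((K + 1) * (2 * Q * N) ^ 2)) : ℝ) := by
          gcongr; exact h2.trans (by gcongr)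
      _ = D / (D + 1) * (N ^ 2 / 32) := by rw [hε₂]; field_simp
      _ ≤ 1 * (N ^ 2 / 32) := by gcongr
      _ = _ := one_mul _
  linarith

lemma homEval_succ_natDegree (f : ℤ[X]) (a b : ℤ) :
    homEval f (f.natDegree + 1) a b = b * homEval f f.natDegree a b := by
  rw [homEval, Finset.sum_range_succ, coeff_eq_zero_of_natDegree_lt (Nat.lt_succ_self _),
    zero_mul, zero_mul, add_zero, homEval, Finset.mul_sum]
  refine Finset.sum_congr rfl fun i hi => ?_
  rw [Nat.sub_add_comm (Nat.lt_succ_iff.1 (Finset.mem_range.1 hi)), pow_succ]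
  ring

lemma homEval_zero_zero (f : ℤ[X]) {n : ℕ} (hn : f.natDegree ≤ n) (hn0 : 0 < n) :
    homEval f n 0 0 = 0 := by
  have := intCast_homEval (A := ℤ) hn (a := 0) (b := 0) (t := 0) (by simp)
  simpa [hn0.ne'] using this

lemma dvd_or_sq_dvd_of_sq_dvd_homEval {f : ℤ[X]} {n : ℕ} (hn : f.natDegree ≤ n)
    (hn1 : n ≤ f.natDegree + 1) {q a b : ℕ} (hq : q.Prime) (hqf : ¬ (q : ℤ) ∣ f.leadingCoeff)
    (hb : q ∣ b) (h : (q : ℤ) ^ 2 ∣ homEval f n a b) : q ∣ a ∨ q ^ 2 ∣ b := by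
  have hqp : Prime (q : ℤ) := Nat.prime_iff_prime_int.1 hq
  have key : (q : ℤ) ∣ homEval f f.natDegree a b → q ∣ a := fun h1 => by
    have h2 := dvd_pow_of_dvd_homEval (Int.natCast_dvd_natCast.2 hb) h1
    exact Int.natCast_dvd_natCast.1 (hqp.dvd_of_dvd_pow ((hqp.dvd_or_dvd h2).resolve_left hqf))
  rcases hn.eq_or_lt with rfl | hlt
  · exact Or.inl (key ((dvd_pow_self _ two_ne_zero).trans h))
  · obtain rfl : n = f.natDegree + 1 := by omega
    rw [homEval_succ_natDegree] at h
    by_cases h1 : (q : ℤ) ∣ homEval f f.natDegree a b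
    · exact Or.inl (key h1)
    · have := (((Prime.coprime_iff_not_dvd hqp).2 h1).pow_left (m := 2)).dvd_of_dvd_mul_right h
      exact Or.inr (by exact_mod_cast this)

lemma coprime_cosetPoint {f : ℤ[X]} {n : ℕ} (hn : f.natDegree ≤ n) (hn0 : 0 < n) {R α β Q : ℕ}
    (hRQ : R.factorial ∣ Q) (hβ : (β : ℤ) ≡ 1 [ZMOD R.factorial])
    (hQH : ∀ q : ℕ, q.Prime → R < q → q ∣ Q → ¬ (q : ℤ) ∣ homEval f n α β) {p : ℕ × ℕ}
    (h : ∀ l : ℕ, l.Prime → R < l → ¬ l ∣ Q → l ∣ (cosetPoint α β Q p).1 →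
      ¬ l ∣ (cosetPoint α β Q p).2) :
    (cosetPoint α β Q p).1.Coprime (cosetPoint α β Q p).2 := by
  refine Nat.coprime_of_dvd fun l hl ha hb => ?_
  by_cases hlQ : l ∣ Q
  · have hlα := (Nat.dvd_add_left (hlQ.mul_right _)).1 ha
    have hlβ := (Nat.dvd_add_left (hlQ.mul_right _)).1 hb
    rcases le_or_gt l R with hlR | hlR
    · have h1 : (β : ℤ) ≡ 1 [ZMOD l] :=
        hβ.of_dvd (Int.natCast_dvd_natCast.2 (Nat.dvd_factorial hl.pos hlR))
      have h2 : (l : ℤ) ∣ 1 := h1.dvd_iff.1 (Int.natCast_dvd_natCast.2 hlβ)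
      exact hl.one_lt.ne' (Nat.dvd_one.1 (by exact_mod_cast h2))
    · refine hQH l hl hlR hlQ (Int.modEq_zero_iff_dvd.1 ?_)
      have h1 := homEval_modEq f n (Int.modEq_zero_iff_dvd.2 (Int.natCast_dvd_natCast.2 hlα))
        (Int.modEq_zero_iff_dvd.2 (Int.natCast_dvd_natCast.2 hlβ))
      rwa [homEval_zero_zero f hn hn0] at h1
  · rcases le_or_gt l R with hlR | hlR
    · exact hlQ ((Nat.dvd_factorial hl.pos hlR).trans hRQ)
    · exact h l hl hlR hlQ ha hb

lemma homEval_cosetPoint_modEq (f : ℤ[X]) (n α β Q : ℕ) (p : ℕ × ℕ) :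
    homEval f n (cosetPoint α β Q p).1 (cosetPoint α β Q p).2 ≡ homEval f n α β [ZMOD Q] := by
  have h : ∀ γ x : ℕ, ((γ + Q * x : ℕ) : ℤ) ≡ γ [ZMOD Q] := fun γ x =>
    Int.modEq_iff_dvd.2 ⟨-x, by push_cast; ring⟩
  exact homEval_modEq f n (h _ _) (h _ _)

open scoped Classical in
/-- On at least half of a suitable lattice coset, the values of the form attached to `f` are not
divisible by the square of any prime larger than `R`. -/
lemma exists_card_sq_free_values {f u v : ℤ[X]} {r : ℤ} (hr : u * f + v * derivative f = C r)
    (hr0 : r ≠ 0) (hf : f ≠ 0)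
    (hfac : ∀ g : ℤ[X], Irreducible g → g ∣ f → 0 < g.natDegree → g.natDegree ≤ 6)
    {n : ℕ} (hn : f.natDegree ≤ n) (hn0 : 0 < n) (hn1 : n ≤ f.natDegree + 1) :
    ∃ R₀ : ℕ, ∀ {R : ℕ}, R₀ ≤ R → ∀ {a₀ : ℤ}, f.eval a₀ ≠ 0 → ∀ {α β Q : ℕ}, 0 < Q → α ≤ Q →
      β ≤ Q → f.eval a₀ * R.factorial ∣ Q → (α : ℤ) ≡ a₀ [ZMOD f.eval a₀ * R.factorial] →
      (β : ℤ) ≡ 1 [ZMOD f.eval a₀ * R.factorial] →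
      (∀ q : ℕ, q.Prime → R < q → q ∣ Q → ¬ (q : ℤ) ∣ homEval f n α β) →
      ∀ᶠ N : ℕ in Filter.atTop, (N : ℝ) ^ 2 / 2 ≤ ((box N).filter fun p => ∀ q : ℕ, q.Prime →
        R < q →
        ¬ (q : ℤ) ^ 2 ∣ homEval f n (cosetPoint α β Q p).1 (cosetPoint α β Q p).2).card := by
  obtain ⟨B, hB0, hB⟩ := exists_card_large_sq_dvd_le hr hr0 hf hfac hn
  refine ⟨B + r.natAbs + f.leadingCoeff.natAbs + 8 * (f.natDegree + 3), ?_⟩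
  intro R hR a₀ ha₀ α β Q hQ hα hβ hdQ hαa hβ1 hQH
  obtain ⟨K, hK⟩ := hB (R := R) (by omega) (by omega) (by omega) (by omega) ha₀ hQ hα hβ hdQ hαa
    hβ1 (1 / (32 * Q ^ 2)) (by positivity)
  have hRQ : R.factorial ∣ Q :=
    Int.natCast_dvd_natCast.1 ((dvd_mul_left _ (f.eval a₀)).trans hdQ)
  have hβR : (β : ℤ) ≡ 1 [ZMOD R.factorial] := hβ1.of_dvd (dvd_mul_left _ _)
  filter_upwards [eventually_error_le Q K f.natDegree hQ, Filter.eventually_ge_atTop 1]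
    with N hN hN1
  let H : ℕ × ℕ → ℤ := fun p => homEval f n (cosetPoint α β Q p).1 (cosetPoint α β Q p).2
  have hHQ : ∀ p, ∀ q : ℕ, q.Prime → R < q → (q : ℤ) ^ 2 ∣ H p → ¬ q ∣ Q :=
    fun p q hq hRq hqH hqQ => hQH q hq hRq hqQ <|
      (((homEval_cosetPoint_modEq f n α β Q p).of_dvd
        (Int.natCast_dvd_natCast.2 hqQ)).dvd_iff).1 ((dvd_pow_self _ two_ne_zero).trans hqH)
  set Z₀ := (box N).filter fun p => ∃ l : ℕ, l.Prime ∧ R < l ∧ ¬ l ∣ Q ∧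
    l ∣ (cosetPoint α β Q p).1 ∧ l ∣ (cosetPoint α β Q p).2 with hZ₀
  set Z₁ := (box N).filter fun p => ∃ q : ℕ, q.Prime ∧ R < q ∧ ¬ q ∣ Q ∧
    q ^ 2 ∣ (cosetPoint α β Q p).2 with hZ₁
  set Z₂ := (box N).filter fun p => ∃ q : ℕ, q.Prime ∧ R < q ∧ q ≤ Q * (N + 1) ∧ ¬ q ∣ Q ∧
      ¬ q ∣ (cosetPoint α β Q p).2 ∧ (q : ℤ) ^ 2 ∣ H p with hZ₂
  set Z₃ := (box N).filter fun p => (cosetPoint α β Q p).1.Coprime (cosetPoint α β Q p).2 ∧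
    ∃ q : ℕ, q.Prime ∧ R < q ∧ Q * (N + 1) < q ∧ q ≤ (K + 1) * (Q * (N + 1)) ^ 2 ∧
      ¬ q ∣ (cosetPoint α β Q p).2 ∧ (q : ℤ) ^ 2 ∣ H p with hZ₃
  set Z₄ := (box N).filter fun p => (cosetPoint α β Q p).1.Coprime (cosetPoint α β Q p).2 ∧
    ∃ q : ℕ, q.Prime ∧ R < q ∧ K * (Q * (N + 1)) ^ 2 < q ∧ ¬ q ∣ Q ∧
        ¬ q ∣ (cosetPoint α β Q p).2 ∧ (q : ℤ) ^ 2 ∣ H p with hZ₄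
  set G := (box N).filter fun p => ∀ q : ℕ, q.Prime → R < q → ¬ (q : ℤ) ^ 2 ∣ H p with hG
  have hcover : box N ⊆ G ∪ (Z₀ ∪ (Z₁ ∪ (Z₂ ∪ (Z₃ ∪ Z₄)))) := by
    intro p hp
    simp only [Finset.mem_union, hG, hZ₀, hZ₁, hZ₂, hZ₃, hZ₄, Finset.mem_filter, hp, true_and]
    by_contra! ⟨hg, h0, h1, h2, h3, h4⟩
    obtain ⟨q, hq, hRq, hqH⟩ := hg
    have hqQ := hHQ p q hq hRq hqH
    have hcop := coprime_cosetPoint hn hn0 hRQ hβR hQH (p := p) h0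
    have hqb : ¬ q ∣ (cosetPoint α β Q p).2 := fun hqb => by
      rcases dvd_or_sq_dvd_of_sq_dvd_homEval hn hn1 hq
        (not_dvd_of_natAbs_lt (leadingCoeff_ne_zero.2 hf) (by omega)) hqb hqH with ha | hb
      · exact h0 q hq hRq hqQ ha hqb
      · exact h1 q hq hRq hqQ hb
    rcases le_or_gt q (Q * (N + 1)) with h5 | h5
    · exact h2 q hq hRq h5 hqQ hqb hqH
    rcases le_or_gt q (K * (Q * (N + 1)) ^ 2) with h6 | h6
    · exact h3 hcop q hq hRq h5 (h6.trans (Nat.mul_le_mul_right _ (Nat.le_succ K))) hqb hqH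
    · exact h4 hcop q hq hRq h6 hqQ hqb hqH
  have hcard : (N : ℝ) ^ 2 ≤ G.card + (Z₀.card + (Z₁.card + (Z₂.card + (Z₃.card + Z₄.card)))) := by
    have h1 : N ^ 2 ≤ G.card + (Z₀.card + (Z₁.card + (Z₂.card + (Z₃.card + Z₄.card)))) := by
      calc N ^ 2 = (box N).card := by
            rw [box, Finset.card_product, Nat.card_Icc, Nat.add_sub_cancel, sq]
        _ ≤ _ := Finset.card_le_card hcover
        _ ≤ _ := by
          refine (Finset.card_union_le _ _).trans (Nat.add_le_add_left ?_ _)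
          refine (Finset.card_union_le _ _).trans (Nat.add_le_add_left ?_ _)
          refine (Finset.card_union_le _ _).trans (Nat.add_le_add_left ?_ _)
          refine (Finset.card_union_le _ _).trans (Nat.add_le_add_left ?_ _)
          exact Finset.card_union_le _ _
    exact_mod_cast h1
  have hR0 : R ≠ 0 := by omega
  have b0 : (Z₀.card : ℝ) ≤ _ := card_not_coprime_le hQ hα hβ hR0
    (Finset.filter_subset _ _ : Z₀ ⊆ box N)
    fun p hp => (Finset.mem_filter.1 hp).2
  have b1 : (Z₁.card : ℝ) ≤ _ := card_sq_dvd_snd_le hQ hα hβ hR0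
    (Finset.filter_subset _ _ : Z₁ ⊆ box N)
    fun p hp => (Finset.mem_filter.1 hp).2
  have b2 : (Z₂.card : ℝ) ≤ _ := card_small_sq_dvd_le hr hr0 hf hn hR0 (by omega) (by omega)
    (Finset.filter_subset _ _ : Z₂ ⊆ box N) fun p hp => (Finset.mem_filter.1 hp).2
  have b3 : (Z₃.card : ℝ) ≤ _ := card_medium_sq_dvd_le hr hr0 hf hn hQ hα hβ (by omega) (by omega)
    (Finset.filter_subset _ _ : Z₃ ⊆ box N) (fun p hp => (Finset.mem_filter.1 hp).2.1)
    fun p hp => (Finset.mem_filter.1 hp).2.2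
  have b4 := hK (Finset.filter_subset _ _ : Z₄ ⊆ box N)
    (fun p hp => (Finset.mem_filter.1 hp).2.1) fun p hp => (Finset.mem_filter.1 hp).2.2
  have hN1' : (1 : ℝ) ≤ N := by exact_mod_cast hN1
  have b4' : (Z₄.card : ℝ) ≤ N ^ 2 / 8 := by
    refine b4.trans ?_
    have hQ0 : (0 : ℝ) < Q := by exact_mod_cast hQ
    push_cast
    rw [mul_pow, div_mul_eq_mul_div, one_mul, div_le_div_iff₀ (by positivity) (by norm_num)]
    have h1 : ((N : ℝ) + 1) ^ 2 ≤ (2 * N) ^ 2 := by gcongr; linarith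
    nlinarith [mul_le_mul_of_nonneg_left h1 (sq_nonneg (Q : ℝ))]
  have hRbig : (N : ℝ) ^ 2 / R * (f.natDegree + 3) ≤ N ^ 2 / 8 := by
    have hRR : ((8 * (f.natDegree + 3) : ℕ) : ℝ) ≤ R := Nat.cast_le.2 (by omega)
    push_cast at hRR
    have hRpos : (0 : ℝ) < R := by positivity
    rw [div_mul_eq_mul_div, div_le_div_iff₀ hRpos (by norm_num)]
    nlinarith [mul_le_mul_of_nonneg_left hRR (sq_nonneg (N : ℝ))]
  have h2 : 2 * (N : ℝ) ^ 2 / R = 2 * (N ^ 2 / R) := mul_div_assoc _ _ _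
  rw [h2] at b0
  rw [mul_add (f.natDegree : ℝ)] at b2
  linarith [sq_nonneg (N : ℝ)]

lemma exists_pow_eq_of_pow_eq_one {G : Type*} [Group G] [Finite G] [IsCyclic G] {n e q : ℕ}
    (he : e = n.gcd (Nat.card G)) (hq : Nat.card G = e * q) {x : G} (hx : x ^ q = 1) :
    ∃ y : G, y ^ n = x := by
  obtain ⟨g, hg⟩ := IsCyclic.exists_ofOrder_eq_natCard (α := G)
  obtain ⟨k, rfl⟩ := (mem_powers_iff_mem_zpowers.2
    ((Subgroup.eq_top_iff' _).1 ((Subgroup.zpowers g).eq_top_of_card_eq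
      ((Nat.card_zpowers g).trans hg)) x) : x ∈ Submonoid.powers g)
  have hq0 : 0 < q := Nat.pos_of_ne_zero fun h0 => Nat.card_pos.ne' (hq.trans (by simp [h0]))
  simp only at hx ⊢
  rw [← pow_mul, ← orderOf_dvd_iff_pow_eq_one, hg, hq] at hx
  obtain ⟨m, rfl⟩ := Nat.dvd_of_mul_dvd_mul_right hq0 hx
  refine ⟨(g ^ (n.gcdA (Nat.card G))) ^ m, ?_⟩
  have h1 : g ^ (e : ℤ) = (g ^ n.gcdA (Nat.card G)) ^ n := by
    rw [he, Nat.gcd_eq_gcd_ab, zpow_add, mul_comm (n : ℤ), zpow_mul, zpow_mul, zpow_natCast,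
      zpow_natCast, pow_card_eq_one', one_zpow, mul_one]
  rw [← pow_mul, mul_comm m, pow_mul, ← h1, zpow_natCast, ← pow_mul]

/-- For large `p`, the form of degree `n` attached to `f` takes every nonzero value modulo `p`. -/
lemma exists_pow_mul_eval_eq {f u v : ℤ[X]} {r : ℤ} (hr : u * f + v * derivative f = C r)
    (hr0 : r ≠ 0) (hdeg : 0 < f.natDegree) {n : ℕ} (hn : f.natDegree ≤ n) :
    ∃ P : ℕ, ∀ (p : ℕ) [Fact p.Prime], P ≤ p → ∀ c : ZMod p, c ≠ 0 →
      ∃ t b : ZMod p, b ^ n * aeval t f = c := by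
  obtain ⟨P₀, D, -, hP⟩ := card_values_in_coset n (hdeg.trans_le hn)
  refine ⟨P₀ + r.natAbs + f.leadingCoeff.natAbs + 1, fun p _ hp c hc => ?_⟩
  have hpp := Fact.out (p := p.Prime)
  have hf : f ≠ 0 := ne_zero_of_natDegree_gt hdeg
  have hd := natDegree_map_zmod (f := f) (l := p)
    (not_dvd_of_natAbs_lt (leadingCoeff_ne_zero.2 hf) (by omega))
  have hcard : Nat.card (ZMod p)ˣ = p - 1 := by
    rw [Nat.card_eq_fintype_card, ZMod.card_units]
  obtain ⟨q, hq⟩ := Nat.gcd_dvd_right n (p - 1)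
  have h1 := hP p (by omega) (n.gcd (p - 1)) q (Nat.gcd_pos_of_pos_left _ (by omega))
    (Nat.gcd_le_left _ (by omega)) (by have := hpp.one_lt; omega) _ (hd.trans_le hn)
    (hdeg.trans_eq hd.symm)
    (separable_map_zmod hr (not_dvd_of_natAbs_lt hr0 (by omega))) c hc
  have h2 := Nat.pos_of_mul_pos_left (hpp.pos.trans_le h1)
  obtain ⟨t, ht⟩ := Finset.card_pos.1 h2
  obtain ⟨-, ht0, htq⟩ := Finset.mem_filter.1 ht
  obtain ⟨y, hy⟩ := exists_pow_eq_of_pow_eq_one (n := n) (q := q)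
    (x := Units.mk0 c hc / Units.mk0 _ ht0) rfl (by rw [hcard]; exact hq) (by
      rw [div_pow, div_eq_one, Units.ext_iff]
      simpa using htq.symm)
  refine ⟨t, y, ?_⟩
  have h3 := congrArg Units.val hy
  rw [Units.val_pow_eq_pow_val, Units.val_div_eq_div_val, Units.val_mk0, Units.val_mk0] at h3
  have h4 : aeval t f = (f.map (Int.castRingHom (ZMod p))).eval t := by
    rw [eval_map, aeval_def]; rfl
  rw [h3, h4, div_mul_cancel₀ _ ht0]

lemma card_le_of_homEval_mem {f : ℤ[X]} (hdeg : 0 < f.natDegree) {n : ℕ} (hn : f.natDegree ≤ n)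
    {α β Q N : ℕ} (hQ : 0 < Q) (V : Finset ℤ) {Z : Finset (ℕ × ℕ)} (hZ : Z ⊆ box N)
    (h : ∀ p ∈ Z, homEval f n (cosetPoint α β Q p).1 (cosetPoint α β Q p).2 ∈ V) :
    Z.card ≤ f.natDegree * (V.card * N) := by
  classical
  have h1 : Z.card ≤ f.natDegree * (V ×ˢ Finset.Icc 1 N).card := by
    refine Finset.card_le_mul_card_image_of_maps_to
      (f := fun p => (homEval f n (cosetPoint α β Q p).1 (cosetPoint α β Q p).2, p.2))
      (fun p hp => Finset.mem_product.2 ⟨h p hp, (Finset.mem_product.1 (hZ hp)).2⟩) _ ?_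
    rintro ⟨w, y⟩ hk
    have hy : 0 < y := (Finset.mem_Icc.1 (Finset.mem_product.1 hk).2).1
    set b : ℚ := ((β + Q * y : ℕ) : ℚ) with hb
    have hb0 : b ≠ 0 := by rw [hb]; positivity
    set g : ℚ[X] := f.map (Int.castRingHom ℚ) - C (w / b ^ n) with hg
    have hgd : g.natDegree = f.natDegree := by
      rw [hg, natDegree_sub_C, natDegree_map_eq_of_injective (RingHom.injective_int _)]
    have hg0 : g ≠ 0 := ne_zero_of_natDegree_gt (hdeg.trans_eq hgd.symm)
    rw [← hgd]
    refine le_trans (Finset.card_le_card_of_injOn (t := g.roots.toFinset)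
      (fun p => ((α + Q * p.1 : ℕ) : ℚ) / b) (fun p hp => ?_) fun p hp p' hp' he => ?_)
      ((Multiset.toFinset_card_le _).trans (card_roots' g))
    · obtain ⟨-, hp⟩ := Finset.mem_filter.1 hp
      obtain ⟨hw, hpy⟩ := Prod.mk.inj hp
      refine Multiset.mem_toFinset.2 ((mem_roots hg0).2 ?_)
      have h2 := intCast_homEval (A := ℚ) hn (a := (cosetPoint α β Q p).1)
        (b := (cosetPoint α β Q p).2) (t := ((α + Q * p.1 : ℕ) : ℚ) / b) (by
          have : (((cosetPoint α β Q p).2 : ℤ) : ℚ) = b := by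
            rw [hb, ← hpy, Int.cast_natCast]; rfl
          rw [this, mul_div_cancel₀ _ hb0, Int.cast_natCast]; rfl)
      have h3 : (((cosetPoint α β Q p).2 : ℤ) : ℚ) = b := by
        rw [hb, ← hpy, Int.cast_natCast]; rfl
      rw [hw, h3] at h2
      have h4 : (f.map (Int.castRingHom ℚ)).eval (((α + Q * p.1 : ℕ) : ℚ) / b) =
          aeval (((α + Q * p.1 : ℕ) : ℚ) / b) f := by
        rw [eval_map, aeval_def]; rfl
      rw [IsRoot.def, hg, eval_sub, eval_C, h4, h2, mul_div_cancel_left₀ _ (pow_ne_zero _ hb0),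
        sub_self]
    · obtain ⟨-, hp⟩ := Finset.mem_filter.1 hp
      obtain ⟨-, hp'⟩ := Finset.mem_filter.1 hp'
      have h5 : α + Q * p.1 = α + Q * p'.1 := by exact_mod_cast (div_left_inj' hb0).1 he
      exact Prod.ext (Nat.eq_of_mul_eq_mul_left hQ (Nat.add_left_cancel h5))
        ((Prod.mk.inj hp).2.trans (Prod.mk.inj hp').2.symm)
  rwa [Finset.card_product, Nat.card_Icc, Nat.add_sub_cancel] at h1

lemma exists_squarefree_mul_sq {m : ℤ} (hm : m ≠ 0) :
    ∃ s t : ℤ, Squarefree s ∧ t ≠ 0 ∧ m = s * t ^ 2 := by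
  obtain ⟨a, b, hab, ha⟩ := Nat.sq_mul_squarefree m.natAbs
  refine ⟨m.sign * a, b, ?_, ?_, ?_⟩
  · rw [← Int.squarefree_natAbs, Int.natAbs_mul, Int.natAbs_sign_of_ne_zero hm, one_mul,
      Int.natAbs_natCast]
    exact ha
  · rintro h
    rw [Nat.cast_eq_zero] at h
    simp only [h, ne_eq, OfNat.ofNat_ne_zero, not_false_eq_true, zero_pow, zero_mul] at hab
    exact hm (Int.natAbs_eq_zero.1 hab.symm)
  · conv_lhs => rw [← Int.sign_mul_natAbs m, ← hab]
    push_cast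
    ring

lemma exists_nat_modEq_and_cast_eq {m : ℤ} {p : ℕ} [NeZero p] (hm : m ≠ 0)
    (h : IsCoprime m p) (c : ℤ) (x : ZMod p) :
    ∃ α : ℕ, α ≤ m.natAbs * p ∧ (α : ℤ) ≡ c [ZMOD m] ∧ (α : ZMod p) = x := by
  obtain ⟨u, v, huv⟩ := h
  set z : ℤ := c * (v * p) + x.val * (u * m) with hz
  have hQ : 0 < ((m.natAbs * p : ℕ) : ℤ) := by
    have := NeZero.pos p
    have := Int.natAbs_pos.2 hm
    positivity
  have h1 := Int.emod_nonneg z hQ.ne'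
  have h2 := Int.emod_lt_of_pos z hQ
  obtain ⟨α, hα⟩ := Int.eq_ofNat_of_zero_le h1
  have h3 : (α : ℤ) ≡ z [ZMOD (m.natAbs * p : ℕ)] := hα ▸ Int.mod_modEq _ _
  refine ⟨α, by omega, ?_, ?_⟩
  · refine (h3.of_dvd ?_).trans (Int.modEq_iff_dvd.2 ⟨c * u - x.val * u, ?_⟩)
    · rw [Nat.cast_mul]
      exact (Int.dvd_natAbs.2 dvd_rfl).mul_right _
    · linear_combination -c * huv
  · have h4 := (ZMod.intCast_eq_intCast_iff _ _ _).2
      (h3.of_dvd (by rw [Nat.cast_mul]; exact dvd_mul_left _ _) : (α : ℤ) ≡ z [ZMOD p])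
    rw [Int.cast_natCast] at h4
    have h5 : ((z : ℤ) : ZMod p) = ((x.val : ℤ) : ZMod p) := by
      rw [ZMod.intCast_eq_intCast_iff]
      refine Int.modEq_iff_dvd.2 ⟨x.val * v - c * v, ?_⟩
      linear_combination -x.val * huv
    rw [h4, h5, Int.cast_natCast, ZMod.natCast_zmod_val]

lemma infinite_of_sq_mul_values {f : ℤ[X]} (hdeg : 0 < f.natDegree) {n : ℕ}
    (hn : f.natDegree ≤ n) {α β Q : ℕ} (hQ : 0 < Q) {t : ℤ} {P : ℕ × ℕ → Prop} [DecidablePred P]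
    {𝒟 : Set ℤ}
    (hP : ∀ p, 0 < p.2 → P p → ∃ d ∈ 𝒟, homEval f n (cosetPoint α β Q p).1 (cosetPoint α β Q p).2 =
      d * t ^ 2)
    (h : ∀ᶠ N : ℕ in Filter.atTop, (N : ℝ) ^ 2 / 2 ≤ ((box N).filter P).card) : 𝒟.Infinite := by
  intro hfin
  obtain ⟨N₁, hN₁⟩ := Filter.eventually_atTop.1 h
  set V := hfin.toFinset.image fun d => d * t ^ 2 with hV
  set N := max N₁ (2 * (f.natDegree * V.card) + 1) with hN
  have h1 := hN₁ N (le_max_left _ _)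
  have h2 := card_le_of_homEval_mem hdeg hn hQ (N := N) V (Finset.filter_subset P _)
    fun p hp => by
      obtain ⟨d, hd, he⟩ := hP p (mem_box.1 (Finset.mem_filter.1 hp).1).2.1
        (Finset.mem_filter.1 hp).2
      exact Finset.mem_image.2 ⟨d, hfin.mem_toFinset.2 hd, he.symm⟩
  have h3 : (((box N).filter P).card : ℝ) ≤ f.natDegree * (V.card * N) := by exact_mod_cast h2
  have h4 : (2 * (f.natDegree * V.card) + 1 : ℝ) ≤ N := by exact_mod_cast le_max_right N₁ _
  nlinarith

lemma eq_mul_sq_of_modEq {s t h : ℤ} (hst : s * t ^ 2 ≠ 0) {R : ℕ}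
    (hR : (s * t ^ 2).natAbs ≤ R) (hs : Squarefree s)
    (hh : h ≡ s * t ^ 2 [ZMOD s * t ^ 2 * R.factorial])
    (hsq : ∀ q : ℕ, q.Prime → R < q → ¬ (q : ℤ) ^ 2 ∣ h) :
    ∃ d : ℤ, Squarefree d ∧ h = d * t ^ 2 := by
  obtain ⟨w, hw⟩ := Int.modEq_iff_dvd.1 hh.symm
  have hs0 : s ≠ 0 := hs.ne_zero
  have hsR : s ∣ R.factorial := by
    rw [← Int.natAbs_dvd, Int.natCast_dvd_natCast]
    refine Nat.dvd_factorial (Int.natAbs_pos.2 hs0) (le_trans ?_ hR)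
    rw [Int.natAbs_mul]
    exact Nat.le_mul_of_pos_right _ (Int.natAbs_pos.2 (right_ne_zero_of_mul hst))
  refine ⟨s * (1 + R.factorial * w), ?_, by linear_combination hw⟩
  have hcop : ∀ {x : ℤ}, x ∣ R.factorial → IsCoprime x (1 + R.factorial * w) := by
    rintro x ⟨y, hy⟩
    exact ⟨-(y * w), 1, by rw [hy]; ring⟩
  rw [squarefree_mul_iff]
  refine ⟨(hcop hsR).isRelPrime, hs, ?_⟩
  rw [← Int.squarefree_natAbs, Nat.squarefree_iff_prime_squarefree]
  intro q hq hqd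
  rw [← sq, ← Int.natCast_dvd, Nat.cast_pow] at hqd
  rcases le_or_gt q R with hqR | hqR
  · have h1 := (hcop (Int.natCast_dvd_natCast.2 (Nat.dvd_factorial hq.pos hqR))).isUnit_of_dvd'
      dvd_rfl ((dvd_pow_self _ two_ne_zero).trans hqd)
    exact (Nat.prime_iff_prime_int.1 hq).not_isUnit h1
  · refine hsq q hq hqR ?_
    rw [show h = s * t ^ 2 * (1 + R.factorial * w) by linear_combination hw]
    exact hqd.mul_left _

lemma exists_infinite_squarefree {f : ℤ[X]} (hdeg : 0 < f.natDegree)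
    (hsep : (f.map (Int.castRingHom ℚ)).Separable)
    (hfac : ∀ g : ℤ[X], Irreducible g → g ∣ f → 0 < g.natDegree → g.natDegree ≤ 6)
    {n : ℕ} (hn : f.natDegree ≤ n) (hn1 : n ≤ f.natDegree + 1) :
    ∃ N₀ : ℕ, ∀ p : ℕ, p.Prime → N₀ ≤ p → ∀ k : ℤ, ¬ ((p : ℤ) ∣ k) →
      {d : ℤ | Squarefree d ∧ d ≡ k [ZMOD (p : ℤ)] ∧
        ∃ a b t : ℤ, b ≠ 0 ∧ t ≠ 0 ∧ homEval f n a b = d * t ^ 2}.Infinite := by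
  classical
  have hf : f ≠ 0 := ne_zero_of_natDegree_gt hdeg
  have hn0 : 0 < n := hdeg.trans_le hn
  obtain ⟨r, hr0, u, v, hr⟩ := exists_bezout hsep
  obtain ⟨R₀, hR₀⟩ := exists_card_sq_free_values hr hr0 hf hfac hn hn0 hn1
  obtain ⟨P, hP⟩ := exists_pow_mul_eval_eq hr hr0 hdeg hn
  obtain ⟨a₀, ha₀⟩ : ∃ a₀ : ℤ, f.eval a₀ ≠ 0 := by
    by_contra! h
    exact hf (Polynomial.funext fun x => (h x).trans eval_zero.symm)
  obtain ⟨s, t, hs, ht, hst⟩ := exists_squarefree_mul_sq ha₀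
  set R := R₀ + (f.eval a₀).natAbs with hR
  refine ⟨P + R + 1, fun p hp hNp k hk => ?_⟩
  have hfact : Fact p.Prime := ⟨hp⟩
  have hpp : Prime (p : ℤ) := Nat.prime_iff_prime_int.1 hp
  have hpf : ¬ (p : ℤ) ∣ f.eval a₀ := not_dvd_of_natAbs_lt ha₀ (by omega)
  have hpt : ¬ (p : ℤ) ∣ t := fun h => hpf (hst ▸ (h.pow two_ne_zero).mul_left s)
  have hpR : ¬ (p : ℤ) ∣ R.factorial := fun h => by
    have := (hp.dvd_factorial).1 (Int.natCast_dvd_natCast.1 h)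
    omega
  set m : ℤ := f.eval a₀ * R.factorial with hm
  have hm0 : m ≠ 0 := mul_ne_zero ha₀ (by exact_mod_cast R.factorial_ne_zero)
  have hmp : IsCoprime m p :=
    ((Prime.coprime_iff_not_dvd hpp).2 (hpp.not_dvd_mul hpf hpR)).symm
  have hc : ((k * t ^ 2 : ℤ) : ZMod p) ≠ 0 := by
    rw [Ne, ZMod.intCast_zmod_eq_zero_iff_dvd]
    exact hpp.not_dvd_mul hk fun h => hpt (hpp.dvd_of_dvd_pow h)
  obtain ⟨x, y, hxy⟩ := hP p (by omega) _ hc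
  obtain ⟨α, hα, hαa, hαx⟩ := exists_nat_modEq_and_cast_eq hm0 hmp a₀ (y * x)
  obtain ⟨β, hβ, hβ1, hβy⟩ := exists_nat_modEq_and_cast_eq hm0 hmp 1 y
  set Q := m.natAbs * p with hQdef
  have hQ : 0 < Q := Nat.mul_pos (Int.natAbs_pos.2 hm0) hp.pos
  have hmQ : m ∣ Q := by
    rw [hQdef, Nat.cast_mul]
    exact (Int.dvd_natAbs.2 dvd_rfl).mul_right _
  have hH : homEval f n α β ≡ k * t ^ 2 [ZMOD p] := by
    rw [← ZMod.intCast_eq_intCast_iff, ← hxy, intCast_homEval hn (t := x), Int.cast_natCast, hβy]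
    rw [Int.cast_natCast, Int.cast_natCast, hαx, hβy]
  refine infinite_of_sq_mul_values (α := α) (β := β) hdeg hn hQ (t := t) (fun z hz0 hz => ?_) <|
    hR₀ (R := R) (by omega) ha₀ hQ hα hβ hmQ hαa hβ1 fun q hq hRq hqQ => ?_
  · set a := (cosetPoint α β Q z).1
    set b := (cosetPoint α β Q z).2 with hb
    have hmod := homEval_cosetPoint_modEq f n α β Q z
    have h1 : homEval f n a b ≡ f.eval a₀ [ZMOD m] := by
      rw [← homEval_one f hn a₀]
      exact (hmod.of_dvd hmQ).trans (homEval_modEq f n hαa hβ1)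
    rw [hm, hst] at h1
    obtain ⟨d, hd, he⟩ := eq_mul_sq_of_modEq (hst ▸ ha₀) (by rw [← hst]; omega) hs h1 hz
    refine ⟨d, ⟨hd, ?_, a, b, t, ?_, ht, he⟩, he⟩
    · have h2 : d * t ^ 2 ≡ k * t ^ 2 [ZMOD p] :=
        he ▸ (hmod.of_dvd (by rw [hQdef, Nat.cast_mul]; exact dvd_mul_left _ _)).trans hH
      have h3 := Int.modEq_iff_dvd.1 h2
      rw [← sub_mul] at h3
      exact Int.modEq_iff_dvd.2
        ((hpp.dvd_or_dvd h3).resolve_right fun h => hpt (hpp.dvd_of_dvd_pow h))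
    · rw [hb, cosetPoint]
      exact_mod_cast (Nat.add_pos_right β (Nat.mul_pos hQ hz0)).ne'
  · have h1 : q = p := by
      rw [hQdef, hm, Int.natAbs_mul, Int.natAbs_natCast] at hqQ
      rcases hq.dvd_mul.1 hqQ with h | h
      · rcases hq.dvd_mul.1 h with h | h
        · have := Nat.le_of_dvd (Int.natAbs_pos.2 ha₀) h
          omega
        · have := hq.dvd_factorial.1 h
          omega
      · exact (Nat.prime_dvd_prime_iff_eq hq hp).1 h
    rw [h1, hH.dvd_iff]
    exact hpp.not_dvd_mul hk fun h => hpt (hpp.dvd_of_dvd_pow h)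

end TwistSieve

open TwistSieve in
theorem stmt_3 (f : Polynomial ℤ) (hdeg : 0 < f.natDegree)
    (hsep : (f.map (Int.castRingHom ℚ)).Separable)
    (hfac : ∀ g : Polynomial ℚ, Irreducible g → g ∣ f.map (Int.castRingHom ℚ) →
      g.natDegree ≤ 6) :
    ∃ N₀ : ℕ, ∀ p : ℕ, p.Prime → N₀ ≤ p → ∀ k : ℤ, ¬ ((p : ℤ) ∣ k) →
      {d : ℤ | Squarefree d ∧ d ≡ k [ZMOD (p : ℤ)] ∧
        ∃ x y : ℚ, y ≠ 0 ∧ (d : ℚ) * y ^ 2 = Polynomial.aeval x f}.Infinite := by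
  obtain ⟨m, hm, hm1⟩ : ∃ m, f.natDegree ≤ 2 * m ∧ 2 * m ≤ f.natDegree + 1 :=
    ⟨(f.natDegree + 1) / 2, by omega, by omega⟩
  have hfac' : ∀ g : ℤ[X], Irreducible g → g ∣ f → 0 < g.natDegree → g.natDegree ≤ 6 := by
    intro g hg hgf hpos
    have hirr := (IsPrimitive.Int.irreducible_iff_irreducible_map_cast
      (hg.isPrimitive hpos.ne')).1 hg
    have := hfac _ hirr (Polynomial.map_dvd _ hgf)
    rwa [natDegree_map_eq_of_injective (RingHom.injective_int _)] at this
  obtain ⟨N₀, hN₀⟩ := exists_infinite_squarefree hdeg hsep hfac' hm hm1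
  refine ⟨N₀, fun p hp hNp k hk => (hN₀ p hp hNp k hk).mono ?_⟩
  rintro d ⟨hd, hdk, a, b, t, hb, ht, h⟩
  have hb' : (b : ℚ) ≠ 0 := Int.cast_ne_zero.2 hb
  refine ⟨hd, hdk, a / b, t / b ^ m, div_ne_zero (Int.cast_ne_zero.2 ht) (pow_ne_zero _ hb'), ?_⟩
  have h1 := intCast_homEval hm (a := a) (b := b) (t := (a / b : ℚ))
    (by rw [mul_div_cancel₀ _ hb'])
  rw [h, Int.cast_mul, Int.cast_pow] at h1
  rw [div_pow, ← pow_mul, mul_comm m, mul_div_assoc', h1,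
    mul_div_cancel_left₀ _ (pow_ne_zero _ hb')]
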